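/- Let h = 2n+1 be an odd integer with n ≥ 1, and suppose either i = 0 and k = 3, or 1 ≤ i < n and k = 1. Let σ be an h-bar-core with exactly k addable i-nodes and τ = ψ_i(σ), so that P_{σ,2} and P_{τ,2} form a [2:k]-pair of residue i. Let α ◁ β ◁ γ be the three exceptional partitions of P_{σ,2} and α̂ ◁ β̂ ◁ γ̂ the three exceptional partitions of P_{τ,2}. Then there is an integer d ≥ 1 such that: (1) ∂α = ∂γ = ∂β̂ = d and α, β̂ and γ all have the same colour; (2) ∂α̂ = ∂β = ∂γ̂ = d − 1 and α̂, β and γ̂ all have the same colour; (3) for every λ ∈ P_{σ,2} with no removable i-node and |∂λ − d| ≤ 1, either γ ◁ λ and β̂ ◁ ψ_i(λ), or λ ◁ α and ψ_i(λ) ◁ β̂; (4) for every λ ∈ P_{σ,2} with no removable i-node and |∂λ − (d−1)| ≤ 1, either β ◁ λ and γ̂ ◁ ψ_i(λ), or λ ◁ β and ψ_i(λ) ◁ α̂. -/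

import Mathlib

/-- A partition: a weakly decreasing sequence of non-negative integers with
finite sum (finitely many nonzero parts), indexed from 0 (so `parts 0` is λ₁). -/
structure BPartition where
  parts : ℕ →₀ ℕ
  antitone : ∀ r, parts (r + 1) ≤ parts r

namespace BPartition

/-- The multiset of positive parts of a partition. -/
def partsM (lam : BPartition) : Multiset ℕ :=
  lam.parts.support.val.map (fun r => lam.parts r)

/-- The Young diagram: nodes `(r, c)` with rows indexed from 0 and columns from 1. -/
def diagram (lam : BPartition) : Set (ℕ × ℕ) :=
  {x | 1 ≤ x.2 ∧ x.2 ≤ lam.parts x.1}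

/-- A partition is strict if λ_r > λ_{r+1} whenever λ_r > 0. -/
def IsStrict (lam : BPartition) : Prop :=
  ∀ r, 0 < lam.parts r → lam.parts (r + 1) < lam.parts r

/-- A partition is h-strict if each part is either strictly bigger than the next,
or positive and divisible by h, or zero. -/
def IsHStrict (h : ℕ) (lam : BPartition) : Prop :=
  ∀ r, lam.parts (r + 1) < lam.parts r ∨ (0 < lam.parts r ∧ h ∣ lam.parts r) ∨ lam.parts r = 0

/-- An h-strict partition is restricted if for every r either λ_{r+1} > λ_r − h,
or λ_{r+1} = λ_r − h and h does not divide λ_r. -/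
def IsRestricted (h : ℕ) (lam : BPartition) : Prop :=
  ∀ r, lam.parts r < lam.parts (r + 1) + h ∨
    (lam.parts (r + 1) + h = lam.parts r ∧ ¬ h ∣ lam.parts r)

/-- The residue of a node in column c (1-indexed): the smaller of the residues of
c − 1 and of −c modulo h. -/
def colRes (h c : ℕ) : ℕ := min ((c - 1) % h) ((h - c % h) % h)

/-- `x` is an addable i-node of `lam`. -/
def Addable (h i : ℕ) (lam : BPartition) (x : ℕ × ℕ) : Prop :=
  colRes h x.2 = i ∧ x ∉ diagram lam ∧
  ∃ nu : BPartition, IsHStrict h nu ∧ diagram lam ⊆ diagram nu ∧ x ∈ diagram nu ∧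
    ∀ y ∈ diagram nu, y ∉ diagram lam → colRes h y.2 = i

/-- `x` is a removable i-node of `lam`. -/
def Removable (h i : ℕ) (lam : BPartition) (x : ℕ × ℕ) : Prop :=
  x ∈ diagram lam ∧
  ∃ mu : BPartition, IsHStrict h mu ∧ diagram mu ⊆ diagram lam ∧ x ∉ diagram mu ∧
    ∀ y ∈ diagram lam, y ∉ diagram mu → colRes h y.2 = i

/-- Removal of a single h-bar from `lam` giving `mu`, recording the value `v`:
either a part `v ≥ h` is replaced by `v − h` (deleted if `v = h`), or two parts
summing to `h` are deleted, in which case `v` is the larger of the two. -/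
def barStepRec (h : ℕ) (lam mu : BPartition) (v : ℕ) : Prop :=
  IsHStrict h mu ∧
  ((v = h ∧ v ∈ partsM lam ∧ partsM mu = (partsM lam).erase v) ∨
   (h < v ∧ v ∈ partsM lam ∧ partsM mu = (v - h) ::ₘ (partsM lam).erase v) ∨
   (∃ a b : ℕ, a + b = h ∧ a ∈ partsM lam ∧ b ∈ (partsM lam).erase a ∧
      v = max a b ∧ partsM mu = ((partsM lam).erase a).erase b))

/-- Removal of a single h-bar. -/
def barStep (h : ℕ) (lam mu : BPartition) : Prop :=
  ∃ v, barStepRec h lam mu v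

/-- An h-bar-core: an h-strict partition from which no h-bar can be removed. -/
def IsBarCore (h : ℕ) (lam : BPartition) : Prop :=
  IsHStrict h lam ∧ ∀ mu, ¬ barStep h lam mu

/-- A chain of `w` h-bar removals from `lam` down to `mu`. -/
def barChain (h : ℕ) : ℕ → BPartition → BPartition → Prop
  | 0, lam, mu => lam = mu
  | w + 1, lam, mu => ∃ nu, barStep h lam nu ∧ barChain h w nu mu

/-- `lam ∈ P_{τ,w}`: `lam` is h-strict with h-bar-core `tau` and h-bar-weight `w`. -/
def InBlock (h : ℕ) (tau : BPartition) (w : ℕ) (lam : BPartition) : Prop :=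
  IsHStrict h lam ∧ IsBarCore h tau ∧ barChain h w lam tau

/-- The left-to-right order on node positions along the edge of a Young diagram:
smaller column first; within a column, larger row first. -/
def posLE (x y : ℕ × ℕ) : Prop := x.2 < y.2 ∨ (x.2 = y.2 ∧ y.1 ≤ x.1)

/-- `x` is a normal i-node: a removable i-node surviving (as a − sign) in the
reduced i-signature; equivalently, every window of the i-signature ending at `x`
contains strictly more removable than addable i-nodes. -/
def Normal (h i : ℕ) (lam : BPartition) (x : ℕ × ℕ) : Prop :=
  Removable h i lam x ∧ ∀ z : ℕ × ℕ, posLE z x →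
    Set.ncard {y | Addable h i lam y ∧ posLE z y ∧ posLE y x} <
      Set.ncard {y | Removable h i lam y ∧ posLE z y ∧ posLE y x}

/-- `x` is a conormal i-node: an addable i-node surviving (as a + sign) in the
reduced i-signature. -/
def Conormal (h i : ℕ) (lam : BPartition) (x : ℕ × ℕ) : Prop :=
  Addable h i lam x ∧ ∀ z : ℕ × ℕ, posLE x z →
    Set.ncard {y | Removable h i lam y ∧ posLE x y ∧ posLE y z} <
      Set.ncard {y | Addable h i lam y ∧ posLE x y ∧ posLE y z}

/-- The node set of ψ_i(λ): add the leftmost s − r conormal i-nodes if s ≥ r,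
remove the rightmost r − s normal i-nodes if r > s, where r = #normal and
s = #conormal i-nodes. -/
noncomputable def psiSet (h i : ℕ) (lam : BPartition) : Set (ℕ × ℕ) :=
  if Set.ncard {x | Normal h i lam x} ≤ Set.ncard {x | Conormal h i lam x} then
    diagram lam ∪ {x | Conormal h i lam x ∧
      Set.ncard {y | Conormal h i lam y ∧ posLE y x} ≤
        Set.ncard {x | Conormal h i lam x} - Set.ncard {x | Normal h i lam x}}
  else
    diagram lam \ {x | Normal h i lam x ∧
      Set.ncard {y | Normal h i lam y ∧ posLE x y} ≤
        Set.ncard {x | Normal h i lam x} - Set.ncard {x | Conormal h i lam x}}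

open Classical in
/-- The involution ψ_i. -/
noncomputable def psi (h i : ℕ) (lam : BPartition) : BPartition :=
  if hex : ∃ mu : BPartition, diagram mu = psiSet h i lam then hex.choose else lam

/-- The set of occupied positions of the abacus display of a strict partition. -/
def abacus (lam : BPartition) : Set ℤ :=
  {a | a = 0 ∨ (0 < a ∧ a.toNat ∈ partsM lam) ∨ (a < 0 ∧ (-a).toNat ∉ partsM lam)}

/-- The dominance order: λ ⊴ μ. -/
def domLE (lam mu : BPartition) : Prop :=
  ∀ r, ∑ s ∈ Finset.range r, lam.parts s ≤ ∑ s ∈ Finset.range r, mu.parts s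

/-- Strict dominance: λ ◁ μ. -/
def domLT (lam mu : BPartition) : Prop := domLE lam mu ∧ lam ≠ mu

/-- Lexicographic order: λ <lex μ. -/
def lexLT (lam mu : BPartition) : Prop :=
  ∃ r, lam.parts r < mu.parts r ∧ ∀ s < r, lam.parts s = mu.parts s

/-- Colexicographic order: λ <colex μ. -/
def colexLT (lam mu : BPartition) : Prop :=
  ∃ r, mu.parts r < lam.parts r ∧ ∀ s, r < s → lam.parts s = mu.parts s

/-- λ ↔ᵢ μ: every node of the symmetric difference of the diagrams has residue i. -/
def Link (h i : ℕ) (lam mu : BPartition) : Prop :=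
  ∀ x : ℕ × ℕ, x ∈ (diagram lam \ diagram mu) ∪ (diagram mu \ diagram lam) →
    colRes h x.2 = i

/-- `a ≤ b` are the bar positions of `lam ∈ P_{τ,2}`: the values recorded by
some two-step removal of h-bars from `lam` down to `tau`. -/
def BarPositions (h : ℕ) (tau lam : BPartition) (a b : ℕ) : Prop :=
  a ≤ b ∧ ∃ (nu : BPartition) (v₁ v₂ : ℕ), barStepRec h lam nu v₁ ∧ barStepRec h nu tau v₂ ∧
    ({a, b} : Multiset ℕ) = {v₁, v₂}

/-- The leg length of the bar of `lam ∈ P_{τ,2}` at bar position `c`. -/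
noncomputable def legLen (h : ℕ) (tau lam : BPartition) (c : ℕ) : ℕ :=
  if h ≤ c then Set.ncard {x : ℕ | c - h < x ∧ x < c ∧ x ∈ partsM lam ∧ x ∈ partsM tau}
  else (h - c) + Set.ncard {x : ℕ | h - c < x ∧ x < c ∧ x ∈ partsM lam ∧ x ∈ partsM tau}

/-- ∂λ: the absolute difference of the two leg lengths of `lam`, whose bar
positions are `a ≤ b`. -/
noncomputable def ddd (h : ℕ) (tau lam : BPartition) (a b : ℕ) : ℕ :=
  max (legLen h tau lam a) (legLen h tau lam b) - min (legLen h tau lam a) (legLen h tau lam b)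

inductive Colour | black | white | grey
deriving DecidableEq

/-- β(τ): the number of parts of τ less than h. -/
def betaCount (h : ℕ) (tau : BPartition) : ℕ :=
  Multiset.card ((partsM tau).filter (fun x => x < h))

/-- The leg length of a 2h-bar of `lam` with larger bar position `b`. -/
noncomputable def legLen2 (h : ℕ) (tau lam : BPartition) (b : ℕ) : ℕ :=
  if 2 * h ≤ b then Set.ncard {x : ℕ | b - 2 * h < x ∧ x < b ∧ x ∈ partsM lam ∧ x ∈ partsM tau}
  else (2 * h - b) + Set.ncard {x : ℕ | 2 * h - b < x ∧ x < b ∧ x ∈ partsM lam ∧ x ∈ partsM tau}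

/-- The colour of `lam ∈ P_{τ,2}` with bar positions `a ≤ b`. -/
noncomputable def colour (h : ℕ) (tau lam : BPartition) (a b : ℕ) : Colour :=
  if 2 ≤ ddd h tau lam a b then Colour.grey
  else if ddd h tau lam a b = 1 then
    if h < b then Colour.grey
    else if (min (legLen h tau lam a) (legLen h tau lam b) + betaCount h tau) % 2 = 1 then
      Colour.black else Colour.white
  else
    if b = a + h ∨ a + b = 2 * h then
      if (legLen2 h tau lam b + 2 * betaCount h tau) % 4 = 0 ∨
         (legLen2 h tau lam b + 2 * betaCount h tau) % 4 = 3 then Colour.black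
      else Colour.white
    else
      if (legLen h tau lam a + betaCount h tau) % 2 = 1 then Colour.black else Colour.white

end BPartition


section S1
namespace BPartition

theorem anti (l : BPartition) {r s : ℕ} (h : r ≤ s) : l.parts s ≤ l.parts r :=
  antitone_nat_of_succ_le l.antitone h

theorem mem_partsM (l : BPartition) (x : ℕ) : x ∈ partsM l ↔ 0 < x ∧ ∃ r, l.parts r = x := by
  unfold partsM
  rw [Multiset.mem_map]
  constructor
  · rintro ⟨r, hr, rfl⟩
    have : l.parts r ≠ 0 := by simpa using hr
    exact ⟨Nat.pos_of_ne_zero this, r, rfl⟩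
  · rintro ⟨h0, r, rfl⟩
    exact ⟨r, by simpa using h0.ne', rfl⟩

theorem pos_of_mem {l : BPartition} {x : ℕ} (h : x ∈ partsM l) : 0 < x :=
  ((mem_partsM l x).1 h).1

/-- column length -/
def cnt (m : Multiset ℕ) (c : ℕ) : ℕ := Multiset.countP (fun x => c ≤ x) m

theorem lower_mem (D : Finset ℕ) (hD : ∀ r s, s ≤ r → r ∈ D → s ∈ D) (r : ℕ) :
    r ∈ D ↔ r < D.card := by
  constructor
  · intro h
    have : Finset.range (r + 1) ⊆ D := fun s hs => hD r s (by simp at hs; omega) h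
    have := Finset.card_le_card this
    simpa using this
  · intro h
    by_contra hr
    have : D ⊆ Finset.range r := by
      intro s hs
      simp only [Finset.mem_range]
      by_contra h2
      exact hr (hD s r (by omega) hs)
    have := Finset.card_le_card this
    simp at this; omega

theorem mem_diag (l : BPartition) (r c : ℕ) :
    (r, c) ∈ diagram l ↔ 1 ≤ c ∧ r < cnt (partsM l) c := by
  have key : 1 ≤ c → (c ≤ l.parts r ↔ r < cnt (partsM l) c) := by
    intro hc
    have := lower_mem (l.parts.support.filter (fun r => c ≤ l.parts r)) (by
      intro r s hs hr
      simp only [Finset.mem_filter, Finsupp.mem_support_iff] at hr ⊢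
      have := anti l hs
      omega) r
    have e : cnt (partsM l) c = (l.parts.support.filter (fun r => c ≤ l.parts r)).card := by
      unfold cnt partsM
      rw [Multiset.countP_map]; rfl
    rw [e, ← this]
    simp only [Finset.mem_filter, Finsupp.mem_support_iff]
    omega
  simp only [diagram, Set.mem_ofPred_eq]
  constructor
  · rintro ⟨h1, h2⟩; exact ⟨h1, (key h1).1 h2⟩
  · rintro ⟨h1, h2⟩; exact ⟨h1, (key h1).2 h2⟩

theorem exists_of_multiset (m : Multiset ℕ) (hm : ∀ x ∈ m, 0 < x) :
    ∃ l : BPartition, partsM l = m := by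
  classical
  let L := m.sort (· ≥ ·)
  have hL : (L : Multiset ℕ) = m := Multiset.sort_eq _ _
  have hs : L.Pairwise (· ≥ ·) := Multiset.pairwise_sort _ _
  have hpos : ∀ x ∈ L, 0 < x := fun x hx => hm x (by rw [← hL]; exact hx)
  let f : ℕ →₀ ℕ := Finsupp.onFinset (Finset.range L.length) (fun r => L.getD r 0) (by
    intro r hr
    simp only [Finset.mem_range]
    by_contra h
    exact hr (List.getD_eq_default _ _ (by omega)))
  have hf : ∀ r, f r = L.getD r 0 := fun r => rfl
  have hsupp : f.support = Finset.range L.length := by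
    ext r
    simp only [Finsupp.mem_support_iff, Finset.mem_range, hf]
    constructor
    · intro hr
      by_contra h
      exact hr (List.getD_eq_default _ _ (by omega))
    · intro hr
      rw [List.getD_eq_getElem _ _ hr]
      exact (hpos _ (List.getElem_mem hr)).ne'
  refine ⟨⟨f, ?_⟩, ?_⟩
  · intro r
    rw [hf, hf]
    by_cases h : r + 1 < L.length
    · rw [List.getD_eq_getElem _ _ h, List.getD_eq_getElem _ _ (by omega : r < L.length)]
      exact (List.pairwise_iff_getElem.1 hs) r (r+1) (by omega) h (by omega)
    · rw [List.getD_eq_default _ _ (by omega)]; exact Nat.zero_le _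
  · unfold partsM
    simp only [hsupp]
    rw [← hL]
    change Multiset.map (fun r => f r) (Multiset.range L.length) = _
    rw [Multiset.range, Multiset.map_coe]
    congr 1
    apply List.ext_getElem
    · simp
    · intro k h1 h2
      rw [List.getElem_map, List.getElem_range, hf, List.getD_eq_getElem _ _ h2]

theorem count_partsM (l : BPartition) (x : ℕ) :
    (partsM l).count x = (l.parts.support.filter (fun r => x = l.parts r)).card := by
  unfold partsM
  rw [Multiset.count_map]; rfl

theorem hstrict_iff (h : ℕ) (l : BPartition) :
    IsHStrict h l ↔ ∀ x, ¬ h ∣ x → (partsM l).count x ≤ 1 := by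
  constructor
  · intro H x hx
    rw [count_partsM]
    rw [Finset.card_le_one]
    intro a ha b hb
    simp only [Finset.mem_filter, Finsupp.mem_support_iff] at ha hb
    by_contra hab
    have key : ∀ a b, a < b → x = l.parts a → x = l.parts b → False := by
      intro a b hab h1 h2
      have h3 := anti l (show a ≤ a+1 by omega)
      have h4 := anti l (show a+1 ≤ b by omega)
      rcases H a with h5 | ⟨_, h5⟩ | h5
      · omega
      · exact hx (h1 ▸ h5)
      · exact hx (by rw [h1, h5]; exact dvd_zero h)
    rcases Nat.lt_or_gt_of_ne hab with h1 | h1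
    · exact key a b h1 ha.2 hb.2
    · exact key b a h1 hb.2 ha.2
  · intro H r
    by_cases h1 : l.parts (r+1) < l.parts r
    · exact Or.inl h1
    by_cases h2 : l.parts r = 0
    · exact Or.inr (Or.inr h2)
    have h3 := l.antitone r
    refine Or.inr (Or.inl ⟨by omega, ?_⟩)
    by_contra h4
    have h5 := H _ h4
    rw [count_partsM, Finset.card_le_one] at h5
    have := h5 r (by simp [h2]) (r+1) (by
      simp only [Finset.mem_filter, Finsupp.mem_support_iff]; omega)
    omega

/-- Sum of excesses over `t`. -/
def FF (m : Multiset ℕ) (t : ℕ) : ℕ := (m.map (fun x => x - t)).sum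

theorem FF_add (a b : Multiset ℕ) (t : ℕ) : FF (a + b) t = FF a t + FF b t := by
  simp [FF]

theorem FF_partsM (l : BPartition) (t N : ℕ) (hN : l.parts.support ⊆ Finset.range N) :
    FF (partsM l) t = ∑ s ∈ Finset.range N, (l.parts s - t) := by
  have : FF (partsM l) t = ∑ s ∈ l.parts.support, (l.parts s - t) := by
    unfold FF partsM
    rw [Multiset.map_map]; rfl
  rw [this]
  apply Finset.sum_subset hN
  intro x _ hx
  have : l.parts x = 0 := by simpa using hx
  omega

theorem supp_bd (l : BPartition) : ∃ N, ∀ M, N ≤ M → l.parts.support ⊆ Finset.range M := by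
  obtain ⟨N, hN⟩ := l.parts.support.exists_nat_subset_range
  exact ⟨N, fun M hM => hN.trans (Finset.range_subset_range.2 hM)⟩

theorem prefix_le_FF (l : BPartition) (t r : ℕ) :
    ∑ s ∈ Finset.range r, l.parts s ≤ FF (partsM l) t + r * t := by
  obtain ⟨N, hN⟩ := supp_bd l
  rw [FF_partsM l t (max N r) (hN _ (le_max_left _ _))]
  have h1 : ∑ s ∈ Finset.range r, l.parts s ≤ ∑ s ∈ Finset.range r, ((l.parts s - t) + t) :=
    Finset.sum_le_sum (fun s _ => by omega)
  rw [Finset.sum_add_distrib, Finset.sum_const, Finset.card_range, smul_eq_mul] at h1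
  have h2 : ∑ s ∈ Finset.range r, (l.parts s - t) ≤ ∑ s ∈ Finset.range (max N r), (l.parts s - t) :=
    Finset.sum_le_sum_of_subset (Finset.range_subset_range.2 (le_max_right _ _))
  omega

theorem prefix_eq_FF (l : BPartition) (t r : ℕ) (h1 : ∀ s < r, t ≤ l.parts s)
    (h2 : ∀ s, r ≤ s → l.parts s ≤ t) :
    ∑ s ∈ Finset.range r, l.parts s = FF (partsM l) t + r * t := by
  obtain ⟨N, hN⟩ := supp_bd l
  rw [FF_partsM l t (max N r) (hN _ (le_max_left _ _))]
  have h3 : ∑ s ∈ Finset.range r, l.parts s = ∑ s ∈ Finset.range r, ((l.parts s - t) + t) :=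
    Finset.sum_congr rfl (fun s hs => by
      have := h1 s (by simpa using hs)
      omega)
  rw [Finset.sum_add_distrib, Finset.sum_const, Finset.card_range, smul_eq_mul] at h3
  have h4 : ∑ s ∈ Finset.range r, (l.parts s - t) = ∑ s ∈ Finset.range (max N r), (l.parts s - t) := by
    apply Finset.sum_subset (Finset.range_subset_range.2 (le_max_right _ _))
    intro s _ hs
    have := h2 s (by simpa using hs)
    omega
  omega

theorem domLE_iff (l m : BPartition) :
    domLE l m ↔ ∀ t, FF (partsM l) t ≤ FF (partsM m) t := by
  constructor
  · intro H t
    -- r = number of parts > t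
    have hex : ∃ r, l.parts r ≤ t := by
      obtain ⟨N, hN⟩ := supp_bd l
      refine ⟨N, ?_⟩
      have : N ∉ l.parts.support := fun h => by simpa using hN N le_rfl h
      have : l.parts N = 0 := by simpa using this
      omega
    classical
    have h1 := prefix_eq_FF l t (Nat.find hex) (fun s hs => by
      have := Nat.find_min hex hs; omega) (fun s hs => (anti l hs).trans (Nat.find_spec hex))
    have h2 := prefix_le_FF m t (Nat.find hex)
    have h3 := H (Nat.find hex)
    omega
  · intro H r
    have h1 := prefix_eq_FF m (m.parts r) r (fun s hs => anti m hs.le) (fun s hs => anti m hs)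
    have h2 := prefix_le_FF l (m.parts r) r
    have h3 := H (m.parts r)
    omega

theorem domLE_antisymm {l m : BPartition} (h1 : domLE l m) (h2 : domLE m l) : l = m := by
  have key : ∀ r, ∑ s ∈ Finset.range r, l.parts s = ∑ s ∈ Finset.range r, m.parts s :=
    fun r => le_antisymm (h1 r) (h2 r)
  have : l.parts = m.parts := by
    ext r
    have a := key r
    have b := key (r+1)
    rw [Finset.sum_range_succ, Finset.sum_range_succ] at b
    omega
  cases l; cases m; simp_all

theorem partsM_inj {l m : BPartition} (h : partsM l = partsM m) : l = m :=
  domLE_antisymm ((domLE_iff _ _).2 (fun t => by rw [h])) ((domLE_iff _ _).2 (fun t => by rw [h]))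

theorem FF_inj {l m : BPartition} (h : ∀ t, FF (partsM l) t = FF (partsM m) t) : l = m :=
  domLE_antisymm ((domLE_iff _ _).2 (fun t => (h t).le)) ((domLE_iff _ _).2 (fun t => (h t).ge))

theorem diagram_inj {l m : BPartition} (h : diagram l = diagram m) : l = m := by
  have : l.parts = m.parts := by
    ext r
    have h1 : ∀ c, (r, c) ∈ diagram l ↔ (r, c) ∈ diagram m := by rw [h]; simp
    simp only [diagram, Set.mem_ofPred_eq] at h1
    have a := h1 (l.parts r)
    have b := h1 (m.parts r)
    omega
  cases l; cases m; simp_all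

theorem cnt_succ (m : Multiset ℕ) (c : ℕ) : cnt m c = cnt m (c + 1) + m.count c := by
  unfold cnt Multiset.count
  induction m using Multiset.induction_on with
  | empty => simp
  | cons a m ih =>
    simp only [Multiset.countP_cons, ih]
    split_ifs <;> omega

theorem cnt_cons (m : Multiset ℕ) (a c : ℕ) : cnt (a ::ₘ m) c = cnt m c + if c ≤ a then 1 else 0 := by
  simp [cnt, Multiset.countP_cons]

theorem diag_sub (l m : BPartition) :
    diagram l ⊆ diagram m ↔ ∀ c, 1 ≤ c → cnt (partsM l) c ≤ cnt (partsM m) c := by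
  constructor
  · intro H c hc
    by_contra h
    have := H ((mem_diag l (cnt (partsM m) c) c).2 ⟨hc, by omega⟩)
    rw [mem_diag] at this
    omega
  · rintro H ⟨r, c⟩ h
    rw [mem_diag] at h ⊢
    exact ⟨h.1, h.2.trans_le (H c h.1)⟩

theorem diag_diff (h i : ℕ) (l m : BPartition) :
    (∀ y ∈ diagram m, y ∉ diagram l → colRes h y.2 = i) ↔
      ∀ c, 1 ≤ c → cnt (partsM l) c < cnt (partsM m) c → colRes h c = i := by
  constructor
  · intro H c hc hlt
    exact H (cnt (partsM l) c, c) ((mem_diag _ _ _).2 ⟨hc, hlt⟩) (by rw [mem_diag]; omega)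
  · rintro H ⟨r, c⟩ h1 h2
    rw [mem_diag] at h1 h2
    exact H c h1.1 (by omega)

end BPartition
end S1

section S2
namespace BPartition

theorem diag_finite (l : BPartition) : (diagram l).Finite := by
  obtain ⟨N, hN⟩ := supp_bd l
  apply Set.Finite.subset ((Finset.range N ×ˢ Finset.range (l.parts 0 + 1)).finite_toSet)
  rintro ⟨r, c⟩ ⟨h1, h2⟩
  have h3 : r ∈ l.parts.support := by
    simp only [Finsupp.mem_support_iff]; simp at h1 h2; omega
  have h4 := hN N le_rfl h3
  have h5 := anti l (Nat.zero_le r)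
  simp at h2 h4 ⊢
  omega

theorem rem_iff (h i : ℕ) (l : BPartition) :
    (∃ x, Removable h i l x) ↔ ∃ m, IsHStrict h m ∧
      (∀ c, 1 ≤ c → cnt (partsM m) c ≤ cnt (partsM l) c) ∧
      (∀ c, 1 ≤ c → cnt (partsM m) c < cnt (partsM l) c → colRes h c = i) ∧
      ∃ c, 1 ≤ c ∧ cnt (partsM m) c < cnt (partsM l) c := by
  constructor
  · rintro ⟨⟨r, c⟩, h1, m, h2, h3, h4, h5⟩
    rw [diag_diff] at h5
    rw [diag_sub] at h3
    rw [mem_diag] at h1 h4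
    exact ⟨m, h2, h3, h5, c, h1.1, by omega⟩
  · rintro ⟨m, h2, h3, h5, c, h1, h4⟩
    rw [← diag_diff] at h5
    rw [← diag_sub] at h3
    exact ⟨(cnt (partsM m) c, c), (mem_diag _ _ _).2 ⟨h1, h4⟩, m, h2, h3,
      by rw [mem_diag]; omega, h5⟩

theorem add_exists (h i : ℕ) (l : BPartition) (x : ℕ × ℕ) (hx : Addable h i l x) :
    ∃ m, IsHStrict h m ∧
      (∀ c, 1 ≤ c → cnt (partsM l) c ≤ cnt (partsM m) c) ∧
      (∀ c, 1 ≤ c → cnt (partsM l) c < cnt (partsM m) c → colRes h c = i) ∧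
      1 ≤ x.2 ∧ colRes h x.2 = i ∧ cnt (partsM l) x.2 ≤ x.1 ∧ x.1 < cnt (partsM m) x.2 := by
  obtain ⟨r, c⟩ := x
  obtain ⟨h0, h1, m, h2, h3, h4, h5⟩ := hx
  rw [diag_diff] at h5
  rw [diag_sub] at h3
  rw [mem_diag] at h1 h4
  exact ⟨m, h2, h3, h5, h4.1, h0, by simp only; omega, h4.2⟩

theorem add_of (h i : ℕ) (l m : BPartition) (r c : ℕ) (h2 : IsHStrict h m)
    (h3 : ∀ c, 1 ≤ c → cnt (partsM l) c ≤ cnt (partsM m) c)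
    (h5 : ∀ c, 1 ≤ c → cnt (partsM l) c < cnt (partsM m) c → colRes h c = i)
    (h1 : 1 ≤ c) (h4 : cnt (partsM l) c ≤ r) (h6 : r < cnt (partsM m) c) :
    Addable h i l (r, c) := by
  refine ⟨h5 c h1 (by omega), by rw [mem_diag]; omega, m, h2, (diag_sub _ _).2 h3,
    (mem_diag _ _ _).2 ⟨h1, h6⟩, (diag_diff _ _ _ _).2 h5⟩

theorem add_max (h i : ℕ) (l m : BPartition) (h2 : IsHStrict h m)
    (h3 : ∀ c, 1 ≤ c → cnt (partsM l) c ≤ cnt (partsM m) c)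
    (h5 : ∀ c, 1 ≤ c → cnt (partsM l) c < cnt (partsM m) c → colRes h c = i)
    (hmax : ∀ m', IsHStrict h m' → 
      (∀ c, 1 ≤ c → cnt (partsM l) c ≤ cnt (partsM m') c) →
      (∀ c, 1 ≤ c → cnt (partsM l) c < cnt (partsM m') c → colRes h c = i) →
      ∀ c, 1 ≤ c → colRes h c = i → cnt (partsM m') c ≤ cnt (partsM m) c) (r c : ℕ) :
    Addable h i l (r, c) ↔ 1 ≤ c ∧ cnt (partsM l) c ≤ r ∧ r < cnt (partsM m) c := by
  constructor
  · intro hx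
    obtain ⟨m', a, b, d, e, e2, f, g⟩ := add_exists h i l _ hx
    exact ⟨e, f, g.trans_le (hmax m' a b d c e e2)⟩
  · rintro ⟨a, b, d⟩
    exact add_of h i l m r c h2 h3 h5 a b d

theorem psi_eq (h i : ℕ) (l m : BPartition) (hrem : ∀ x, ¬ Removable h i l x)
    (h3 : ∀ c, 1 ≤ c → cnt (partsM l) c ≤ cnt (partsM m) c)
    (hadd : ∀ r c, Addable h i l (r, c) ↔ 1 ≤ c ∧ cnt (partsM l) c ≤ r ∧ r < cnt (partsM m) c) :
    psi h i l = m := by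
  have hfin : {x | Addable h i l x}.Finite := by
    apply (diag_finite m).subset
    rintro ⟨r, c⟩ hx
    have := (hadd r c).1 hx
    rw [mem_diag]; omega
  have hN : ∀ x, ¬ Normal h i l x := fun x hx => hrem x hx.1
  have hC : ∀ x, Conormal h i l x ↔ Addable h i l x := by
    intro x
    constructor
    · exact fun hx => hx.1
    · intro hx
      refine ⟨hx, fun z hz => ?_⟩
      have e : {y | Removable h i l y ∧ posLE x y ∧ posLE y z} = ∅ := by
        ext y; simp [hrem y]
      rw [e, Set.ncard_empty]
      rw [Set.ncard_pos (hfin.subset (fun y hy => hy.1))]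
      exact ⟨x, hx, Or.inr ⟨rfl, le_rfl⟩, hz⟩
  have hset : psiSet h i l = diagram m := by
    have e : {x | Normal h i l x} = ∅ := by ext y; simp [hN y]
    unfold psiSet
    rw [e, Set.ncard_empty, if_pos (Nat.zero_le _)]
    ext ⟨r, c⟩
    simp only [hC, Nat.sub_zero, Set.mem_union, Set.mem_ofPred_eq]
    have hle : Set.ncard {y | Addable h i l y ∧ posLE y (r, c)} ≤ Set.ncard {x | Addable h i l x} :=
      Set.ncard_le_ncard (fun y hy => hy.1) hfin
    rw [mem_diag, mem_diag, hadd]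
    constructor
    · rintro (⟨a, b⟩ | ⟨⟨a, b, d⟩, _⟩)
      · exact ⟨a, b.trans_le (h3 c a)⟩
      · exact ⟨a, d⟩
    · rintro ⟨a, b⟩
      by_cases hc : r < cnt (partsM l) c
      · exact Or.inl ⟨a, hc⟩
      · exact Or.inr ⟨⟨a, by omega, b⟩, hle⟩
  have hex : ∃ mu : BPartition, diagram mu = psiSet h i l := ⟨m, hset.symm⟩
  unfold psi
  rw [dif_pos hex]
  exact diagram_inj (hex.choose_spec.trans hset)

/-! ### Residues -/

theorem colRes_iff (h i x : ℕ) (hi : 2 * i + 1 < h) :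
    colRes h (x + 1) = i ↔ x % h = i ∨ x % h + i + 1 = h := by
  have hr : x % h < h := Nat.mod_lt _ (by omega)
  unfold colRes
  have e1 : x + 1 - 1 = x := by omega
  rw [e1]
  by_cases hc : x % h + 1 = h
  · have : (x + 1) % h = 0 := by
      rw [Nat.add_mod, Nat.mod_eq_of_lt (show 1 < h by omega), hc, Nat.mod_self]
    rw [this, Nat.sub_zero, Nat.mod_self]; omega
  · have : (x + 1) % h = x % h + 1 := by
      rw [Nat.add_mod, Nat.mod_eq_of_lt (show 1 < h by omega), Nat.mod_eq_of_lt (by omega)]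
    rw [this, Nat.mod_eq_of_lt (show h - (x % h + 1) < h by omega)]; omega

theorem succ_mod (h x : ℕ) (hh : 1 < h) :
    (x % h + 1 = h ∧ (x + 1) % h = 0) ∨ (x % h + 1 < h ∧ (x + 1) % h = x % h + 1) := by
  have hr : x % h < h := Nat.mod_lt _ (by omega)
  by_cases hc : x % h + 1 = h
  · left
    exact ⟨hc, by rw [Nat.add_mod, Nat.mod_eq_of_lt (show 1 < h by omega), hc, Nat.mod_self]⟩
  · right
    exact ⟨by omega, by rw [Nat.add_mod, Nat.mod_eq_of_lt (show 1 < h by omega), Nat.mod_eq_of_lt (by omega)]⟩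

/-- replacing one part `x+1` by `x` -/
theorem rem_of_one (h i : ℕ) (l : BPartition) (x : ℕ) (hx : x + 1 ∈ partsM l)
    (hl : IsHStrict h l) (hres : colRes h (x + 1) = i) (h1 : h ∣ x ∨ x ∉ partsM l) :
    ∃ y, Removable h i l y := by
  obtain ⟨m0, hm0⟩ := Multiset.exists_cons_of_mem hx
  rw [hstrict_iff] at hl
  by_cases hx0 : x = 0
  · subst hx0
    obtain ⟨m, hm⟩ := exists_of_multiset m0 (fun y hy => pos_of_mem (l := l) (by rw [hm0]; simp [hy]))
    rw [rem_iff]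
    refine ⟨m, ?_, ?_, ?_, 1, le_rfl, ?_⟩
    · rw [hstrict_iff]
      intro y hy
      have := hl y hy
      rw [hm0, Multiset.count_cons] at this
      rw [hm]; omega
    · intro c hc; rw [hm0, hm, cnt_cons]; omega
    · intro c hc; rw [hm0, hm, cnt_cons]
      split_ifs with hc2
      · have : c = 0 + 1 := by omega
        rw [this]; intro _; exact hres
      · omega
    · rw [hm0, hm, cnt_cons]; simp
  · obtain ⟨m, hm⟩ := exists_of_multiset (x ::ₘ m0) (fun y hy => by
      rw [Multiset.mem_cons] at hy
      rcases hy with rfl | hy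
      · omega
      · exact pos_of_mem (l := l) (by rw [hm0]; simp [hy]))
    rw [rem_iff]
    refine ⟨m, ?_, ?_, ?_, x+1, by omega, ?_⟩
    · rw [hstrict_iff]
      intro y hy
      have := hl y hy
      rw [hm0, Multiset.count_cons] at this
      rw [hm, Multiset.count_cons]
      split_ifs with hxy
      · subst hxy
        have h2 := h1.resolve_left hy
        rw [← Multiset.count_eq_zero, hm0, Multiset.count_cons] at h2
        omega
      · omega
    · intro c hc; rw [hm0, hm, cnt_cons, cnt_cons]; split_ifs <;> omega
    · intro c hc; rw [hm0, hm, cnt_cons, cnt_cons]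
      by_cases hc2 : c = x + 1
      · rw [hc2]; intro _; exact hres
      · split_ifs <;> omega
    · rw [hm0, hm, cnt_cons, cnt_cons]; simp

/-- replacing one part `x` by `x+1` -/
theorem add_of_one (h i : ℕ) (l : BPartition) (x : ℕ) (hx : x ∈ partsM l)
    (hl : IsHStrict h l) (hres : colRes h (x + 1) = i) (h1 : x + 1 ∉ partsM l) :
    Addable h i l (cnt (partsM l) (x + 1), x + 1) := by
  obtain ⟨m0, hm0⟩ := Multiset.exists_cons_of_mem hx
  rw [hstrict_iff] at hl
  obtain ⟨m, hm⟩ := exists_of_multiset ((x + 1) ::ₘ m0) (fun y hy => by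
      rw [Multiset.mem_cons] at hy
      rcases hy with rfl | hy
      · omega
      · exact pos_of_mem (l := l) (by rw [hm0]; simp [hy]))
  refine add_of h i l m _ _ ?_ ?_ ?_ (by omega) le_rfl ?_
  · rw [hstrict_iff]
    intro y hy
    have := hl y hy
    rw [hm0, Multiset.count_cons] at this
    rw [hm, Multiset.count_cons]
    split_ifs with hxy
    · subst hxy
      have h2 := h1
      rw [← Multiset.count_eq_zero, hm0, Multiset.count_cons] at h2
      omega
    · omega
  · intro c hc; rw [hm0, hm, cnt_cons, cnt_cons]; split_ifs <;> omega
  · intro c hc; rw [hm0, hm, cnt_cons, cnt_cons]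
    by_cases hc2 : c = x + 1
    · rw [hc2]; intro _; exact hres
    · split_ifs <;> omega
  · rw [hm0, hm, cnt_cons, cnt_cons]; simp

end BPartition
end S2

section S3
namespace BPartition

/-- columns `x+1` of residue `i` -/
def QQ (h i x : ℕ) : Prop := x % h = i ∨ x % h + i + 1 = h

instance (h i x : ℕ) : Decidable (QQ h i x) := by unfold QQ; infer_instance

theorem colRes_QQ {h i : ℕ} (x : ℕ) (hi : 2 * i + 1 < h) : colRes h (x + 1) = i ↔ QQ h i x :=
  colRes_iff h i x hi

theorem QQ_succ {h i x : ℕ} (hi : 1 ≤ i) (hi2 : 2 * i + 2 < h) (hx : QQ h i x) :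
    ¬ QQ h i (x + 1) := by
  unfold QQ at *
  rcases succ_mod h x (by omega) with h1 | h1 <;> omega

theorem QQ_ndvd {h i x : ℕ} (hi : 1 ≤ i) (hi2 : 2 * i + 2 < h) (hx : QQ h i x) : ¬ h ∣ x := by
  unfold QQ at *
  intro hd
  have := Nat.mod_eq_zero_of_dvd hd
  omega

theorem QQ_pos {h i x : ℕ} (hi : 1 ≤ i) (hi2 : 2 * i + 2 < h) (hx : QQ h i x) : 0 < x := by
  rcases Nat.eq_zero_or_pos x with rfl | h0
  · exact absurd (dvd_zero h) (QQ_ndvd hi hi2 hx)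
  · exact h0

theorem QQ_ndvd' {h i x : ℕ} (hi : 1 ≤ i) (hi2 : 2 * i + 2 < h) (hx : QQ h i x) : ¬ h ∣ x + 1 := by
  unfold QQ at *
  intro hd
  have := Nat.mod_eq_zero_of_dvd hd
  rcases succ_mod h x (by omega) with h1 | h1 <;> omega

/-- if only `i`-columns differ -/
theorem cnt_eq_of_nQ {h i : ℕ} (hi : 2 * i + 1 < h) {l m : BPartition}
    (h3 : ∀ c, 1 ≤ c → cnt (partsM l) c ≤ cnt (partsM m) c)
    (h5 : ∀ c, 1 ≤ c → cnt (partsM l) c < cnt (partsM m) c → colRes h c = i) (x : ℕ)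
    (hx : ¬ QQ h i x) : cnt (partsM l) (x+1) = cnt (partsM m) (x+1) := by
  have a := h3 (x+1) (by omega)
  by_contra hne
  exact hx ((colRes_QQ x hi).1 (h5 (x+1) (by omega) (by omega)))

theorem rem_pat {h i : ℕ} (hi : 1 ≤ i) (hi2 : 2 * i + 2 < h) {l : BPartition}
    (H : ∃ x, Removable h i l x) : ∃ x, QQ h i x ∧ x + 1 ∈ partsM l ∧ x ∉ partsM l := by
  rw [rem_iff] at H
  obtain ⟨m, hm, h3, h5, c, hc, hlt⟩ := H
  obtain ⟨x, rfl⟩ : ∃ x, c = x + 1 := ⟨c - 1, by omega⟩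
  have hq := (colRes_QQ x (by omega)).1 (h5 _ hc hlt)
  have h6 := cnt_eq_of_nQ (by omega) h3 h5 (x+1) (QQ_succ hi hi2 hq)
  obtain ⟨y, rfl⟩ : ∃ y, x = y + 1 := ⟨x - 1, by have := QQ_pos hi hi2 hq; omega⟩
  have h7 := cnt_eq_of_nQ (by omega) h3 h5 y (fun h => QQ_succ hi hi2 h hq)
  have h8 := (hstrict_iff h m).1 hm _ (QQ_ndvd hi hi2 hq)
  have e1 := cnt_succ (partsM m) (y+1)
  have e2 := cnt_succ (partsM m) (y+1+1)
  have e3 := cnt_succ (partsM l) (y+1)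
  have e4 := cnt_succ (partsM l) (y+1+1)
  refine ⟨y+1, hq, ?_, ?_⟩
  · rw [← Multiset.count_pos]; omega
  · rw [← Multiset.count_eq_zero]; omega

theorem unexc {h i : ℕ} (hi2 : 2 * i + 2 < h) {l : BPartition} (hl : IsHStrict h l)
    (H : ∀ x, ¬ Removable h i l x) (x : ℕ) (hq : QQ h i x) (hx : x + 1 ∈ partsM l) :
    x ∈ partsM l := by
  by_contra hn
  obtain ⟨y, hy⟩ := rem_of_one h i l x hx hl ((colRes_QQ x (by omega)).2 hq) (Or.inr hn)
  exact H y hy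

theorem add_pat {h i : ℕ} (hi : 1 ≤ i) (hi2 : 2 * i + 2 < h) {l : BPartition}
    (H : ∃ x, Addable h i l x) : ∃ x, QQ h i x ∧ x ∈ partsM l ∧ x + 1 ∉ partsM l := by
  obtain ⟨z, hz⟩ := H
  obtain ⟨m, hm, h3, h5, hc, -, g1, g2⟩ := add_exists _ _ _ _ hz
  have hlt := g1.trans_lt g2
  generalize z.2 = c at *
  obtain ⟨x, rfl⟩ : ∃ x, c = x + 1 := ⟨c - 1, by omega⟩
  have hq := (colRes_QQ x (by omega)).1 (h5 _ hc hlt)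
  have h6 := cnt_eq_of_nQ (by omega) h3 h5 (x+1) (QQ_succ hi hi2 hq)
  obtain ⟨y, rfl⟩ : ∃ y, x = y + 1 := ⟨x - 1, by have := QQ_pos hi hi2 hq; omega⟩
  have h7 := cnt_eq_of_nQ (by omega) h3 h5 y (fun h => QQ_succ hi hi2 h hq)
  have h8 := (hstrict_iff h m).1 hm _ (QQ_ndvd' hi hi2 hq)
  have e1 := cnt_succ (partsM m) (y+1)
  have e2 := cnt_succ (partsM m) (y+1+1)
  have e3 := cnt_succ (partsM l) (y+1)
  have e4 := cnt_succ (partsM l) (y+1+1)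
  refine ⟨y+1, hq, ?_, ?_⟩
  · rw [← Multiset.count_pos]; omega
  · rw [← Multiset.count_eq_zero]; omega

/-- swapping runners -/
def sw (h i x : ℕ) : ℕ := if QQ h i x then x + 1 else if QQ h i (x - 1) then x - 1 else x

theorem sw_of_Q {h i x : ℕ} (hq : QQ h i x) : sw h i x = x + 1 := by simp [sw, hq]

theorem sw_of_Q' {h i x : ℕ} (hi : 1 ≤ i) (hi2 : 2 * i + 2 < h) (hq : QQ h i x) :
    sw h i (x + 1) = x := by simp [sw, hq, QQ_succ hi hi2 hq]

theorem sw_sw {h i : ℕ} (hi : 1 ≤ i) (hi2 : 2 * i + 2 < h) (x : ℕ) : sw h i (sw h i x) = x := by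
  by_cases h1 : QQ h i x
  · rw [sw_of_Q h1, sw_of_Q' hi hi2 h1]
  · by_cases h2 : QQ h i (x - 1)
    · have := QQ_pos hi hi2 h2
      obtain ⟨y, rfl⟩ : ∃ y, x = y + 1 := ⟨x - 1, by omega⟩
      simp only [Nat.add_sub_cancel] at h2
      rw [sw_of_Q' hi hi2 h2, sw_of_Q h2]
    · simp [sw, h1, h2]

theorem count_sw {h i : ℕ} (hi : 1 ≤ i) (hi2 : 2 * i + 2 < h) (m : Multiset ℕ) (y : ℕ) :
    (m.map (sw h i)).count y = m.count (sw h i y) := by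
  have hinj : Function.Injective (sw h i) := fun a b hab => by
    rw [← sw_sw hi hi2 a, hab, sw_sw hi hi2]
  have := Multiset.count_map_eq_count' (sw h i) m hinj (sw h i y)
  rwa [sw_sw hi hi2] at this

theorem cnt_map_eq (m : Multiset ℕ) (f : ℕ → ℕ) (c : ℕ) (H : ∀ x, c ≤ f x ↔ c ≤ x) :
    cnt (m.map f) c = cnt m c := by
  induction m using Multiset.induction_on with
  | empty => simp
  | cons a m ih => rw [Multiset.map_cons, cnt_cons, cnt_cons, ih]; simp [H]

theorem cnt_sw {h i : ℕ} (hi : 1 ≤ i) (hi2 : 2 * i + 2 < h) (m : Multiset ℕ) (x : ℕ)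
    (hx : ¬ QQ h i x) : cnt (m.map (sw h i)) (x + 1) = cnt m (x + 1) := by
  apply cnt_map_eq
  intro y
  unfold sw
  split_ifs with h1 h2
  · have : y ≠ x := by rintro rfl; exact hx h1
    omega
  · have : y - 1 ≠ x := by intro h; exact hx (h ▸ h2)
    have := QQ_pos hi hi2 h2
    omega
  · rfl

theorem psi_sw {h i : ℕ} (hi : 1 ≤ i) (hi2 : 2 * i + 2 < h) {l : BPartition} (hl : IsHStrict h l)
    (H : ∀ x, ¬ Removable h i l x) : partsM (psi h i l) = (partsM l).map (sw h i) := by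
  obtain ⟨m, hm⟩ := exists_of_multiset ((partsM l).map (sw h i)) (by
    intro x hx
    rw [Multiset.mem_map] at hx
    obtain ⟨y, hy, rfl⟩ := hx
    have := pos_of_mem hy
    unfold sw
    split_ifs with h1 h2
    · omega
    · exact QQ_pos hi hi2 h2
    · exact this)
  have hl' := (hstrict_iff _ _).1 hl
  have hq1 : ∀ x, QQ h i x → cnt (partsM m) (x+1) = cnt (partsM l) (x+1+1) + (partsM l).count x := by
    intro x hx
    rw [cnt_succ, hm, cnt_sw hi hi2 _ _ (QQ_succ hi hi2 hx), count_sw hi hi2, sw_of_Q' hi hi2 hx]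
  have hq2 : ∀ x, ¬ QQ h i x → cnt (partsM m) (x+1) = cnt (partsM l) (x+1) := by
    intro x hx
    rw [hm, cnt_sw hi hi2 _ _ hx]
  have hpat : ∀ x, QQ h i x → (partsM l).count (x+1) ≤ (partsM l).count x := by
    intro x hx
    have h1 := hl' _ (QQ_ndvd' hi hi2 hx)
    have h2 := unexc hi2 hl H x hx
    rw [← Multiset.count_pos, ← Multiset.count_pos] at h2
    omega
  have hms : IsHStrict h m := by
    rw [hstrict_iff]
    intro y hy
    rw [hm, count_sw hi hi2]
    apply hl'
    unfold sw
    split_ifs with h1 h2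
    · exact QQ_ndvd' hi hi2 h1
    · exact QQ_ndvd hi hi2 h2
    · exact hy
  have h3 : ∀ c, 1 ≤ c → cnt (partsM l) c ≤ cnt (partsM m) c := by
    intro c hc
    obtain ⟨x, rfl⟩ : ∃ x, c = x + 1 := ⟨c - 1, by omega⟩
    by_cases hx : QQ h i x
    · rw [hq1 x hx, cnt_succ (partsM l) (x+1)]
      have := hpat x hx
      omega
    · rw [hq2 x hx]
  have h5 : ∀ c, 1 ≤ c → cnt (partsM l) c < cnt (partsM m) c → colRes h c = i := by
    intro c hc hlt
    obtain ⟨x, rfl⟩ : ∃ x, c = x + 1 := ⟨c - 1, by omega⟩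
    by_cases hx : QQ h i x
    · exact (colRes_QQ x (by omega)).2 hx
    · rw [hq2 x hx] at hlt; omega
  have hmax := add_max h i l m hms h3 h5 (by
    intro m' hm' g3 g5 c hc hcol
    obtain ⟨x, rfl⟩ : ∃ x, c = x + 1 := ⟨c - 1, by omega⟩
    have hq := (colRes_QQ x (by omega)).1 hcol
    rw [hq1 x hq]
    have h6 := cnt_eq_of_nQ (by omega) g3 g5 (x+1) (QQ_succ hi hi2 hq)
    obtain ⟨y, rfl⟩ : ∃ y, x = y + 1 := ⟨x - 1, by have := QQ_pos hi hi2 hq; omega⟩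
    have h7 := cnt_eq_of_nQ (by omega) g3 g5 y (fun h => QQ_succ hi hi2 h hq)
    have h8 := (hstrict_iff h m').1 hm' _ (QQ_ndvd' hi hi2 hq)
    have e1 := cnt_succ (partsM m') (y+1)
    have e2 := cnt_succ (partsM m') (y+1+1)
    have e3 := cnt_succ (partsM l) (y+1)
    have e4 := cnt_succ (partsM l) (y+1+1)
    have := hpat _ hq
    omega)
  rw [psi_eq h i l m H h3 hmax, hm]

/-! ### residue zero -/

theorem QQ0 {h : ℕ} (x : ℕ) : QQ h 0 x ↔ x % h = 0 ∨ x % h + 1 = h := Iff.rfl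

theorem unexc0 {h : ℕ} (hh : 3 ≤ h) {l : BPartition} (hl : IsHStrict h l)
    (H : ∀ x, ¬ Removable h 0 l x) :
    (∀ x, x % h = 1 → x ∉ partsM l) ∧ (∀ x, x % h + 1 = h → x + 1 ∈ partsM l → x ∈ partsM l) := by
  constructor
  · intro x hx hmem
    obtain ⟨y, rfl⟩ : ∃ y, x = y + 1 := ⟨x - 1, by have := pos_of_mem hmem; omega⟩
    have hy : y % h = 0 := by rcases succ_mod h y (by omega) with h1 | h1 <;> omega
    obtain ⟨z, hz⟩ := rem_of_one h 0 l y hmem hl ((colRes_QQ y (by omega)).2 (Or.inl hy))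
      (Or.inl (Nat.dvd_of_mod_eq_zero hy))
    exact H z hz
  · intro x hx hmem
    by_contra hn
    obtain ⟨z, hz⟩ := rem_of_one h 0 l x hmem hl ((colRes_QQ x (by omega)).2 (Or.inr hx)) (Or.inr hn)
    exact H z hz

theorem rem_pat0 {h : ℕ} (hh : 3 ≤ h) {l : BPartition}
    (H : ∃ x, Removable h 0 l x) : (∃ x, x % h = 1 ∧ x ∈ partsM l) ∨
      ∃ x, x % h + 1 = h ∧ x + 1 ∈ partsM l ∧ x ∉ partsM l := by
  rw [rem_iff] at H
  obtain ⟨m, hm, h3, h5, c, hc, hlt⟩ := H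
  by_contra hcon
  push Not at hcon
  obtain ⟨c1, c2⟩ := hcon
  have first : ∀ x, x % h = 0 → cnt (partsM m) (x+1) = cnt (partsM l) (x+1) := by
    intro x hx
    have hx1 : (x+1) % h = 1 := by rcases succ_mod h x (by omega) with h1 | h1 <;> omega
    have h6 := cnt_eq_of_nQ (by omega) h3 h5 (x+1) (by rw [QQ0]; omega)
    have e1 := cnt_succ (partsM m) (x+1)
    have e2 := cnt_succ (partsM l) (x+1)
    have e3 := Multiset.count_eq_zero.2 (c1 _ hx1)
    have := h3 (x+1) (by omega)
    omega
  obtain ⟨x, rfl⟩ : ∃ x, c = x + 1 := ⟨c - 1, by omega⟩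
  have hq := (colRes_QQ x (by omega)).1 (h5 _ hc hlt)
  rcases hq with hq | hq
  · have := first x hq; omega
  · have hq : x % h + 1 = h := by omega
    have hx1 : (x+1) % h = 0 := by rcases succ_mod h x (by omega) with h1 | h1 <;> omega
    have h6 := first (x+1) hx1
    obtain ⟨y, rfl⟩ : ∃ y, x = y + 1 := ⟨x - 1, by
      rcases Nat.eq_zero_or_pos x with rfl | h0
      · simp at hq; omega
      · omega⟩
    have hx0 : y % h + 2 = h := by rcases succ_mod h y (by omega) with h1 | h1 <;> omega
    have h7 := cnt_eq_of_nQ (by omega) h3 h5 y (by rw [QQ0]; omega)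
    have h8 := (hstrict_iff h m).1 hm (y+1) (by rw [Nat.dvd_iff_mod_eq_zero]; omega)
    have e1 := cnt_succ (partsM m) (y+1)
    have e2 := cnt_succ (partsM m) (y+1+1)
    have e3 := cnt_succ (partsM l) (y+1)
    have e4 := cnt_succ (partsM l) (y+1+1)
    have := c2 (y+1) hq
    rw [← Multiset.count_pos, ← Multiset.count_pos] at this
    omega

theorem add_pat0 {h : ℕ} (hh : 3 ≤ h) {l : BPartition}
    (H : ∃ x, Addable h 0 l x) : 1 ∉ partsM l ∨ (∃ x, x % h + 1 = h ∧ x ∈ partsM l) ∨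
      ∃ x, h ∣ x ∧ x ∈ partsM l ∧ x + 1 ∉ partsM l := by
  obtain ⟨z, hz⟩ := H
  obtain ⟨m, hm, h3, h5, hc, -, g1, g2⟩ := add_exists _ _ _ _ hz
  have hlt := g1.trans_lt g2
  generalize z.2 = c at *
  by_contra hcon
  push Not at hcon
  obtain ⟨c0, c1, c2⟩ := hcon
  have first : ∀ x, x % h + 1 = h → cnt (partsM m) (x+1) = cnt (partsM l) (x+1) := by
    intro x hq
    obtain ⟨y, rfl⟩ : ∃ y, x = y + 1 := ⟨x - 1, by
      rcases Nat.eq_zero_or_pos x with rfl | h0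
      · simp at hq; omega
      · omega⟩
    have hx0 : y % h + 2 = h := by rcases succ_mod h y (by omega) with h1 | h1 <;> omega
    have h6 := cnt_eq_of_nQ (by omega) h3 h5 y (by rw [QQ0]; omega)
    have e1 := cnt_succ (partsM m) (y+1)
    have e2 := cnt_succ (partsM l) (y+1)
    have e3 := Multiset.count_eq_zero.2 (c1 _ hq)
    have := h3 (y+1+1) (by omega)
    omega
  obtain ⟨x, rfl⟩ : ∃ x, c = x + 1 := ⟨c - 1, by omega⟩
  have hq := (colRes_QQ x (by omega)).1 (h5 _ hc hlt)
  rcases hq with hq | hq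
  · have hx1 : (x+1) % h = 1 := by rcases succ_mod h x (by omega) with h1 | h1 <;> omega
    have h6 := cnt_eq_of_nQ (by omega) h3 h5 (x+1) (by rw [QQ0]; omega)
    have h8 := (hstrict_iff h m).1 hm (x+1) (by rw [Nat.dvd_iff_mod_eq_zero]; omega)
    have e2 := cnt_succ (partsM m) (x+1)
    have e4 := cnt_succ (partsM l) (x+1)
    rcases Nat.eq_zero_or_pos x with rfl | h0
    · rw [← Multiset.count_pos] at c0
      simp only [Nat.zero_add] at *
      omega
    · obtain ⟨y, rfl⟩ : ∃ y, x = y + 1 := ⟨x - 1, by omega⟩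
      have h7 := first y (by rcases succ_mod h y (by omega) with h1 | h1 <;> omega)
      have e1 := cnt_succ (partsM m) (y+1)
      have e3 := cnt_succ (partsM l) (y+1)
      have := c2 (y+1) (Nat.dvd_of_mod_eq_zero hq)
      rw [← Multiset.count_pos, ← Multiset.count_pos] at this
      omega
  · have := first x (by omega); omega

def s0 (h x : ℕ) : ℕ := if x % h + 1 = h then x + 2 else x

theorem cnt_s0 (h : ℕ) (hh : 3 ≤ h) (m : Multiset ℕ) (x : ℕ) (hx : x % h + 1 = h) :
    cnt (m.map (s0 h)) (x+1) = cnt m (x+1) + m.count x ∧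
    cnt (m.map (s0 h)) (x+2) = cnt m (x+2) + m.count x := by
  have hx1 : (x+1) % h = 0 := by rcases succ_mod h x (by omega) with h1 | h1 <;> omega
  have hx2 : x ≠ 0 := by rintro rfl; simp at hx; omega
  have hx3 : (x-1) % h + 1 ≠ h := by
    have e : x - 1 + 1 = x := by omega
    have := succ_mod h (x-1) (by omega)
    rw [e] at this
    omega
  have key : ∀ a, (s0 h a = a + 2 ∧ a ≠ x - 1 ∧ a ≠ x + 1) ∨ (s0 h a = a ∧ a ≠ x) := by
    intro a
    unfold s0
    split_ifs with h1
    · refine Or.inl ⟨rfl, ?_, ?_⟩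
      · rintro rfl; exact hx3 h1
      · rintro rfl; omega
    · refine Or.inr ⟨rfl, ?_⟩
      rintro rfl; exact h1 hx
  induction m using Multiset.induction_on with
  | empty => simp [cnt]
  | cons a m ih =>
    simp only [Multiset.map_cons, cnt_cons, ih, Multiset.count_cons]
    have := key a
    constructor <;> split_ifs <;> omega

theorem cnt_s0' (h : ℕ) (m : Multiset ℕ) (x : ℕ) (hx : ¬ QQ h 0 x ∨ x = 0) (hh : 3 ≤ h) :
    cnt (m.map (s0 h)) (x+1) = cnt m (x+1) := by
  apply cnt_map_eq
  intro y
  unfold s0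
  split_ifs with h1
  · have : y ≠ x := by
      rintro rfl
      rcases hx with hx | hx
      · exact hx (Or.inr (by omega))
      · subst hx; simp at h1; omega
    have : y + 1 ≠ x := by
      rintro rfl
      rcases hx with hx | hx
      · apply hx
        left
        rcases succ_mod h y (by omega) with h1 | h1 <;> omega
      · omega
    omega
  · rfl

theorem psi_s0 {h : ℕ} (hh : 3 ≤ h) {l : BPartition} (hl : IsHStrict h l)
    (H : ∀ x, ¬ Removable h 0 l x) : partsM (psi h 0 l) = 1 ::ₘ (partsM l).map (s0 h) ∧
    ∀ r c, Addable h 0 l (r, c) ↔ 1 ≤ c ∧ cnt (partsM l) c ≤ r ∧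
      r < cnt (1 ::ₘ (partsM l).map (s0 h)) c := by
  obtain ⟨m, hm⟩ := exists_of_multiset (1 ::ₘ (partsM l).map (s0 h)) (by
    intro x hx
    rw [Multiset.mem_cons, Multiset.mem_map] at hx
    rcases hx with rfl | ⟨y, hy, rfl⟩
    · omega
    have := pos_of_mem hy
    unfold s0
    split_ifs with h1 <;> omega)
  have hl' := (hstrict_iff _ _).1 hl
  obtain ⟨u1, u2⟩ := unexc0 hh hl H
  have hq1 : ∀ x, x % h + 1 = h → cnt (partsM m) (x+1) = cnt (partsM l) (x+1) + (partsM l).count x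
      ∧ cnt (partsM m) (x+2) = cnt (partsM l) (x+2) + (partsM l).count x := by
    intro x hx
    have hx2 : x ≠ 0 := by rintro rfl; simp at hx; omega
    rw [hm, cnt_cons, cnt_cons, (cnt_s0 h hh _ x hx).1, (cnt_s0 h hh _ x hx).2,
      if_neg (by omega), if_neg (by omega)]
    simp
  have hq2 : ∀ x, ¬ QQ h 0 x → cnt (partsM m) (x+1) = cnt (partsM l) (x+1) := by
    intro x hx
    have hx2 : x ≠ 0 := by rintro rfl; exact hx (Or.inl (by simp))
    rw [hm, cnt_cons, cnt_s0' h _ _ (Or.inl hx) hh, if_neg (by omega)]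
    simp
  have hq3 : cnt (partsM m) 1 = cnt (partsM l) 1 + 1 := by
    rw [hm, cnt_cons]
    have := cnt_s0' h (partsM l) 0 (Or.inr rfl) hh
    simp only [Nat.zero_add] at this
    rw [this]; simp
  have hpat : ∀ x, x % h + 1 = h → 0 < (partsM l).count (x+1) → 0 < (partsM l).count x := by
    intro x hx
    rw [Multiset.count_pos, Multiset.count_pos]
    exact u2 x hx
  have hone : ∀ x, x % h = 1 → (partsM l).count x = 0 := by
    intro x hx
    rw [Multiset.count_eq_zero]; exact u1 x hx
  -- classification
  have cases : ∀ x, x = 0 ∨ (x % h + 1 = h) ∨ (∃ y, x = y + 1 ∧ y % h + 1 = h ∧ x % h = 0) ∨ ¬ QQ h 0 x := by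
    intro x
    by_cases hx0 : x = 0
    · exact Or.inl hx0
    by_cases hx1 : x % h + 1 = h
    · exact Or.inr (Or.inl hx1)
    by_cases hx2 : x % h = 0
    · refine Or.inr (Or.inr (Or.inl ⟨x - 1, by omega, ?_, hx2⟩))
      have e : x - 1 + 1 = x := by omega
      have := succ_mod h (x-1) (by omega)
      rw [e] at this
      omega
    · refine Or.inr (Or.inr (Or.inr ?_))
      rw [QQ0]; omega
  have h01 : 1 % h = 1 := Nat.mod_eq_of_lt (by omega)
  have h02 : ¬ QQ h 0 1 := by rw [QQ0, h01]; omega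
  have hms : IsHStrict h m := by
    rw [hstrict_iff]
    intro y hy
    rw [Nat.dvd_iff_mod_eq_zero] at hy
    have hly := hl' y (by rwa [Nat.dvd_iff_mod_eq_zero])
    have f1 := cnt_succ (partsM m) y
    have f2 := cnt_succ (partsM l) y
    by_cases ha : y % h + 1 = h
    · have g1 := (hq1 y ha).1
      obtain ⟨z, rfl⟩ : ∃ z, y = z + 1 := ⟨y - 1, by
        rcases Nat.eq_zero_or_pos y with rfl | h0
        · simp at ha; omega
        · omega⟩
      have g2 := hq2 z (by rw [QQ0]; rcases succ_mod h z (by omega) with h1 | h1 <;> omega)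
      omega
    · obtain ⟨z, rfl⟩ : ∃ z, y = z + 1 := ⟨y - 1, by
        rcases Nat.eq_zero_or_pos y with rfl | h0
        · simp at hy
        · omega⟩
      by_cases hz : z = 0
      · subst hz
        have g1 := hq2 1 h02
        simp only [Nat.zero_add] at *
        have := hone 1 h01
        omega
      have g1 := hq2 (z+1) (by rw [QQ0]; omega)
      by_cases hb : (z+1) % h = 1
      · have := hone _ hb
        obtain ⟨w, rfl⟩ : ∃ w, z = w + 1 := ⟨z - 1, by omega⟩
        have hw : w % h + 1 = h := by
          rcases succ_mod h w (by omega) with h1 | h1 <;>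
          rcases succ_mod h (w+1) (by omega) with h2 | h2 <;> omega
        have g3 := (hq1 w hw).2
        have := hl' w (by rw [Nat.dvd_iff_mod_eq_zero]; omega)
        simp only [Nat.add_assoc, Nat.reduceAdd] at *
        omega
      · have g3 := hq2 z (by rw [QQ0]; rcases succ_mod h z (by omega) with h1 | h1 <;> omega)
        omega
  have h3 : ∀ c, 1 ≤ c → cnt (partsM l) c ≤ cnt (partsM m) c := by
    intro c hc
    obtain ⟨x, rfl⟩ : ∃ x, c = x + 1 := ⟨c - 1, by omega⟩
    rcases cases x with rfl | hx | ⟨y, rfl, hy, hx⟩ | hx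
    · simp only [Nat.zero_add]; omega
    · have := (hq1 x hx).1; omega
    · have := (hq1 y hy).2
      simp only [Nat.add_assoc, Nat.reduceAdd] at *; omega
    · have := hq2 x hx; omega
  have h5 : ∀ c, 1 ≤ c → cnt (partsM l) c < cnt (partsM m) c → colRes h c = 0 := by
    intro c hc hlt
    obtain ⟨x, rfl⟩ : ∃ x, c = x + 1 := ⟨c - 1, by omega⟩
    by_cases hx : QQ h 0 x
    · exact (colRes_QQ x (by omega)).2 hx
    · rw [hq2 x hx] at hlt; omega
  have hmax := add_max h 0 l m hms h3 h5 (by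
    intro m' hm' g3 g5 c hc hcol
    obtain ⟨x, rfl⟩ : ∃ x, c = x + 1 := ⟨c - 1, by omega⟩
    have hm'' := (hstrict_iff _ _).1 hm'
    rcases cases x with rfl | hx | ⟨y, rfl, hy, hx⟩ | hx
    · simp only [Nat.zero_add] at *
      have a1 := cnt_eq_of_nQ (by omega) g3 g5 1 h02
      have a2 := cnt_succ (partsM m') 1
      have a3 := hm'' 1 (by rw [Nat.dvd_iff_mod_eq_zero]; omega)
      have a4 := cnt_succ (partsM l) 1
      omega
    · have a1 := (hq1 x hx).1
      obtain ⟨z, rfl⟩ : ∃ z, x = z + 1 := ⟨x - 1, by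
        rcases Nat.eq_zero_or_pos x with rfl | h0
        · simp at hx; omega
        · omega⟩
      have a2 := cnt_eq_of_nQ (by omega) g3 g5 z
        (by rw [QQ0]; rcases succ_mod h z (by omega) with h1 | h1 <;> omega)
      have a3 := cnt_succ (partsM m') (z+1)
      have a4 := cnt_succ (partsM l) (z+1)
      omega
    · have a1 := (hq1 y hy).2
      have hx2 : (y+1+1) % h = 1 := by rcases succ_mod h (y+1) (by omega) with h1 | h1 <;> omega
      have b1 := hone _ hx2
      have b2 := hpat y hy
      have b3 := hm'' (y+1+1) (by rw [Nat.dvd_iff_mod_eq_zero]; omega)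
      have b4 := cnt_eq_of_nQ (by omega) g3 g5 (y+1+1) (by rw [QQ0]; omega)
      obtain ⟨z, rfl⟩ : ∃ z, y = z + 1 := ⟨y - 1, by
        rcases Nat.eq_zero_or_pos y with rfl | h0
        · simp at hy; omega
        · omega⟩
      have a2 := cnt_eq_of_nQ (by omega) g3 g5 z
        (by rw [QQ0]; rcases succ_mod h z (by omega) with h1 | h1 <;> omega)
      have a3 := cnt_succ (partsM m') (z+1)
      have a4 := cnt_succ (partsM l) (z+1)
      have a5 := cnt_succ (partsM m') (z+2)
      have a6 := cnt_succ (partsM l) (z+2)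
      have a7 := cnt_succ (partsM m') (z+3)
      have a8 := cnt_succ (partsM l) (z+3)
      simp only [Nat.add_assoc, Nat.reduceAdd] at *
      omega
    · exact absurd ((colRes_QQ x (by omega)).1 hcol) hx)
  rw [psi_eq h 0 l m H h3 hmax, hm]
  rw [hm] at hmax
  exact ⟨rfl, hmax⟩

end BPartition
end S3

section S4
namespace BPartition

structure Core (h : ℕ) (s : Multiset ℕ) : Prop where
  nd : ∀ x, s.count x ≤ 1
  dv : ∀ x, h ∣ x → x ∉ s
  pos : ∀ x ∈ s, 0 < x
  dn : ∀ x ∈ s, h < x → x - h ∈ s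
  op : ∀ x ∈ s, x < h → h - x ∉ s

theorem core_of {n h : ℕ} (hh : h = 2 * n + 1) {σ : BPartition} (hσ : IsBarCore h σ) :
    Core h (partsM σ) := by
  obtain ⟨hs, hc⟩ := hσ
  have hs' := (hstrict_iff h σ).1 hs
  have key : ∀ m : Multiset ℕ, (∀ x ∈ m, 0 < x) → (∀ x, ¬ h ∣ x → m.count x ≤ 1) →
      ∃ l, IsHStrict h l ∧ partsM l = m := by
    intro m hp hm
    obtain ⟨l, hl⟩ := exists_of_multiset m hp
    exact ⟨l, (hstrict_iff h l).2 (by rwa [hl]), hl⟩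
  have her : ∀ x y, ((partsM σ).erase x).count y ≤ (partsM σ).count y := fun x y =>
    Multiset.count_le_of_le _ (Multiset.erase_le _ _)
  have hpos : ∀ x ∈ partsM σ, 0 < x := fun x hx => pos_of_mem hx
  have hdv : ∀ x, h ∣ x → x ∉ partsM σ := by
    intro x hx hmem
    have := hpos x hmem
    have hle := Nat.le_of_dvd this hx
    rcases hle.eq_or_lt with rfl | hlt
    · obtain ⟨l, hl, e⟩ := key ((partsM σ).erase h)
        (fun y hy => hpos y (Multiset.mem_of_mem_erase hy))
        (fun y hy => (her h y).trans (hs' y hy))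
      exact hc l ⟨h, hl, Or.inl ⟨rfl, hmem, e⟩⟩
    · obtain ⟨l, hl, e⟩ := key ((x - h) ::ₘ (partsM σ).erase x)
        (by
          intro y hy
          rcases Multiset.mem_cons.1 hy with rfl | hy
          · omega
          · exact hpos y (Multiset.mem_of_mem_erase hy))
        (by
          intro y hy
          rw [Multiset.count_cons_of_ne]
          · exact (her x y).trans (hs' y hy)
          · rintro rfl
            exact hy (Nat.dvd_sub hx dvd_rfl))
      exact hc l ⟨x, hl, Or.inr (Or.inl ⟨hlt, hmem, e⟩)⟩
  have hnd : ∀ x, (partsM σ).count x ≤ 1 := by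
    intro x
    by_cases hx : h ∣ x
    · rw [Multiset.count_eq_zero_of_notMem (hdv x hx)]; omega
    · exact hs' x hx
  refine ⟨hnd, hdv, hpos, ?_, ?_⟩
  · intro x hx hlt
    by_contra hnot
    obtain ⟨l, hl, e⟩ := key ((x - h) ::ₘ (partsM σ).erase x)
        (by
          intro y hy
          rcases Multiset.mem_cons.1 hy with rfl | hy
          · omega
          · exact hpos y (Multiset.mem_of_mem_erase hy))
        (by
          intro y hy
          rw [Multiset.count_cons]
          split_ifs with h1
          · subst h1
            have := her x (x-h)
            have h2 := Multiset.count_eq_zero_of_notMem hnot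
            omega
          · exact (her x y).trans (hs' y hy))
    exact hc l ⟨x, hl, Or.inr (Or.inl ⟨hlt, hx, e⟩)⟩
  · intro x hx hlt hop
    obtain ⟨l, hl, e⟩ := key (((partsM σ).erase x).erase (h - x))
        (fun y hy => hpos y (Multiset.mem_of_mem_erase (Multiset.mem_of_mem_erase hy)))
        (fun y hy => (Multiset.count_le_of_le _ (Multiset.erase_le _ _)).trans
          ((her x y).trans (hs' y hy)))
    exact hc l ⟨_, hl, Or.inr (Or.inr ⟨x, h - x, by omega, hx,
      (Multiset.mem_erase_of_ne (by omega)).2 hop, rfl, e⟩)⟩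

def lo (h c : ℕ) : Multiset ℕ := if h < c then {c - h} else 0
def hib (h c : ℕ) : Multiset ℕ := if h ≤ c then {c} else {c, h - c}

theorem count_lo (h c x : ℕ) : (lo h c).count x = if h < c ∧ x = c - h then 1 else 0 := by
  unfold lo; by_cases h1 : h < c <;> simp [h1, Multiset.count_singleton]

theorem count_hib (h c x : ℕ) : (hib h c).count x =
    (if x = c then 1 else 0) + if c < h ∧ x = h - c then 1 else 0 := by
  unfold hib
  by_cases h1 : h ≤ c
  · have : ¬ c < h := by omega
    simp [h1, this, Multiset.count_singleton]
  · have : c < h := by omega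
    simp only [h1, if_false, this, true_and, Multiset.insert_eq_cons, Multiset.count_cons,
      Multiset.count_singleton]
    omega

theorem step_eq {n h : ℕ} (hh : h = 2 * n + 1) {l m : BPartition} {v : ℕ}
    (H : barStepRec h l m v) : h < 2 * v ∧ partsM l + lo h v = partsM m + hib h v := by
  obtain ⟨-, ⟨rfl, h1, h2⟩ | ⟨h0, h1, h2⟩ | ⟨a, b, h0, h1, h2, h3, h4⟩⟩ := H
  · refine ⟨by omega, ?_⟩
    rw [h2, lo, hib, if_neg (lt_irrefl _), if_pos le_rfl, add_zero]
    conv_lhs => rw [← Multiset.cons_erase h1]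
    rw [add_comm]; rfl
  · refine ⟨by omega, ?_⟩
    rw [h2, lo, hib, if_pos h0, if_pos h0.le]
    conv_lhs => rw [← Multiset.cons_erase h1]
    ext x
    simp only [Multiset.count_add, Multiset.count_cons, Multiset.count_singleton]
    omega
  · have hne : a ≠ b := by omega
    have hlt : v < h ∧ n < v := by
      have ha := pos_of_mem h1
      have hb := pos_of_mem (Multiset.mem_of_mem_erase h2)
      omega
    refine ⟨by omega, ?_⟩
    rw [h4, lo, hib, if_neg (by omega), if_neg (by omega), add_zero]
    conv_lhs => rw [← Multiset.cons_erase h1, ← Multiset.cons_erase h2]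
    have : (v = a ∧ h - v = b) ∨ (v = b ∧ h - v = a) := by omega
    ext x
    rcases this with ⟨e1, e2⟩ | ⟨e1, e2⟩ <;>
    · rw [e2, e1]
      simp only [Multiset.count_add, Multiset.count_cons, Multiset.insert_eq_cons,
        Multiset.count_singleton]
      omega

def SS (h : ℕ) (s : Multiset ℕ) (c : ℕ) : Prop :=
  h < 2 * c ∧ c ∉ s ∧ (c < h → h - c ∉ s) ∧ (h < c → c - h ∈ s)

def Ty (h : ℕ) (s : Multiset ℕ) (a b : ℕ) : Prop :=
  (a < b ∧ SS h s a ∧ SS h s b) ∨ (SS h s a ∧ b = a + h) ∨ (SS h s b ∧ b = a + h ∧ h < 2 * a) ∨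
  (a + b = 2 * h ∧ a < h ∧ h < 2 * a ∧ (SS h s a ∨ SS h s b)) ∨ (a = h ∧ b = h)

theorem SS_h {h : ℕ} {s : Multiset ℕ} (hc : Core h s) (h0 : 0 < h) : SS h s h :=
  ⟨by omega, hc.dv h dvd_rfl, by omega, by omega⟩

theorem ty_unsorted {n h : ℕ} (hh : h = 2 * n + 1) {s l m : Multiset ℕ} (hc : Core h s) (v c : ℕ)
    (hv : h < 2 * v) (hcc : h < 2 * c)
    (hl : ∀ x, ¬ h ∣ x → l.count x ≤ 1) (hm : ∀ x, ¬ h ∣ x → m.count x ≤ 1)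
    (e1 : l + lo h v = m + hib h v) (e2 : m + lo h c = s + hib h c) :
    Ty h s (min v c) (max v c) := by
  have E1 : ∀ x, l.count x + (if h < v ∧ x = v - h then 1 else 0) = m.count x +
      ((if x = v then 1 else 0) + if v < h ∧ x = h - v then 1 else 0) := by
    intro x; rw [← count_lo, ← count_hib, ← Multiset.count_add, ← Multiset.count_add, e1]
  have E2 : ∀ x, m.count x + (if h < c ∧ x = c - h then 1 else 0) = s.count x +
      ((if x = c then 1 else 0) + if c < h ∧ x = h - c then 1 else 0) := by
    intro x; rw [← count_lo, ← count_hib, ← Multiset.count_add, ← Multiset.count_add, e2]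
  have ms : ∀ x, x ∉ s ↔ s.count x = 0 := fun x => Multiset.count_eq_zero.symm
  have ms' : ∀ x, x ∈ s ↔ 0 < s.count x := fun x => Multiset.count_pos.symm
  have dvh : ∀ x, 0 < x → x < h → ¬ h ∣ x := fun x h1 h2 h3 => by
    have := Nat.le_of_dvd h1 h3; omega
  have hSc : SS h s c := by
    refine ⟨hcc, ?_, ?_, ?_⟩
    · by_cases hd : h ∣ c
      · exact hc.dv c hd
      · have := hm c hd
        have := E2 c
        rw [ms]
        split_ifs at this <;> omega
    · intro hlt
      have := hm (h - c) (dvh _ (by omega) (by omega))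
      have := E2 (h - c)
      rw [ms]
      split_ifs at this <;> omega
    · intro hlt
      have := E2 (c - h)
      rw [ms']
      split_ifs at this <;> omega
  have hS' := hSc
  obtain ⟨-, c1, c2, c3⟩ := hS'
  have hmv : ¬ h ∣ v → m.count v = 0 := by
    intro hd
    have := hl v hd
    have := E1 v
    split_ifs at this <;> omega
  have hcm : 0 < m.count c := by
    have := E2 c
    split_ifs at this <;> omega
  rcases lt_trichotomy v h with hlt | heq | hgt
  · have hd := dvh v (by omega) hlt
    have a1 := hmv hd
    have a2 : m.count (h - v) = 0 := by
      have := hl (h - v) (dvh _ (by omega) (by omega))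
      have := E1 (h - v)
      split_ifs at this <;> omega
    have hvc : v ≠ c := by rintro rfl; omega
    by_cases b1 : h < c ∧ v = c - h
    · right; right; left
      rw [min_eq_left (by omega), max_eq_right (by omega)]
      exact ⟨hSc, by omega, by omega⟩
    · by_cases b2 : h < c ∧ h - v = c - h
      · right; right; right; left
        rw [min_eq_left (by omega), max_eq_right (by omega)]
        exact ⟨by omega, by omega, by omega, Or.inr hSc⟩
      · have hSv : SS h s v := by
          refine ⟨hv, ?_, fun _ => ?_, by omega⟩
          · have := E2 v; rw [ms]; rw [if_neg b1] at this; omega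
          · have := E2 (h - v); rw [ms]; rw [if_neg b2] at this; omega
        left
        rcases le_total v c with h1 | h1
        · rw [min_eq_left h1, max_eq_right h1]; exact ⟨by omega, hSv, hSc⟩
        · rw [min_eq_right h1, max_eq_left h1]; exact ⟨by omega, hSc, hSv⟩
  · have hSv : SS h s v := by rw [heq]; exact SS_h hc (by omega)
    by_cases hvc : v = c
    · right; right; right; right
      omega
    · left
      rcases le_total v c with h1 | h1
      · rw [min_eq_left h1, max_eq_right h1]; exact ⟨by omega, hSv, hSc⟩
      · rw [min_eq_right h1, max_eq_left h1]; exact ⟨by omega, hSc, hSv⟩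
  · have a1 : 0 < m.count (v - h) := by
      have := E1 (v - h)
      split_ifs at this <;> omega
    by_cases b1 : v - h = c
    · right; left
      rw [min_eq_right (by omega), max_eq_left (by omega)]
      exact ⟨hSc, by omega⟩
    by_cases b2 : c < h ∧ v - h = h - c
    · right; right; right; left
      rw [min_eq_right (by omega), max_eq_left (by omega)]
      exact ⟨by omega, by omega, by omega, Or.inl hSc⟩
    have a2 : v - h ∈ s := by
      have := E2 (v - h); rw [ms']; rw [if_neg b1, if_neg b2] at this; omega
    have hd : ¬ h ∣ v := fun hd => hc.dv _ (Nat.dvd_sub hd dvd_rfl) a2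
    have a3 := hmv hd
    have hvc : v ≠ c := by rintro rfl; omega
    by_cases b3 : v ∈ s
    · have := E2 v
      rw [ms'] at b3
      right; right; left
      have b4 : h < c ∧ v = c - h := by by_contra hcon; rw [if_neg hcon] at this; omega
      rw [min_eq_left (by omega), max_eq_right (by omega)]
      exact ⟨hSc, by omega, by omega⟩
    · have hSv : SS h s v := ⟨hv, b3, by omega, fun _ => a2⟩
      left
      rcases le_total v c with h1 | h1
      · rw [min_eq_left h1, max_eq_right h1]; exact ⟨by omega, hSv, hSc⟩
      · rw [min_eq_right h1, max_eq_left h1]; exact ⟨by omega, hSc, hSv⟩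

/-- `l` has bars `a`, `b` over `s` -/
def EqB (h : ℕ) (s l : Multiset ℕ) (a b : ℕ) : Prop :=
  l + lo h a + lo h b = s + hib h a + hib h b

theorem pair_eq {a b v w : ℕ} (hab : a ≤ b) (H : ({a, b} : Multiset ℕ) = {v, w}) :
    a = min v w ∧ b = max v w := by
  have h1 : a = v ∧ b = w ∨ a = w ∧ b = v := by
    rw [Multiset.insert_eq_cons, Multiset.insert_eq_cons, Multiset.cons_eq_cons] at H
    rcases H with ⟨h1, h2⟩ | ⟨h1, cs, h2, h3⟩
    · left; exact ⟨h1, Multiset.singleton_inj.1 h2⟩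
    · right
      have e := Multiset.singleton_eq_cons_iff _ |>.1 h2
      have e' := Multiset.singleton_eq_cons_iff _ |>.1 h3
      exact ⟨e'.1.symm, e.1⟩
  omega

theorem bp_ty {n h : ℕ} (hh : h = 2 * n + 1) {σ l : BPartition} (hσ : Core h (partsM σ))
    (hl : IsHStrict h l) {a b : ℕ} (H : BarPositions h σ l a b) :
    Ty h (partsM σ) a b ∧ EqB h (partsM σ) (partsM l) a b := by
  obtain ⟨hab, nu, v, w, s1, s2, e⟩ := H
  obtain ⟨hv, e1⟩ := step_eq hh s1
  obtain ⟨hw, e2⟩ := step_eq hh s2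
  have hty := ty_unsorted hh hσ v w hv hw ((hstrict_iff h l).1 hl) ((hstrict_iff h nu).1 s1.1) e1 e2
  obtain ⟨ea, eb⟩ := pair_eq hab e
  rw [← ea, ← eb] at hty
  refine ⟨hty, ?_⟩
  have E : partsM l + lo h v + lo h w = partsM σ + hib h v + hib h w := by
    rw [e1, add_right_comm, e2, add_right_comm]
  unfold EqB
  rcases le_total v w with h1 | h1
  · rw [ea, eb, min_eq_left h1, max_eq_right h1, E]
  · rw [ea, eb, min_eq_right h1, max_eq_left h1, add_right_comm, E, add_right_comm]

theorem bp_exists {h : ℕ} {σ l : BPartition} (H : InBlock h σ 2 l) :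
    ∃ a b, BarPositions h σ l a b := by
  obtain ⟨-, -, nu, ⟨v, hv⟩, m, ⟨w, hw⟩, e⟩ := H
  change m = σ at e
  subst e
  rcases le_total v w with h1 | h1
  · exact ⟨v, w, h1, nu, v, w, hv, hw, rfl⟩
  · exact ⟨w, v, h1, nu, v, w, hv, hw, Multiset.pair_comm _ _⟩

def gg (h c t : ℕ) : ℕ := (c - t) + (h - c - t) - (c - h - t)

theorem FF_EqB {h : ℕ} {s l : Multiset ℕ} {a b : ℕ} (H : EqB h s l a b) (t : ℕ) :
    FF l t = FF s t + gg h a t + gg h b t := by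
  have hlo : ∀ c, FF (lo h c) t = c - h - t := by
    intro c; unfold lo FF; split_ifs with h1 <;> simp; omega
  have hhi : ∀ c, FF (hib h c) t = (c - t) + (h - c - t) := by
    intro c; unfold hib FF; split_ifs with h1 <;> simp; omega
  have := congrArg (fun m => FF m t) H
  simp only [FF_add, hlo, hhi] at this
  unfold gg
  omega

end BPartition
end S4

section S5
namespace BPartition

def NN (s : Multiset ℕ) (x : ℕ) : ℕ := Multiset.card (s.filter (· < x))

theorem NN_succ (s : Multiset ℕ) (x : ℕ) : NN s (x + 1) = NN s x + s.count x := by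
  unfold NN
  induction s using Multiset.induction_on with
  | empty => simp
  | cons a m ih =>
    rw [Multiset.filter_cons, Multiset.filter_cons, Multiset.card_add, Multiset.card_add, ih,
      Multiset.count_cons]
    split_ifs <;> first | (exfalso; omega) | (simp; omega) | simp

theorem NN_mono (s : Multiset ℕ) {x y : ℕ} (h : x ≤ y) : NN s x ≤ NN s y := by
  induction y, h using Nat.le_induction with
  | base => exact le_rfl
  | succ y _ ih => rw [NN_succ]; omega

theorem NN_Ioo {h : ℕ} {s : Multiset ℕ} (hc : Core h s) (u v : ℕ) (huv : u < v) :
    ((Finset.Ioo u v).filter (· ∈ s)).card + NN s (u + 1) = NN s v := by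
  induction v, huv using Nat.le_induction with
  | base => simp
  | succ v hv ih =>
    have e : Finset.Ioo u (v+1) = insert v (Finset.Ioo u v) := by
      ext x; simp; omega
    rw [e, Finset.filter_insert, NN_succ s v, ← ih]
    have := hc.nd v
    split_ifs with h1
    · rw [Finset.card_insert_of_notMem (by simp)]
      have := Multiset.count_pos.2 h1
      omega
    · rw [Multiset.count_eq_zero.2 h1]; omega

theorem leg0 {h : ℕ} {s l : Multiset ℕ} (hc : Core h s) (u v : ℕ) (huv : u < v)
    (H : ∀ x, u < x → x < v → x ∈ s → x ∈ l) :
    Set.ncard {x : ℕ | u < x ∧ x < v ∧ x ∈ l ∧ x ∈ s} + NN s (u + 1) = NN s v := by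
  rw [← NN_Ioo hc u v huv, ← Set.ncard_coe_finset]
  congr 2
  ext x
  simp only [Set.mem_ofPred_eq, Finset.coe_filter, Finset.mem_Ioo]
  constructor
  · rintro ⟨h1, h2, h3, h4⟩; exact ⟨⟨h1, h2⟩, h4⟩
  · rintro ⟨⟨h1, h2⟩, h4⟩; exact ⟨h1, h2, H x h1 h2 h4, h4⟩

theorem leg1 {h : ℕ} {s l : Multiset ℕ} (hc : Core h s) (u v r : ℕ) (h1 : u < r) (h2 : r < v)
    (hr : r ∈ s) (hr' : r ∉ l)
    (H : ∀ x, u < x → x < v → x ∈ s → x ≠ r → x ∈ l) :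
    Set.ncard {x : ℕ | u < x ∧ x < v ∧ x ∈ l ∧ x ∈ s} + 1 + NN s (u + 1) = NN s v := by
  rw [← NN_Ioo hc u v (by omega)]
  have : r ∈ (Finset.Ioo u v).filter (· ∈ s) := by simp [h1, h2, hr]
  rw [← Finset.card_erase_add_one this, ← Set.ncard_coe_finset]
  congr 3
  ext x
  simp only [Set.mem_ofPred_eq, Finset.coe_erase, Finset.coe_filter, Finset.mem_Ioo, Set.mem_sdiff,
    Set.mem_singleton_iff]
  constructor
  · rintro ⟨h1, h2, h3, h4⟩; exact ⟨⟨⟨h1, h2⟩, h4⟩, by rintro rfl; exact hr' h3⟩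
  · rintro ⟨⟨⟨h1, h2⟩, h4⟩, h5⟩; exact ⟨h1, h2, H x h1 h2 h4 h5, h4⟩

theorem EqB_count {h : ℕ} {s l : Multiset ℕ} {a b : ℕ} (H : EqB h s l a b) (x : ℕ) :
    l.count x + (if h < a ∧ x = a - h then 1 else 0) + (if h < b ∧ x = b - h then 1 else 0) =
    s.count x + ((if x = a then 1 else 0) + if a < h ∧ x = h - a then 1 else 0) +
      ((if x = b then 1 else 0) + if b < h ∧ x = h - b then 1 else 0) := by
  rw [← count_lo, ← count_lo, ← count_hib, ← count_hib, ← Multiset.count_add,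
    ← Multiset.count_add, ← Multiset.count_add, ← Multiset.count_add, H]

theorem SS_hib {h : ℕ} {s : Multiset ℕ} {a x : ℕ} (hs : SS h s a) (hx : x ∈ s) :
    x ≠ a ∧ ¬ (a < h ∧ x = h - a) := by
  obtain ⟨h1, h2, h3, h4⟩ := hs
  constructor
  · rintro rfl; exact h2 hx
  · rintro ⟨h5, rfl⟩; exact h3 h5 hx

theorem memT1 {h : ℕ} {s l : Multiset ℕ} {a b : ℕ} (hc : Core h s) (H : EqB h s l a b)
    (hab : a < b) (ha : SS h s a) (hb : SS h s b) {x : ℕ} (hx : x ∈ s) :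
    x ∈ l ↔ ¬ (h < a ∧ x = a - h) ∧ ¬ (h < b ∧ x = b - h) := by
  have h1 := EqB_count H x
  have h2 := SS_hib ha hx
  have h3 := SS_hib hb hx
  have h4 := hc.nd x
  rw [if_neg h2.1, if_neg h2.2, if_neg h3.1, if_neg h3.2] at h1
  have h5 := Multiset.count_pos.2 hx
  rw [← Multiset.count_pos]
  split_ifs at h1 <;> omega

theorem memT {h : ℕ} {s l : Multiset ℕ} {a b : ℕ} (hc : Core h s) (H : EqB h s l a b)
    (hT : (SS h s a ∧ b = a + h) ∨ (SS h s b ∧ b = a + h ∧ h < 2 * a) ∨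
  (a + b = 2 * h ∧ a < h ∧ h < 2 * a ∧ (SS h s a ∨ SS h s b)) ∨ (a = h ∧ b = h))
    {x : ℕ} (hx : x ∈ s) :
    x ∈ l ↔ ¬ (h < a ∧ x = a - h) := by
  have h1 := EqB_count H x
  have h4 := hc.nd x
  have h5 := Multiset.count_pos.2 hx
  rw [← Multiset.count_pos]
  rcases hT with ⟨ha, e⟩ | ⟨hb, e, h6⟩ | ⟨e, h6, h7, -⟩ | ⟨e1, e2⟩
  · have h2 := SS_hib ha hx
    have := ha.1
    rw [if_neg h2.1, if_neg h2.2] at h1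
    split_ifs at h1 <;> omega
  · have h2 := SS_hib hb hx
    have ha : a ∈ s := by
      have := hb.2.2.2 (by omega)
      rwa [e, Nat.add_sub_cancel] at this
    have h8 : ¬ (a < h ∧ x = h - a) := by
      rintro ⟨h9, rfl⟩
      exact hc.op a ha h9 hx
    rw [if_neg h2.1, if_neg h2.2, if_neg h8] at h1
    split_ifs at h1 <;> omega
  · split_ifs at h1 <;> omega
  · split_ifs at h1 <;> omega

def MM (h : ℕ) (s : Multiset ℕ) (c : ℕ) : ℤ :=
  if c ≤ h then (h : ℤ) - c + 1 + NN s c - NN s (h - c + 1) else (NN s c : ℤ) - NN s (c - h)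

theorem MM_succ {h : ℕ} {s : Multiset ℕ} (hc : Core h s) (c : ℕ) (h2 : h < 2 * c) :
    (SS h s c → MM h s c = MM h s (c + 1) + 1) ∧ (¬ SS h s c → MM h s c = MM h s (c + 1)) := by
  have h0 : 0 ∉ s := fun h0 => by have := hc.pos 0 h0; omega
  have n1 := NN_succ s c
  have cp : ∀ x, (x ∈ s ∧ s.count x = 1) ∨ (x ∉ s ∧ s.count x = 0) := by
    intro x
    by_cases hx : x ∈ s
    · have := Multiset.count_pos.2 hx
      have := hc.nd x
      left; exact ⟨hx, by omega⟩
    · right; exact ⟨hx, Multiset.count_eq_zero.2 hx⟩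
  unfold SS MM
  rcases lt_trichotomy c h with hlt | heq | hgt
  · rw [if_pos (by omega), if_pos (by omega)]
    obtain ⟨y, hy⟩ : ∃ y, y = h - c := ⟨_, rfl⟩
    have e : h - (c + 1) + 1 = y := by omega
    rw [e, ← hy, NN_succ s y, n1]
    have := hc.op c
    rw [← hy] at this
    rcases cp c with ⟨a1, a2⟩ | ⟨a1, a2⟩ <;> rcases cp y with ⟨b1, b2⟩ | ⟨b1, b2⟩ <;>
      constructor <;> intro hs <;> push_cast <;> rw [a2, b2] <;> simp_all <;> omega
  · subst heq
    have := hc.dv c dvd_rfl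
    rw [if_pos le_rfl, if_neg (by omega), n1, Multiset.count_eq_zero.2 this]
    have e : c - c + 1 = c + 1 - c := by omega
    rw [e]
    constructor
    · intro _; push_cast; omega
    · intro hs; exact absurd ⟨h2, this, by omega, by omega⟩ hs
  · rw [if_neg (by omega), if_neg (by omega)]
    obtain ⟨y, hy⟩ : ∃ y, y = c - h := ⟨_, rfl⟩
    have e : c + 1 - h = y + 1 := by omega
    rw [e, ← hy, NN_succ s y, n1]
    have := hc.dn c
    rw [← hy] at this
    rcases cp c with ⟨a1, a2⟩ | ⟨a1, a2⟩ <;> rcases cp y with ⟨b1, b2⟩ | ⟨b1, b2⟩ <;>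
      constructor <;> intro hs <;> push_cast <;> rw [a2, b2] <;> simp_all <;> omega

theorem MM_le {h : ℕ} {s : Multiset ℕ} (hc : Core h s) {c d : ℕ} (h2 : h < 2 * c) (hcd : c ≤ d) :
    MM h s d ≤ MM h s c := by
  induction d, hcd using Nat.le_induction with
  | base => exact le_rfl
  | succ d hd ih =>
    have := MM_succ hc d (by omega)
    by_cases hs : SS h s d
    · have := this.1 hs; omega
    · have := this.2 hs; omega

theorem MM_lt {h : ℕ} {s : Multiset ℕ} (hc : Core h s) {c d : ℕ} (hs : SS h s c) (hcd : c < d) :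
    MM h s d + 1 ≤ MM h s c := by
  have := (MM_succ hc c hs.1).1 hs
  have := MM_le hc (c := c + 1) (d := d) (by have := hs.1; omega) (by omega)
  omega

/-- legs of unadjusted bars -/
theorem leg_plain {h : ℕ} {σ l : BPartition} (hpos : 0 < h) (hc : Core h (partsM σ)) {c : ℕ} (h2 : h < 2 * c)
    (H : ∀ x ∈ partsM σ, x < c → (c < h → h - c < x) → (h ≤ c → c - h < x) → x ∈ partsM l) :
    (legLen h σ l c : ℤ) = MM h (partsM σ) c -
      if c ≤ h ∨ c - h ∈ partsM σ then 1 else 0 := by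
  unfold legLen MM
  have h0 : 0 ∉ partsM σ := fun h0 => by have := hc.pos 0 h0; omega
  by_cases h1 : h ≤ c
  · rw [if_pos h1]
    have e := leg0 (l := partsM l) hc (c - h) c (by omega)
      (fun x a b d => H x d b (by omega) (fun _ => a))
    rcases h1.eq_or_lt with rfl | hlt
    · rw [if_pos le_rfl, if_pos (Or.inl le_rfl)]; push_cast; omega
    · rw [if_neg (by omega)]
      rw [NN_succ] at e
      have := hc.nd (c - h)
      by_cases hm : c - h ∈ partsM σ
      · have := Multiset.count_pos.2 hm
        rw [if_pos (Or.inr hm)]; omega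
      · rw [Multiset.count_eq_zero.2 hm] at e
        have : ¬ (c ≤ h ∨ c - h ∈ partsM σ) := by rintro (h | h); omega; exact hm h
        rw [if_neg this]; omega
  · rw [if_neg h1, if_pos (by omega), if_pos (Or.inl (by omega))]
    have e := leg0 (l := partsM l) hc (h - c) c (by omega)
      (fun x a b d => H x d b (fun _ => a) (by omega))
    push_cast
    omega

theorem leg_adj {h : ℕ} {σ l : BPartition} (hc : Core h (partsM σ)) {c r : ℕ} (h2 : h < 2 * c)
    (hr : r ∈ partsM σ) (hr' : r ∉ partsM l) (r1 : r < c) (r2 : c < h → h - c < r)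
    (r3 : h ≤ c → c - h < r) (hcs : SS h (partsM σ) c)
    (H : ∀ x ∈ partsM σ, x < c → (c < h → h - c < x) → (h ≤ c → c - h < x) → x ≠ r →
      x ∈ partsM l) :
    (legLen h σ l c : ℤ) = MM h (partsM σ) c - 2 := by
  unfold legLen MM
  by_cases h1 : h ≤ c
  · rw [if_pos h1]
    have e := leg1 (l := partsM l) hc (c - h) c r (r3 h1) r1 hr hr'
      (fun x a b d => H x d b (by omega) (fun _ => a))
    rcases h1.eq_or_lt with rfl | hlt
    · rw [if_pos le_rfl]; omega
    · rw [if_neg (by omega)]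
      rw [NN_succ] at e
      have := hc.nd (c - h)
      have := Multiset.count_pos.2 (hcs.2.2.2 hlt)
      omega
  · rw [if_neg h1, if_pos (by omega)]
    have e := leg1 (l := partsM l) hc (h - c) c r (r2 (by omega)) r1 hr hr'
      (fun x a b d => H x d b (fun _ => a) (by omega))
    push_cast
    omega

theorem ddd_of {h : ℕ} {σ l : BPartition} {a b : ℕ} {x y z : ℤ}
    (h1 : (legLen h σ l a : ℤ) = x) (h2 : (legLen h σ l b : ℤ) = y) (h3 : x - y = z) (h4 : 0 ≤ z) :
    (ddd h σ l a b : ℤ) = z := by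
  unfold ddd; omega

theorem SS_e {h : ℕ} {s : Multiset ℕ} {c : ℕ} (hs : SS h s c) : c ≤ h ∨ c - h ∈ s := by
  rcases le_or_gt c h with h1 | h1
  · exact Or.inl h1
  · exact Or.inr (hs.2.2.2 h1)

theorem ddd_T1 {h : ℕ} {σ l : BPartition} {a b : ℕ} (h0 : 0 < h) (hc : Core h (partsM σ))
    (H : EqB h (partsM σ) (partsM l) a b)
    (hab : a < b) (ha : SS h (partsM σ) a) (hb : SS h (partsM σ) b) :
    (legLen h σ l b : ℤ) = MM h (partsM σ) b - 1 ∧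
    (legLen h σ l a : ℤ) = MM h (partsM σ) a - 1 - (if b < a + h ∧ 2 * h < a + b then 1 else 0) ∧
    (ddd h σ l a b : ℤ) = MM h (partsM σ) a - MM h (partsM σ) b -
      if b < a + h ∧ 2 * h < a + b then 1 else 0 := by
  have hm := fun x hx => memT1 hc H hab ha hb (x := x) hx
  have e1 : (legLen h σ l b : ℤ) = MM h (partsM σ) b - 1 := by
    rw [leg_plain (by omega) hc hb.1, if_pos (SS_e hb)]
    intro x hx h1 h2 h3
    rw [hm x hx]; omega
  have e2 : (legLen h σ l a : ℤ) =
      MM h (partsM σ) a - 1 - (if b < a + h ∧ 2 * h < a + b then 1 else 0) := by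
    split_ifs with hadj
    · have hr := hb.2.2.2 (by omega)
      rw [leg_adj (r := b - h) hc ha.1 hr _ _ _ _ ha]
      · ring
      · intro x hx h1 h2 h3 h4
        rw [hm x hx]; omega
      · rw [hm _ hr]; omega
      · omega
      · omega
      · omega
    · rw [leg_plain (by omega) hc ha.1, if_pos (SS_e ha)]
      · ring
      · intro x hx h1 h2 h3
        rw [hm x hx]; omega
  refine ⟨e1, e2, ddd_of e2 e1 (by ring) ?_⟩
  have := MM_lt hc ha hab
  split_ifs <;> omega

theorem ddd_T {h : ℕ} {σ l : BPartition} {a b : ℕ} (h0 : 0 < h) (hc : Core h (partsM σ))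
    (H : EqB h (partsM σ) (partsM l) a b)
    (hT : (SS h (partsM σ) a ∧ b = a + h) ∨ (SS h (partsM σ) b ∧ b = a + h ∧ h < 2 * a) ∨
  (a + b = 2 * h ∧ a < h ∧ h < 2 * a ∧ (SS h (partsM σ) a ∨ SS h (partsM σ) b))) :
    (ddd h σ l a b : ℤ) = MM h (partsM σ) (a + 1) - MM h (partsM σ) b := by
  have hm := fun x hx => memT hc H (by tauto) (x := x) hx
  have g : a < b ∧ h < 2 * a ∧ h < b := by
    rcases hT with ⟨⟨h1, -⟩, h2⟩ | ⟨-, h2⟩ | h2 <;> omega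
  have e1 := leg_plain (l := l) h0 hc (c := b) (by omega) (by
    intro x hx h1 h2 h3
    rw [hm x hx]; omega)
  have e2 := leg_plain (l := l) h0 hc (c := a) (by omega) (by
    intro x hx h1 h2 h3
    rw [hm x hx]; omega)
  have hle := MM_le hc (c := a + 1) (d := b) (by omega) (by omega)
  have hs := MM_succ hc a (by omega)
  refine ddd_of e2 e1 ?_ (by omega)
  rcases hT with ⟨ha, e⟩ | ⟨hb, e, -⟩ | ⟨e, h6, h7, ha | hb⟩
  · have : ¬ (b ≤ h ∨ b - h ∈ partsM σ) := by
      rw [e, Nat.add_sub_cancel]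
      rintro (h | h)
      · omega
      · exact ha.2.1 h
    rw [if_pos (SS_e ha), if_neg this, hs.1 ha]; ring
  · have hma : a ∈ partsM σ := by
      have := hb.2.2.2 g.2.2
      rwa [e, Nat.add_sub_cancel] at this
    have : a ≤ h ∨ a - h ∈ partsM σ := by
      rcases le_or_gt a h with h1 | h1
      · exact Or.inl h1
      · exact Or.inr (hc.dn a hma h1)
    rw [if_pos this, if_pos (SS_e hb), hs.2 (fun hs => hs.2.1 hma)]; ring
  · have : ¬ (b ≤ h ∨ b - h ∈ partsM σ) := by
      have e3 : b - h = h - a := by omega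
      rw [e3]
      rintro (h | h)
      · omega
      · exact ha.2.2.1 h6 h
    rw [if_pos (SS_e ha), if_neg this, hs.1 ha]; ring
  · have hma : h - a ∈ partsM σ := by
      have := hb.2.2.2 g.2.2
      have e3 : b - h = h - a := by omega
      rwa [e3] at this
    rw [if_pos (Or.inl h6.le), if_pos (SS_e hb), hs.2 (fun hs => hs.2.2.1 h6 hma)]; ring

theorem ddd_T5 {h : ℕ} {σ l : BPartition} : ddd h σ l h h = 0 := by unfold ddd; omega

end BPartition
end S5

section S6
namespace BPartition

theorem gg_mono {h c d : ℕ} (hc : h < 2 * c) (hcd : c ≤ d) (t : ℕ) : gg h c t ≤ gg h d t := by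
  unfold gg; omega

theorem gg_in {h a b k : ℕ} (hk : h < 2 * (a - k)) (hab : a ≤ b) (hs : a + b ≤ 2 * h) (t : ℕ) :
    gg h a t + gg h b t ≤ gg h (a - k) t + gg h (b + k) t := by
  unfold gg
  omega

def LE2 (h a b x y : ℕ) : Prop :=
  (a ≤ x ∧ b ≤ y) ∨ (x ≤ a ∧ a ≤ b ∧ a + b ≤ 2 * h ∧ a + b ≤ x + y)

theorem LE2_gg {h a b x y : ℕ} (ha : h < 2 * a) (hb : h < 2 * b) (hx : h < 2 * x)
    (H : LE2 h a b x y) (t : ℕ) :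
    gg h a t + gg h b t ≤ gg h x t + gg h y t := by
  rcases H with ⟨h1, h2⟩ | ⟨h1, h2, h3, h4⟩
  · exact Nat.add_le_add (gg_mono ha h1 t) (gg_mono hb h2 t)
  · refine (gg_in (k := a - x) (by omega) h2 h3 t).trans ?_
    have e : a - (a - x) = x := by omega
    rw [e]
    exact Nat.add_le_add_left (gg_mono (by omega) (by omega) t) _

/-- type together with transformed bars and the value of `∂` -/
def DTy (h : ℕ) (s : Multiset ℕ) (F : ℕ → ℕ) (a b a' b' : ℕ) (D : ℤ) : Prop :=
  (a < b ∧ SS h s a ∧ SS h s b ∧ a' = F a ∧ b' = F b ∧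
    D = MM h s a - MM h s b - if b < a + h ∧ 2 * h < a + b then 1 else 0) ∨
  (SS h s a ∧ b = a + h ∧ a' = F a ∧ b' = F a + h ∧ D = MM h s (a+1) - MM h s b) ∨
  (SS h s b ∧ b = a + h ∧ h < 2 * a ∧ b' = F b ∧ a' + h = F b ∧ D = MM h s (a+1) - MM h s b) ∨
  (a + b = 2 * h ∧ a < h ∧ h < 2 * a ∧ SS h s a ∧ a' = F a ∧ a' + b' = 2 * h ∧
    D = MM h s (a+1) - MM h s b) ∨
  (a + b = 2 * h ∧ a < h ∧ h < 2 * a ∧ SS h s b ∧ b' = F b ∧ a' + b' = 2 * h ∧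
    D = MM h s (a+1) - MM h s b) ∨
  (a = h ∧ b = h ∧ a' = h ∧ b' = h ∧ D = 0)

theorem MM_cmp {h : ℕ} {s : Multiset ℕ} (hc : Core h s) {c d : ℕ} (h1 : h < 2 * c)
    (h2 : h < 2 * d) : (c < d → MM h s d ≤ MM h s c) ∧ (d < c → MM h s c ≤ MM h s d) ∧
    (c = d → MM h s c = MM h s d) :=
  ⟨fun h => MM_le hc h1 h.le, fun h => MM_le hc h2 h.le, fun h => by rw [h]⟩

theorem MM_cmp' {h : ℕ} {s : Multiset ℕ} (hc : Core h s) {c d : ℕ} (h1 : SS h s c)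
    (h2 : SS h s d) : (c < d → MM h s d + 1 ≤ MM h s c) ∧ (d < c → MM h s c + 1 ≤ MM h s d) ∧
    (c = d → MM h s c = MM h s d) :=
  ⟨fun h => MM_lt hc h1 h, fun h => MM_lt hc h2 h, fun h => by rw [h]⟩

theorem MM_cmp1 {h : ℕ} {s : Multiset ℕ} (hc : Core h s) {c d : ℕ} (h1 : h < 2 * c)
    (h2 : SS h s d) : (c ≤ d → MM h s d ≤ MM h s c) ∧ (d < c → MM h s c + 1 ≤ MM h s d) :=
  ⟨fun h => MM_le hc h1 h, fun h => MM_lt hc h2 h⟩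


theorem arithA1 {h p q a b a' b' : ℕ} {x y u v D : ℤ} (h3 : 3 ≤ h) (hp : h < 2 * p) (q1 : p ≤ q)
    (q2 : q ≤ p + 1) (hab : a < b) (n2 : ¬ (a = p + 1 ∧ b = p + h))
    (eD : D = x - y - if b < a + h ∧ 2 * h < a + b then 1 else 0)
    (A : (a = p + 1 ∧ a' = q ∧ x = u) ∨ (a = p + h ∧ a' = q + h + 1) ∨
        (a < p ∧ a' = a ∧ u + 1 ≤ x) ∨ (p + 1 < a ∧ a' = a ∧ x + 1 ≤ u))
    (B : (b = p + 1 ∧ b' = q) ∨ (b = p + h ∧ b' = q + h + 1 ∧ y = v) ∨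
        (b < p + h ∧ b ≠ p + 1 ∧ b' = b ∧ v + 1 ≤ y) ∨ (p + h + 1 < b ∧ b' = b ∧ y + 1 ≤ v)) :
    ((u - v - 1 ≤ D → D ≤ u - v + 1 →
      (LE2 h (p + 1) (p + 1 + h) a b ∧ LE2 h q (q + 1 + h) a' b') ∨
      (LE2 h a b p (p + h) ∧ LE2 h a' b' q (q + 1 + h))) ∧
    (u - v - 2 ≤ D → D ≤ u - v →
      (LE2 h (p + 1) (p + h) a b ∧ LE2 h (q + 1) (q + 1 + h) a' b') ∨
      (LE2 h a b (p + 1) (p + h) ∧ LE2 h a' b' q (q + h)))) := by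
  rcases A with ⟨A1, A2, A3⟩ | ⟨A1, A2⟩ | ⟨A1, A2, A3⟩ | ⟨A1, A2, A3⟩
  · rcases B with ⟨B1, B2⟩ | ⟨B1, B2, B3⟩ | ⟨B1, B0, B2, B3⟩ | ⟨B1, B2, B3⟩
    · omega
    · omega
    · clear n2
      split_ifs at eD with hj
      · exact ⟨fun d1 d2 => by exfalso; omega, fun _ _ => Or.inr ⟨Or.inl ⟨by omega, by omega⟩, Or.inl ⟨by omega, by omega⟩⟩⟩
      · exact ⟨fun _ _ => Or.inr ⟨Or.inr ⟨by omega, by omega, by omega, by omega⟩, Or.inl ⟨by omega, by omega⟩⟩, fun _ _ => Or.inr ⟨Or.inl ⟨by omega, by omega⟩, Or.inl ⟨by omega, by omega⟩⟩⟩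
    · clear n2
      rw [if_neg (by omega)] at eD
      exact ⟨fun _ _ => Or.inl ⟨Or.inl ⟨by omega, by omega⟩, Or.inl ⟨by omega, by omega⟩⟩, fun d1 d2 => by exfalso; omega⟩
  · clear n2 eD
    have : p + h + 1 < b ∧ b' = b := by omega
    exact ⟨fun _ _ => Or.inl ⟨Or.inl ⟨by omega, by omega⟩, Or.inl ⟨by omega, by omega⟩⟩, fun _ _ => Or.inl ⟨Or.inl ⟨by omega, by omega⟩, Or.inl ⟨by omega, by omega⟩⟩⟩
  · clear n2
    rcases B with ⟨B1, B2⟩ | ⟨B1, B2, B3⟩ | ⟨B1, B0, B2, B3⟩ | ⟨B1, B2, B3⟩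
    · exact ⟨fun _ _ => Or.inr ⟨Or.inl ⟨by omega, by omega⟩, Or.inl ⟨by omega, by omega⟩⟩, fun _ _ => Or.inr ⟨Or.inl ⟨by omega, by omega⟩, Or.inl ⟨by omega, by omega⟩⟩⟩
    · rw [if_neg (by omega)] at eD
      exact ⟨fun _ _ => Or.inr ⟨Or.inl ⟨by omega, by omega⟩, Or.inl ⟨by omega, by omega⟩⟩, fun d1 d2 => by exfalso; omega⟩
    · exact ⟨fun _ _ => Or.inr ⟨Or.inl ⟨by omega, by omega⟩, Or.inl ⟨by omega, by omega⟩⟩, fun _ _ => Or.inr ⟨Or.inl ⟨by omega, by omega⟩, Or.inl ⟨by omega, by omega⟩⟩⟩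
    · rw [if_neg (by omega)] at eD
      exact ⟨fun d1 d2 => by exfalso; omega, fun d1 d2 => by exfalso; omega⟩
  · clear n2
    rcases B with ⟨B1, B2⟩ | ⟨B1, B2, B3⟩ | ⟨B1, B0, B2, B3⟩ | ⟨B1, B2, B3⟩
    · omega
    · rw [if_pos (by omega)] at eD
      exact ⟨fun d1 d2 => by exfalso; omega, fun _ _ => Or.inl ⟨Or.inl ⟨by omega, by omega⟩, Or.inl ⟨by omega, by omega⟩⟩⟩
    · split_ifs at eD with hj
      · exact ⟨fun d1 d2 => by exfalso; omega, fun d1 d2 => by exfalso; omega⟩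
      · exact ⟨fun d1 d2 => by exfalso; omega, fun _ _ => Or.inr ⟨Or.inr ⟨by omega, by omega, by omega, by omega⟩, Or.inr ⟨by omega, by omega, by omega, by omega⟩⟩⟩
    · exact ⟨fun _ _ => Or.inl ⟨Or.inl ⟨by omega, by omega⟩, Or.inl ⟨by omega, by omega⟩⟩, fun _ _ => Or.inl ⟨Or.inl ⟨by omega, by omega⟩, Or.inl ⟨by omega, by omega⟩⟩⟩

theorem arithA {h p q : ℕ} {s : Multiset ℕ} (hc : Core h s) (h3 : 3 ≤ h) (hodd : h % 2 = 1)
    (hp : h < 2 * p) (hq : q = p ∨ (q = p + 1 ∧ p + 1 = h))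
    (s1 : SS h s (p + 1)) (s2 : SS h s (p + h)) (s3 : ¬ SS h s p) (s4 : ¬ SS h s (p + h + 1))
    {a b a' b' : ℕ} {D u v : ℤ} (hu : MM h s (p + 1) = u) (hv : MM h s (p + h) = v)
    {F : ℕ → ℕ} (F1 : F (p + 1) = q) (F2 : F (p + h) = q + h + 1)
    (F3 : ∀ c, SS h s c → c ≠ p + 1 → c ≠ p + h → F c = c)
    (hT : DTy h s F a b a' b' D)
    (n1 : ¬ (a = p ∧ b = p + h)) (n2 : ¬ (a = p + 1 ∧ b = p + h))
    (n3 : ¬ (a = p + 1 ∧ b = p + 1 + h)) :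
    ((u - v - 1 ≤ D → D ≤ u - v + 1 →
      (LE2 h (p + 1) (p + 1 + h) a b ∧ LE2 h q (q + 1 + h) a' b') ∨
      (LE2 h a b p (p + h) ∧ LE2 h a' b' q (q + 1 + h))) ∧
    (u - v - 2 ≤ D → D ≤ u - v →
      (LE2 h (p + 1) (p + h) a b ∧ LE2 h (q + 1) (q + 1 + h) a' b') ∨
      (LE2 h a b (p + 1) (p + h) ∧ LE2 h a' b' q (q + h)))) := by
  have q1 : p ≤ q := by omega
  have q2 : q ≤ p + 1 := by omega
  have hF : ∀ c, SS h s c → c ≠ p ∧ c ≠ p + h + 1 ∧ h < 2 * c ∧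
      ((c = p + 1 ∧ F c = q) ∨ (c = p + h ∧ F c = q + h + 1) ∨
      (c ≠ p + 1 ∧ c ≠ p + h ∧ F c = c)) := by
    intro c hs
    refine ⟨fun h => s3 (h ▸ hs), fun h => s4 (h ▸ hs), hs.1, ?_⟩
    by_cases h1 : c = p + 1
    · left; exact ⟨h1, h1 ▸ F1⟩
    by_cases h2 : c = p + h
    · right; left; exact ⟨h2, h2 ▸ F2⟩
    · right; right; exact ⟨h1, h2, F3 c hs h1 h2⟩
  clear F1 F2 F3 s3 s4
  rcases hT with ⟨hab, ha, hb, e1, e2, e3⟩ | ⟨ha, hb, e1, e2, e3⟩ | ⟨hb, hab, h2, e1, e2, e3⟩ |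
    ⟨hab, h2, h4, ha, e1, e2, e3⟩ | ⟨hab, h2, h4, hb, e1, e2, e3⟩ | ⟨e1, e2, e3, e4, e5⟩
  · have A := hF a ha
    have B := hF b hb
    have m1 := MM_cmp' hc ha s1
    have m2 := MM_cmp' hc hb s2
    rw [← e1, hu] at *
    rw [← e2, hv] at *
    clear hF hq
    generalize MM h s a = x at *
    generalize MM h s b = y at *
    obtain ⟨A1, A2, A3, A4⟩ := A
    obtain ⟨B1, B2, B3, B4⟩ := B
    refine arithA1 h3 hp q1 q2 hab n2 e3 ?_ ?_ <;> clear e3 n1 n2 n3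
    · clear m2 B4; rcases A4 with A4 | A4 | A4 <;> omega
    · clear m1 A4; rcases B4 with A4 | A4 | A4 <;> omega
  · obtain ⟨A1, A2, A3, A4⟩ := hF a ha
    rw [← e1] at A4 e2
    clear n1 n2 e3 hF
    have A4 : (a = p + h ∧ a' = q + h + 1) ∨ (a < p ∧ a' = a) ∨ (p + 1 < a ∧ a' = a) := by omega
    rcases A4 with A4 | A4 | A4
    · exact ⟨fun _ _ => Or.inl ⟨Or.inl ⟨by omega, by omega⟩, Or.inl ⟨by omega, by omega⟩⟩, fun _ _ => Or.inl ⟨Or.inl ⟨by omega, by omega⟩, Or.inl ⟨by omega, by omega⟩⟩⟩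
    · exact ⟨fun _ _ => Or.inr ⟨Or.inl ⟨by omega, by omega⟩, Or.inl ⟨by omega, by omega⟩⟩, fun _ _ => Or.inr ⟨Or.inl ⟨by omega, by omega⟩, Or.inl ⟨by omega, by omega⟩⟩⟩
    · exact ⟨fun _ _ => Or.inl ⟨Or.inl ⟨by omega, by omega⟩, Or.inl ⟨by omega, by omega⟩⟩, fun _ _ => Or.inl ⟨Or.inl ⟨by omega, by omega⟩, Or.inl ⟨by omega, by omega⟩⟩⟩
  · obtain ⟨A1, A2, A3, A4⟩ := hF b hb
    rw [← e1] at A4 e2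
    clear n2 n3 e3 hF
    have A4 : (b = p + 1 ∧ b' = q) ∨ (b < p + h ∧ b' = b) ∨ (p + h + 1 < b ∧ b' = b) := by omega
    clear n1
    rcases A4 with A4 | A4 | A4
    · exact ⟨fun _ _ => Or.inr ⟨Or.inl ⟨by omega, by omega⟩, Or.inl ⟨by omega, by omega⟩⟩, fun _ _ => Or.inr ⟨Or.inl ⟨by omega, by omega⟩, Or.inl ⟨by omega, by omega⟩⟩⟩
    · exact ⟨fun _ _ => Or.inr ⟨Or.inl ⟨by omega, by omega⟩, Or.inl ⟨by omega, by omega⟩⟩, fun _ _ => Or.inr ⟨Or.inl ⟨by omega, by omega⟩, Or.inl ⟨by omega, by omega⟩⟩⟩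
    · exact ⟨fun _ _ => Or.inl ⟨Or.inl ⟨by omega, by omega⟩, Or.inl ⟨by omega, by omega⟩⟩, fun _ _ => Or.inl ⟨Or.inl ⟨by omega, by omega⟩, Or.inl ⟨by omega, by omega⟩⟩⟩
  · obtain ⟨A1, A2, A3, A4⟩ := hF a ha
    rw [← e1] at A4
    have m1 := MM_cmp' hc ha s1
    have m2 := MM_cmp1 hc (c := b) (by omega) s2
    have m3 := (MM_succ hc a h4).1 ha
    rw [hu] at m1
    rw [hv] at m2
    generalize MM h s a = x at *
    generalize MM h s (a + 1) = x' at *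
    generalize MM h s b = y at *
    clear n1 n2 n3 hF hq
    have A4 : (a = p + 1 ∧ a' = q) ∨ (a < p ∧ a' = a) ∨ (p + 1 < a ∧ a' = a) := by omega
    rcases A4 with A4 | A4 | A4
    · clear m1 m2
      exact ⟨fun _ _ => Or.inr ⟨Or.inr ⟨by omega, by omega, by omega, by omega⟩, Or.inl ⟨by omega, by omega⟩⟩, fun _ _ => Or.inr ⟨Or.inl ⟨by omega, by omega⟩, Or.inl ⟨by omega, by omega⟩⟩⟩
    · clear m1 m2
      exact ⟨fun _ _ => Or.inr ⟨Or.inl ⟨by omega, by omega⟩, Or.inl ⟨by omega, by omega⟩⟩, fun _ _ => Or.inr ⟨Or.inl ⟨by omega, by omega⟩, Or.inl ⟨by omega, by omega⟩⟩⟩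
    · exact ⟨fun d1 d2 => by exfalso; omega, fun _ _ => Or.inr ⟨Or.inr ⟨by omega, by omega, by omega, by omega⟩, Or.inr ⟨by omega, by omega, by omega, by omega⟩⟩⟩
  · obtain ⟨A1, A2, A3, A4⟩ := hF b hb
    rw [← e1] at A4
    have m1 := MM_cmp1 hc (c := a + 1) (by omega) s1
    have m2 := MM_cmp' hc hb s2
    rw [hu] at m1
    rw [hv] at m2
    generalize MM h s (a + 1) = x' at *
    generalize MM h s b = y at *
    clear n1 n2 n3 hF
    have A4 : (b = p + 1 ∧ b' = q ∧ q = p) ∨ (a ≤ p ∧ b' = b) ∨ (p < a ∧ b' = b) := by omega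
    clear hq
    rcases A4 with A4 | A4 | A4
    · clear m1 m2
      exact ⟨fun _ _ => Or.inr ⟨Or.inl ⟨by omega, by omega⟩, Or.inl ⟨by omega, by omega⟩⟩, fun _ _ => Or.inr ⟨Or.inl ⟨by omega, by omega⟩, Or.inl ⟨by omega, by omega⟩⟩⟩
    · clear m1 m2
      exact ⟨fun _ _ => Or.inr ⟨Or.inl ⟨by omega, by omega⟩, Or.inl ⟨by omega, by omega⟩⟩, fun _ _ => Or.inr ⟨Or.inl ⟨by omega, by omega⟩, Or.inl ⟨by omega, by omega⟩⟩⟩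
    · exact ⟨fun d1 d2 => by exfalso; omega, fun _ _ => Or.inr ⟨Or.inr ⟨by omega, by omega, by omega, by omega⟩, Or.inr ⟨by omega, by omega, by omega, by omega⟩⟩⟩
  · have hS := SS_h hc (by omega)
    have m1 := MM_cmp' hc hS s1
    have m2 := MM_cmp' hc hS s2
    have A := (hF h hS).1
    rw [hu] at m1
    rw [hv] at m2
    generalize MM h s h = w at *
    clear n1 n2 n3 hF
    rcases (by omega : h < p ∨ (p + 1 = h) ∨ p + 1 < h) with A4 | A4 | A4
    · clear m1 m2
      exact ⟨fun _ _ => Or.inr ⟨Or.inl ⟨by omega, by omega⟩, Or.inl ⟨by omega, by omega⟩⟩, fun _ _ => Or.inr ⟨Or.inl ⟨by omega, by omega⟩, Or.inl ⟨by omega, by omega⟩⟩⟩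
    · clear m1 m2
      exact ⟨fun _ _ => Or.inr ⟨by unfold LE2; omega, by unfold LE2; omega⟩,
        fun _ _ => Or.inr ⟨by unfold LE2; omega, by unfold LE2; omega⟩⟩
    · exact ⟨fun d1 d2 => by exfalso; omega, fun _ _ => Or.inr ⟨Or.inr ⟨by omega, by omega, by omega, by omega⟩, Or.inr ⟨by omega, by omega, by omega, by omega⟩⟩⟩

theorem arithB1 {h P Q a b a' b' : ℕ} {x y u v D : ℤ} (hPQ : P + Q + 1 = 2 * h)
    (hP : h < 2 * P) (hP2 : P + 1 < h) (ha : h < 2 * a) (hab : a < b) (n2 : ¬ (a = P ∧ b = Q))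
    (eD : D = x - y - if b < a + h ∧ 2 * h < a + b then 1 else 0)
    (A : (a = P ∧ a' = P + 1 ∧ x = u) ∨ (a = Q ∧ a' = Q + 1) ∨
        (a < P ∧ a' = a ∧ u + 1 ≤ x) ∨ (P + 1 < a ∧ a' = a ∧ x + 1 ≤ u))
    (B : (b = P ∧ b' = P + 1) ∨ (b = Q ∧ b' = Q + 1 ∧ y = v) ∨
        (b < Q ∧ b ≠ P ∧ b ≠ P + 1 ∧ b' = b ∧ v + 1 ≤ y) ∨ (Q + 1 < b ∧ b' = b ∧ y + 1 ≤ v)) :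
    ((u - v - 1 ≤ D → D ≤ u - v + 1 →
      (LE2 h P (Q + 1) a b ∧ LE2 h P (Q + 1) a' b') ∨
      (LE2 h a b P Q ∧ LE2 h a' b' P (Q + 1))) ∧
    (u - v - 2 ≤ D → D ≤ u - v →
      (LE2 h (P + 1) Q a b ∧ LE2 h (P + 1) (Q + 1) a' b') ∨
      (LE2 h a b (P + 1) Q ∧ LE2 h a' b' (P + 1) Q))) := by
  rcases A with ⟨A1, A2, A3⟩ | ⟨A1, A2⟩ | ⟨A1, A2, A3⟩ | ⟨A1, A2, A3⟩
  · rcases B with ⟨B1, B2⟩ | ⟨B1, B2, B3⟩ | ⟨B1, B0, B00, B2, B3⟩ | ⟨B1, B2, B3⟩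
    · omega
    · omega
    · clear n2 eD
      exact ⟨fun _ _ => Or.inr ⟨Or.inl ⟨by omega, by omega⟩, Or.inr ⟨by omega, by omega, by omega, by omega⟩⟩, fun _ _ => Or.inr ⟨Or.inl ⟨by omega, by omega⟩, Or.inl ⟨by omega, by omega⟩⟩⟩
    · clear n2 eD
      exact ⟨fun _ _ => Or.inl ⟨Or.inl ⟨by omega, by omega⟩, Or.inl ⟨by omega, by omega⟩⟩, fun _ _ => Or.inl ⟨Or.inr ⟨by omega, by omega, by omega, by omega⟩, Or.inl ⟨by omega, by omega⟩⟩⟩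
  · clear n2 eD
    have : Q + 1 < b ∧ b' = b := by omega
    exact ⟨fun _ _ => Or.inl ⟨Or.inl ⟨by omega, by omega⟩, Or.inl ⟨by omega, by omega⟩⟩, fun _ _ => Or.inl ⟨Or.inl ⟨by omega, by omega⟩, Or.inl ⟨by omega, by omega⟩⟩⟩
  · clear n2
    rcases B with ⟨B1, B2⟩ | ⟨B1, B2, B3⟩ | ⟨B1, B0, B00, B2, B3⟩ | ⟨B1, B2, B3⟩
    · exact ⟨fun _ _ => Or.inr ⟨Or.inl ⟨by omega, by omega⟩, Or.inl ⟨by omega, by omega⟩⟩, fun _ _ => Or.inr ⟨Or.inl ⟨by omega, by omega⟩, Or.inl ⟨by omega, by omega⟩⟩⟩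
    · rw [if_neg (by omega)] at eD
      exact ⟨fun _ _ => Or.inr ⟨Or.inl ⟨by omega, by omega⟩, Or.inl ⟨by omega, by omega⟩⟩, fun d1 d2 => by exfalso; omega⟩
    · exact ⟨fun _ _ => Or.inr ⟨Or.inl ⟨by omega, by omega⟩, Or.inl ⟨by omega, by omega⟩⟩, fun _ _ => Or.inr ⟨Or.inl ⟨by omega, by omega⟩, Or.inl ⟨by omega, by omega⟩⟩⟩
    · by_cases hs : 2 * h ≤ a + b
      · split_ifs at eD <;> exact ⟨fun _ _ => Or.inl ⟨Or.inr ⟨by omega, by omega, by omega, by omega⟩, Or.inr ⟨by omega, by omega, by omega, by omega⟩⟩, fun d1 d2 => by exfalso; omega⟩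
      · rw [if_neg (by omega)] at eD
        exact ⟨fun d1 d2 => by exfalso; omega, fun d1 d2 => by exfalso; omega⟩
  · clear n2
    rcases B with ⟨B1, B2⟩ | ⟨B1, B2, B3⟩ | ⟨B1, B0, B00, B2, B3⟩ | ⟨B1, B2, B3⟩
    · omega
    · rw [if_pos (by omega)] at eD
      exact ⟨fun d1 d2 => by exfalso; omega, fun _ _ => Or.inl ⟨Or.inl ⟨by omega, by omega⟩, Or.inl ⟨by omega, by omega⟩⟩⟩
    · split_ifs at eD with hj
      · exact ⟨fun d1 d2 => by exfalso; omega, fun d1 d2 => by exfalso; omega⟩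
      · exact ⟨fun d1 d2 => by exfalso; omega, fun _ _ => Or.inr ⟨Or.inr ⟨by omega, by omega, by omega, by omega⟩, Or.inr ⟨by omega, by omega, by omega, by omega⟩⟩⟩
    · exact ⟨fun _ _ => Or.inl ⟨Or.inl ⟨by omega, by omega⟩, Or.inl ⟨by omega, by omega⟩⟩, fun _ _ => Or.inl ⟨Or.inl ⟨by omega, by omega⟩, Or.inl ⟨by omega, by omega⟩⟩⟩

theorem arithB {h P Q : ℕ} {s : Multiset ℕ} (hc : Core h s) (hPQ : P + Q + 1 = 2 * h)
    (hP : h < 2 * P) (hP2 : P + 1 < h)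
    (s1 : SS h s P) (s2 : SS h s Q) (s3 : ¬ SS h s (P + 1)) (s4 : ¬ SS h s (Q + 1))
    {a b a' b' : ℕ} {D u v : ℤ} (hu : MM h s P = u) (hv : MM h s Q = v)
    {F : ℕ → ℕ} (F1 : F P = P + 1) (F2 : F Q = Q + 1)
    (F3 : ∀ c, SS h s c → c ≠ P → c ≠ Q → F c = c)
    (hT : DTy h s F a b a' b' D)
    (n1 : ¬ (a = P ∧ b = Q)) (n2 : ¬ (a = P + 1 ∧ b = Q)) (n3 : ¬ (a = P ∧ b = Q + 1)) :
    ((u - v - 1 ≤ D → D ≤ u - v + 1 →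
      (LE2 h P (Q + 1) a b ∧ LE2 h P (Q + 1) a' b') ∨
      (LE2 h a b P Q ∧ LE2 h a' b' P (Q + 1))) ∧
    (u - v - 2 ≤ D → D ≤ u - v →
      (LE2 h (P + 1) Q a b ∧ LE2 h (P + 1) (Q + 1) a' b') ∨
      (LE2 h a b (P + 1) Q ∧ LE2 h a' b' (P + 1) Q))) := by
  have hF : ∀ c, SS h s c → c ≠ P + 1 ∧ c ≠ Q + 1 ∧ h < 2 * c ∧
      ((c = P ∧ F c = P + 1) ∨ (c = Q ∧ F c = Q + 1) ∨ (c ≠ P ∧ c ≠ Q ∧ F c = c)) := by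
    intro c hs
    refine ⟨fun h => s3 (h ▸ hs), fun h => s4 (h ▸ hs), hs.1, ?_⟩
    by_cases h1 : c = P
    · left; exact ⟨h1, h1 ▸ F1⟩
    by_cases h2 : c = Q
    · right; left; exact ⟨h2, h2 ▸ F2⟩
    · right; right; exact ⟨h1, h2, F3 c hs h1 h2⟩
  clear F1 F2 F3 s3 s4
  rcases hT with ⟨hab, ha, hb, e1, e2, e3⟩ | ⟨ha, hb, e1, e2, e3⟩ | ⟨hb, hab, h2, e1, e2, e3⟩ |
    ⟨hab, h2, h4, ha, e1, e2, e3⟩ | ⟨hab, h2, h4, hb, e1, e2, e3⟩ | ⟨e1, e2, e3, e4, e5⟩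
  · have A := hF a ha
    have B := hF b hb
    have m1 := MM_cmp' hc ha s1
    have m2 := MM_cmp' hc hb s2
    rw [← e1, hu] at *
    rw [← e2, hv] at *
    clear hF
    generalize MM h s a = x at *
    generalize MM h s b = y at *
    obtain ⟨A1, A2, A3, A4⟩ := A
    obtain ⟨B1, B2, B3, B4⟩ := B
    refine arithB1 hPQ hP hP2 A3 hab n1 e3 ?_ ?_ <;> clear e3 n1 n2 n3
    · clear m2 B4; rcases A4 with A4 | A4 | A4 <;> omega
    · clear m1 A4; rcases B4 with A4 | A4 | A4 <;> omega
  · obtain ⟨A1, A2, A3, A4⟩ := hF a ha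
    rw [← e1] at A4 e2
    have m1 := MM_cmp' hc ha s1
    have m2 := MM_cmp1 hc (c := b) (by omega) s2
    have m3 := (MM_succ hc a A3).1 ha
    rw [hu] at m1
    rw [hv] at m2
    generalize MM h s a = x at *
    generalize MM h s (a + 1) = x' at *
    generalize MM h s b = y at *
    clear n1 n2 n3 hF
    have A4 : (a = P ∧ a' = P + 1) ∨ (a = Q ∧ a' = Q + 1) ∨ (a < P ∧ a' = a) ∨ (P + 1 < a ∧ a' = a) := by omega
    rcases A4 with A4 | A4 | A4 | A4
    · clear m1 m2
      exact ⟨fun _ _ => Or.inl ⟨Or.inl ⟨by omega, by omega⟩, Or.inl ⟨by omega, by omega⟩⟩, fun _ _ => Or.inl ⟨Or.inr ⟨by omega, by omega, by omega, by omega⟩, Or.inl ⟨by omega, by omega⟩⟩⟩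
    · clear m1 m2
      exact ⟨fun _ _ => Or.inl ⟨Or.inl ⟨by omega, by omega⟩, Or.inl ⟨by omega, by omega⟩⟩, fun _ _ => Or.inl ⟨Or.inl ⟨by omega, by omega⟩, Or.inl ⟨by omega, by omega⟩⟩⟩
    · exact ⟨fun _ _ => Or.inl ⟨Or.inr ⟨by omega, by omega, by omega, by omega⟩, Or.inr ⟨by omega, by omega, by omega, by omega⟩⟩, fun d1 d2 => by exfalso; omega⟩
    · clear m1 m2
      exact ⟨fun _ _ => Or.inl ⟨Or.inl ⟨by omega, by omega⟩, Or.inl ⟨by omega, by omega⟩⟩, fun _ _ => Or.inl ⟨Or.inl ⟨by omega, by omega⟩, Or.inl ⟨by omega, by omega⟩⟩⟩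
  · obtain ⟨A1, A2, A3, A4⟩ := hF b hb
    rw [← e1] at A4 e2
    have m1 := MM_cmp1 hc (c := a + 1) (by omega) s1
    have m1' : a + 1 ≤ P → MM h s P ≤ MM h s (a + 1) := m1.1
    have m2 := MM_cmp' hc hb s2
    have aP : a ≠ P := by
      rintro rfl
      have := hb.2.2.2 (by omega)
      rw [hab, Nat.add_sub_cancel] at this
      exact s1.2.1 this
    rw [hu] at m1'
    rw [hv] at m2
    generalize MM h s (a + 1) = x' at *
    generalize MM h s b = y at *
    clear n1 n2 n3 hF m1
    have A5 : b' = b ∧ Q + 1 < b := by omega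
    clear A4
    rcases lt_or_gt_of_ne aP with A4 | A4
    · exact ⟨fun _ _ => Or.inl ⟨Or.inr ⟨by omega, by omega, by omega, by omega⟩, Or.inr ⟨by omega, by omega, by omega, by omega⟩⟩, fun d1 d2 => by exfalso; omega⟩
    · clear m1' m2
      exact ⟨fun _ _ => Or.inl ⟨Or.inl ⟨by omega, by omega⟩, Or.inl ⟨by omega, by omega⟩⟩, fun _ _ => Or.inl ⟨Or.inl ⟨by omega, by omega⟩, Or.inl ⟨by omega, by omega⟩⟩⟩
  · obtain ⟨A1, A2, A3, A4⟩ := hF a ha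
    rw [← e1] at A4
    have m1 := MM_cmp' hc ha s1
    have m2 := MM_cmp1 hc (c := b) (by omega) s2
    have m3 := (MM_succ hc a h4).1 ha
    rw [hu] at m1
    rw [hv] at m2
    generalize MM h s a = x at *
    generalize MM h s (a + 1) = x' at *
    generalize MM h s b = y at *
    clear n1 n2 hF
    have A4 : (a < P ∧ a' = a) ∨ (P + 1 < a ∧ a' = a) := by omega
    clear n3
    rcases A4 with A4 | A4
    · exact ⟨fun _ _ => Or.inl ⟨Or.inr ⟨by omega, by omega, by omega, by omega⟩, Or.inr ⟨by omega, by omega, by omega, by omega⟩⟩, fun d1 d2 => by exfalso; omega⟩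
    · exact ⟨fun d1 d2 => by exfalso; omega, fun _ _ => Or.inr ⟨Or.inr ⟨by omega, by omega, by omega, by omega⟩, Or.inr ⟨by omega, by omega, by omega, by omega⟩⟩⟩
  · obtain ⟨A1, A2, A3, A4⟩ := hF b hb
    rw [← e1] at A4
    have m1 := MM_cmp1 hc (c := a + 1) (by omega) s1
    have m2 := MM_cmp' hc hb s2
    rw [hu] at m1
    rw [hv] at m2
    generalize MM h s (a + 1) = x' at *
    generalize MM h s b = y at *
    clear n1 n3 hF
    have A4 : (b < Q ∧ b' = b) ∨ (Q + 1 < b ∧ b' = b) := by omega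
    clear n2
    rcases A4 with A4 | A4
    · exact ⟨fun d1 d2 => by exfalso; omega, fun _ _ => Or.inr ⟨Or.inr ⟨by omega, by omega, by omega, by omega⟩, Or.inr ⟨by omega, by omega, by omega, by omega⟩⟩⟩
    · exact ⟨fun _ _ => Or.inl ⟨Or.inr ⟨by omega, by omega, by omega, by omega⟩, Or.inr ⟨by omega, by omega, by omega, by omega⟩⟩, fun d1 d2 => by exfalso; omega⟩
  · have hS := SS_h hc (by omega)
    have m1 := MM_cmp' hc hS s1
    have m2 := MM_cmp' hc hS s2
    have A := (hF h hS).1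
    rw [hu] at m1
    rw [hv] at m2
    generalize MM h s h = w at *
    clear n1 n2 n3 hF
    exact ⟨fun d1 d2 => by exfalso; omega, fun _ _ => Or.inr ⟨Or.inr ⟨by omega, by omega, by omega, by omega⟩, Or.inr ⟨by omega, by omega, by omega, by omega⟩⟩⟩
end BPartition
end S6

section S7
namespace BPartition

theorem chain {h : ℕ} {s : Multiset ℕ} (o : ℕ → ℕ × ℕ)
    (mono : ∀ j k, j ≤ k → k < 3 → ∀ t, gg h (o j).1 t + gg h (o j).2 t ≤
      gg h (o k).1 t + gg h (o k).2 t)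
    {α β γ : BPartition} (ho1 : domLT α β) (ho2 : domLT β γ) {j k m : ℕ} (hj : j < 3) (hk : k < 3)
    (hm : m < 3) (e1 : EqB h s (partsM α) (o j).1 (o j).2)
    (e2 : EqB h s (partsM β) (o k).1 (o k).2)
    (e3 : EqB h s (partsM γ) (o m).1 (o m).2) : j = 0 ∧ k = 1 ∧ m = 2 := by
  have key : ∀ (α β : BPartition) (j k : ℕ), j < 3 → domLT α β →
      EqB h s (partsM α) (o j).1 (o j).2 → EqB h s (partsM β) (o k).1 (o k).2 → j < k := by
    intro α β j k hj ho e1 e2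
    by_contra hlt
    refine ho.2 (domLE_antisymm ho.1 ((domLE_iff β α).2 fun t => ?_))
    have := mono k j (by omega) hj t
    rw [FF_EqB e1, FF_EqB e2]; omega
  have := key _ _ _ _ hj ho1 e1 e2
  have := key _ _ _ _ hk ho2 e2 e3
  omega

theorem colour_grey {h : ℕ} {σ l : BPartition} {a b : ℕ} (hb : h < b) (hd : 1 ≤ ddd h σ l a b) :
    colour h σ l a b = Colour.grey := by
  unfold colour
  split_ifs <;> first | rfl | omega

theorem LE2_mono {h : ℕ} (o : ℕ → ℕ × ℕ)
    (pos : ∀ j < 3, h < 2 * (o j).1 ∧ h < 2 * (o j).2)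
    (le01 : LE2 h (o 0).1 (o 0).2 (o 1).1 (o 1).2)
    (le12 : LE2 h (o 1).1 (o 1).2 (o 2).1 (o 2).2) :
    ∀ j k, j ≤ k → k < 3 → ∀ t, gg h (o j).1 t + gg h (o j).2 t ≤
      gg h (o k).1 t + gg h (o k).2 t := by
  intro j k hjk hk t
  have p0 := pos 0 (by omega)
  have p1 := pos 1 (by omega)
  have p2 := pos 2 (by omega)
  have g1 := LE2_gg p0.1 p0.2 p1.1 le01 t
  have g2 := LE2_gg p1.1 p1.2 p2.1 le12 t
  have hj : j < 3 := by omega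
  interval_cases k <;> interval_cases j <;> omega

theorem glue {n h i : ℕ} (hh : h = 2 * n + 1) {σ τ : BPartition} (hσ : IsBarCore h σ)
    (o o' : ℕ → ℕ × ℕ)
    (pos : ∀ j < 3, h < 2 * (o j).1 ∧ h < (o j).2)
    (pos' : ∀ j < 3, h < 2 * (o' j).1 ∧ h < (o' j).2)
    (le01 : LE2 h (o 0).1 (o 0).2 (o 1).1 (o 1).2)
    (le12 : LE2 h (o 1).1 (o 1).2 (o 2).1 (o 2).2)
    (le01' : LE2 h (o' 0).1 (o' 0).2 (o' 1).1 (o' 1).2)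
    (le12' : LE2 h (o' 1).1 (o' 1).2 (o' 2).1 (o' 2).2)
    (hS : ∀ l a b, InBlock h σ 2 l → (∃ x, Removable h i l x) → BarPositions h σ l a b →
      ∃ j < 3, a = (o j).1 ∧ b = (o j).2)
    (hS' : IsBarCore h τ → ∀ l a b, InBlock h τ 2 l → (∃ x, Addable h i l x) →
      BarPositions h τ l a b → ∃ j < 3, a = (o' j).1 ∧ b = (o' j).2)
    (hψ : ∀ l, InBlock h σ 2 l → (∀ x, ¬ Removable h i l x) → ∀ x, ¬ Addable h i (psi h i l) x)
    (d : ℤ) (hd : 1 ≤ d)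
    (dσ : ∀ l j, j < 3 → EqB h (partsM σ) (partsM l) (o j).1 (o j).2 →
      (ddd h σ l (o j).1 (o j).2 : ℤ) = if j = 1 then d - 1 else d)
    (dτ : IsBarCore h τ → ∀ l j, j < 3 → EqB h (partsM τ) (partsM l) (o' j).1 (o' j).2 →
      (ddd h τ l (o' j).1 (o' j).2 : ℤ) = if j = 1 then d else d - 1)
    (hcol : d = 1 → IsBarCore h τ → ∃ c₂ : Colour,
      (∀ l, EqB h (partsM σ) (partsM l) (o 1).1 (o 1).2 → colour h σ l (o 1).1 (o 1).2 = c₂) ∧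
      (∀ l, EqB h (partsM τ) (partsM l) (o' 0).1 (o' 0).2 → colour h τ l (o' 0).1 (o' 0).2 = c₂) ∧
      (∀ l, EqB h (partsM τ) (partsM l) (o' 2).1 (o' 2).2 → colour h τ l (o' 2).1 (o' 2).2 = c₂))
    (trans : ∀ l a b, InBlock h σ 2 l → (∀ x, ¬ Removable h i l x) → BarPositions h σ l a b →
      (∀ j < 3, ¬ (a = (o j).1 ∧ b = (o j).2)) →
      ∃ a' b', EqB h (partsM τ) (partsM (psi h i l)) a' b' ∧ h < 2 * a ∧ h < 2 * b ∧ h < 2 * a' ∧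
        h < 2 * b' ∧
      (d - 1 ≤ ddd h σ l a b → ddd h σ l a b ≤ d + 1 →
        (LE2 h (o 2).1 (o 2).2 a b ∧ LE2 h (o' 1).1 (o' 1).2 a' b') ∨
        (LE2 h a b (o 0).1 (o 0).2 ∧ LE2 h a' b' (o' 1).1 (o' 1).2)) ∧
      (d - 2 ≤ ddd h σ l a b → ddd h σ l a b ≤ d →
        (LE2 h (o 1).1 (o 1).2 a b ∧ LE2 h (o' 2).1 (o' 2).2 a' b') ∨
        (LE2 h a b (o 1).1 (o 1).2 ∧ LE2 h a' b' (o' 0).1 (o' 0).2)))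
    (α β γ α' β' γ' : BPartition)
    (hexc : {lam | InBlock h σ 2 lam ∧ ∃ x, Removable h i lam x} = {α, β, γ})
    (ho1 : domLT α β) (ho2 : domLT β γ)
    (hexc' : {mu | InBlock h τ 2 mu ∧ ∃ x, Addable h i mu x} = {α', β', γ'})
    (ho1' : domLT α' β') (ho2' : domLT β' γ') :
    ∃ d : ℕ, 1 ≤ d ∧ ∃ c₁ c₂ : Colour,
      (∀ a b, BarPositions h σ α a b → ddd h σ α a b = d ∧ colour h σ α a b = c₁) ∧
      (∀ a b, BarPositions h σ γ a b → ddd h σ γ a b = d ∧ colour h σ γ a b = c₁) ∧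
      (∀ a b, BarPositions h τ β' a b → ddd h τ β' a b = d ∧ colour h τ β' a b = c₁) ∧
      (∀ a b, BarPositions h τ α' a b →
        ddd h τ α' a b = d - 1 ∧ colour h τ α' a b = c₂) ∧
      (∀ a b, BarPositions h σ β a b →
        ddd h σ β a b = d - 1 ∧ colour h σ β a b = c₂) ∧
      (∀ a b, BarPositions h τ γ' a b →
        ddd h τ γ' a b = d - 1 ∧ colour h τ γ' a b = c₂) ∧
      (∀ lam, InBlock h σ 2 lam → (∀ x, ¬ Removable h i lam x) →
        (∀ a b, BarPositions h σ lam a b → ((ddd h σ lam a b : ℤ) - (d : ℤ)).natAbs ≤ 1) →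
        ((domLT γ lam ∧ domLT β' (psi h i lam)) ∨
          (domLT lam α ∧ domLT (psi h i lam) β'))) ∧
      (∀ lam, InBlock h σ 2 lam → (∀ x, ¬ Removable h i lam x) →
        (∀ a b, BarPositions h σ lam a b →
          ((ddd h σ lam a b : ℤ) - ((d : ℤ) - 1)).natAbs ≤ 1) →
        ((domLT β lam ∧ domLT γ' (psi h i lam)) ∨
          (domLT lam β ∧ domLT (psi h i lam) α'))) := by
  have mα : InBlock h σ 2 α ∧ ∃ x, Removable h i α x := by
    have : α ∈ ({α, β, γ} : Set BPartition) := by simp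
    rw [← hexc] at this; exact this
  have mβ : InBlock h σ 2 β ∧ ∃ x, Removable h i β x := by
    have : β ∈ ({α, β, γ} : Set BPartition) := by simp
    rw [← hexc] at this; exact this
  have mγ : InBlock h σ 2 γ ∧ ∃ x, Removable h i γ x := by
    have : γ ∈ ({α, β, γ} : Set BPartition) := by simp
    rw [← hexc] at this; exact this
  have mα' : InBlock h τ 2 α' ∧ ∃ x, Addable h i α' x := by
    have : α' ∈ ({α', β', γ'} : Set BPartition) := by simp
    rw [← hexc'] at this; exact this
  have mβ' : InBlock h τ 2 β' ∧ ∃ x, Addable h i β' x := by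
    have : β' ∈ ({α', β', γ'} : Set BPartition) := by simp
    rw [← hexc'] at this; exact this
  have mγ' : InBlock h τ 2 γ' ∧ ∃ x, Addable h i γ' x := by
    have : γ' ∈ ({α', β', γ'} : Set BPartition) := by simp
    rw [← hexc'] at this; exact this
  have hτ : IsBarCore h τ := mα'.1.2.1
  have hc := core_of hh hσ
  have hc' := core_of hh hτ
  have mono := LE2_mono o (fun j hj => ⟨(pos j hj).1, by have := (pos j hj).2; omega⟩) le01 le12
  have mono' := LE2_mono o' (fun j hj => ⟨(pos' j hj).1, by have := (pos' j hj).2; omega⟩) le01' le12'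
  have id1 : ∀ l a b, InBlock h σ 2 l → (∃ x, Removable h i l x) → BarPositions h σ l a b →
      ∃ j < 3, a = (o j).1 ∧ b = (o j).2 ∧ EqB h (partsM σ) (partsM l) (o j).1 (o j).2 := by
    intro l a b h1 h2 h3
    obtain ⟨j, hj, rfl, rfl⟩ := hS l a b h1 h2 h3
    exact ⟨j, hj, rfl, rfl, (bp_ty hh hc h1.1 h3).2⟩
  have id1' : ∀ l a b, InBlock h τ 2 l → (∃ x, Addable h i l x) → BarPositions h τ l a b →
      ∃ j < 3, a = (o' j).1 ∧ b = (o' j).2 ∧ EqB h (partsM τ) (partsM l) (o' j).1 (o' j).2 := by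
    intro l a b h1 h2 h3
    obtain ⟨j, hj, rfl, rfl⟩ := hS' hτ l a b h1 h2 h3
    exact ⟨j, hj, rfl, rfl, (bp_ty hh hc' h1.1 h3).2⟩
  obtain ⟨aα, bα, pα⟩ := bp_exists mα.1
  obtain ⟨aβ, bβ, pβ⟩ := bp_exists mβ.1
  obtain ⟨aγ, bγ, pγ⟩ := bp_exists mγ.1
  obtain ⟨aα', bα', pα'⟩ := bp_exists mα'.1
  obtain ⟨aβ', bβ', pβ'⟩ := bp_exists mβ'.1
  obtain ⟨aγ', bγ', pγ'⟩ := bp_exists mγ'.1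
  obtain ⟨j1, hj1, -, -, e1⟩ := id1 α _ _ mα.1 mα.2 pα
  obtain ⟨j2, hj2, -, -, e2⟩ := id1 β _ _ mβ.1 mβ.2 pβ
  obtain ⟨j3, hj3, -, -, e3⟩ := id1 γ _ _ mγ.1 mγ.2 pγ
  obtain ⟨k1, hk1, -, -, f1⟩ := id1' α' _ _ mα'.1 mα'.2 pα'
  obtain ⟨k2, hk2, -, -, f2⟩ := id1' β' _ _ mβ'.1 mβ'.2 pβ'
  obtain ⟨k3, hk3, -, -, f3⟩ := id1' γ' _ _ mγ'.1 mγ'.2 pγ'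
  have q1 : ∀ a b, BarPositions h σ α a b → a = (o 0).1 ∧ b = (o 0).2 := by
    intro a b hb
    obtain ⟨j, hj, ea, eb, e⟩ := id1 α _ _ mα.1 mα.2 hb
    obtain ⟨rfl, -, -⟩ := chain o mono ho1 ho2 hj hj2 hj3 e e2 e3
    exact ⟨ea, eb⟩
  have q2 : ∀ a b, BarPositions h σ β a b → a = (o 1).1 ∧ b = (o 1).2 := by
    intro a b hb
    obtain ⟨j, hj, ea, eb, e⟩ := id1 β _ _ mβ.1 mβ.2 hb
    obtain ⟨-, rfl, -⟩ := chain o mono ho1 ho2 hj1 hj hj3 e1 e e3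
    exact ⟨ea, eb⟩
  have q3 : ∀ a b, BarPositions h σ γ a b → a = (o 2).1 ∧ b = (o 2).2 := by
    intro a b hb
    obtain ⟨j, hj, ea, eb, e⟩ := id1 γ _ _ mγ.1 mγ.2 hb
    obtain ⟨-, -, rfl⟩ := chain o mono ho1 ho2 hj1 hj2 hj e1 e2 e
    exact ⟨ea, eb⟩
  have q1' : ∀ a b, BarPositions h τ α' a b → a = (o' 0).1 ∧ b = (o' 0).2 := by
    intro a b hb
    obtain ⟨j, hj, ea, eb, e⟩ := id1' α' _ _ mα'.1 mα'.2 hb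
    obtain ⟨rfl, -, -⟩ := chain o' mono' ho1' ho2' hj hk2 hk3 e f2 f3
    exact ⟨ea, eb⟩
  have q2' : ∀ a b, BarPositions h τ β' a b → a = (o' 1).1 ∧ b = (o' 1).2 := by
    intro a b hb
    obtain ⟨j, hj, ea, eb, e⟩ := id1' β' _ _ mβ'.1 mβ'.2 hb
    obtain ⟨-, rfl, -⟩ := chain o' mono' ho1' ho2' hk1 hj hk3 f1 e f3
    exact ⟨ea, eb⟩
  have q3' : ∀ a b, BarPositions h τ γ' a b → a = (o' 2).1 ∧ b = (o' 2).2 := by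
    intro a b hb
    obtain ⟨j, hj, ea, eb, e⟩ := id1' γ' _ _ mγ'.1 mγ'.2 hb
    obtain ⟨-, -, rfl⟩ := chain o' mono' ho1' ho2' hk1 hk2 hj f1 f2 e
    exact ⟨ea, eb⟩
  obtain ⟨rfl, rfl, rfl⟩ := chain o mono ho1 ho2 hj1 hj2 hj3 e1 e2 e3
  obtain ⟨rfl, rfl, rfl⟩ := chain o' mono' ho1' ho2' hk1 hk2 hk3 f1 f2 f3
  have d1 := dσ α 0 hj1 e1
  have d2 := dσ β 1 hj2 e2
  have d3 := dσ γ 2 hj3 e3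
  have d1' := dτ hτ α' 0 hk1 f1
  have d2' := dτ hτ β' 1 hk2 f2
  have d3' := dτ hτ γ' 2 hk3 f3
  simp only [if_true, OfNat.ofNat_ne_one, zero_ne_one, if_false] at d1 d2 d3 d1' d2' d3'
  have c2 : ∃ c₂, colour h σ β (o 1).1 (o 1).2 = c₂ ∧ colour h τ α' (o' 0).1 (o' 0).2 = c₂ ∧
      colour h τ γ' (o' 2).1 (o' 2).2 = c₂ := by
    by_cases h1 : d = 1
    · obtain ⟨c, g1, g2, g3⟩ := hcol h1 hτ
      exact ⟨c, g1 β e2, g2 α' f1, g3 γ' f3⟩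
    · exact ⟨Colour.grey, colour_grey (pos 1 hj2).2 (by omega),
        colour_grey (pos' 0 hk1).2 (by omega), colour_grey (pos' 2 hk3).2 (by omega)⟩
  obtain ⟨c₂, g1, g2, g3⟩ := c2
  -- no common bars
  have hno : ∀ l a b, InBlock h σ 2 l → (∀ x, ¬ Removable h i l x) → BarPositions h σ l a b →
      (∀ j < 3, ¬ (a = (o j).1 ∧ b = (o j).2)) := by
    intro l a b h1 h2 h3 j hj ⟨ea, eb⟩
    have e := (bp_ty hh hc h1.1 h3).2
    have same : ∀ m : BPartition, EqB h (partsM σ) (partsM m) a b → l = m := by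
      intro m em
      refine domLE_antisymm ((domLE_iff _ _).2 fun t => ?_) ((domLE_iff _ _).2 fun t => ?_) <;>
        rw [FF_EqB e, FF_EqB em]
    subst ea eb
    have : j = 0 ∨ j = 1 ∨ j = 2 := by omega
    rcases this with rfl | rfl | rfl
    · obtain ⟨x, hx⟩ := mα.2
      rw [← same α e1] at hx; exact h2 x hx
    · obtain ⟨x, hx⟩ := mβ.2
      rw [← same β e2] at hx; exact h2 x hx
    · obtain ⟨x, hx⟩ := mγ.2
      rw [← same γ e3] at hx; exact h2 x hx
  have lt1 : ∀ (s : Multiset ℕ) (l m : BPartition) (a b x y : ℕ), h < 2 * a → h < 2 * b →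
      h < 2 * x → EqB h s (partsM l) a b → EqB h s (partsM m) x y → LE2 h a b x y →
      l ≠ m → domLT l m := by
    intro s l m a b x y ha hb hx e f hle hne
    refine ⟨(domLE_iff _ _).2 fun t => ?_, hne⟩
    have := LE2_gg ha hb hx hle t
    rw [FF_EqB e, FF_EqB f]; omega
  have p0 := pos 0 hj1
  have p1 := pos 1 hj2
  have p2 := pos 2 hj3
  have p0' := pos' 0 hj1
  have p1' := pos' 1 hj2
  have p2' := pos' 2 hj3
  refine ⟨d.toNat, by omega, Colour.grey, c₂, ?_, ?_, ?_, ?_, ?_, ?_, ?_, ?_⟩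
  · intro a b hb
    obtain ⟨rfl, rfl⟩ := q1 a b hb
    exact ⟨by omega, colour_grey p0.2 (by omega)⟩
  · intro a b hb
    obtain ⟨rfl, rfl⟩ := q3 a b hb
    exact ⟨by omega, colour_grey p2.2 (by omega)⟩
  · intro a b hb
    obtain ⟨rfl, rfl⟩ := q2' a b hb
    exact ⟨by omega, colour_grey p1'.2 (by omega)⟩
  · intro a b hb
    obtain ⟨rfl, rfl⟩ := q1' a b hb
    exact ⟨by omega, g2⟩
  · intro a b hb
    obtain ⟨rfl, rfl⟩ := q2 a b hb
    exact ⟨by omega, g1⟩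
  · intro a b hb
    obtain ⟨rfl, rfl⟩ := q3' a b hb
    exact ⟨by omega, g3⟩
  · intro l h1 h2 h3
    obtain ⟨a, b, hab⟩ := bp_exists h1
    have e := (bp_ty hh hc h1.1 hab).2
    obtain ⟨a', b', e', pa, pb, pa', pb', H, -⟩ := trans l a b h1 h2 hab (hno l a b h1 h2 hab)
    have h4 := h3 a b hab
    have na : ∀ m, (∃ x, Removable h i m x) → l ≠ m := by
      rintro m ⟨x, hx⟩ rfl; exact h2 x hx
    have na' : ∀ m, (∃ x, Addable h i m x) → psi h i l ≠ m := by
      rintro m ⟨x, hx⟩ rfl; exact hψ l h1 h2 x hx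
    rcases H (by omega) (by omega) with ⟨u, v⟩ | ⟨u, v⟩
    · exact Or.inl ⟨lt1 _ _ _ _ _ _ _ p2.1 (by omega) pa e3 e u (na _ mγ.2).symm,
        lt1 _ _ _ _ _ _ _ p1'.1 (by omega) pa' f2 e' v (na' _ mβ'.2).symm⟩
    · exact Or.inr ⟨lt1 _ _ _ _ _ _ _ pa pb p0.1 e e1 u (na _ mα.2),
        lt1 _ _ _ _ _ _ _ pa' pb' p1'.1 e' f2 v (na' _ mβ'.2)⟩
  · intro l h1 h2 h3
    obtain ⟨a, b, hab⟩ := bp_exists h1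
    have e := (bp_ty hh hc h1.1 hab).2
    obtain ⟨a', b', e', pa, pb, pa', pb', -, H⟩ := trans l a b h1 h2 hab (hno l a b h1 h2 hab)
    have h4 := h3 a b hab
    have na : ∀ m, (∃ x, Removable h i m x) → l ≠ m := by
      rintro m ⟨x, hx⟩ rfl; exact h2 x hx
    have na' : ∀ m, (∃ x, Addable h i m x) → psi h i l ≠ m := by
      rintro m ⟨x, hx⟩ rfl; exact hψ l h1 h2 x hx
    rcases H (by omega) (by omega) with ⟨u, v⟩ | ⟨u, v⟩
    · exact Or.inl ⟨lt1 _ _ _ _ _ _ _ p1.1 (by omega) pa e2 e u (na _ mβ.2).symm,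
        lt1 _ _ _ _ _ _ _ p2'.1 (by omega) pa' f3 e' v (na' _ mγ'.2).symm⟩
    · exact Or.inr ⟨lt1 _ _ _ _ _ _ _ pa pb p1.1 e e2 u (na _ mβ.2),
        lt1 _ _ _ _ _ _ _ pa' pb' p0'.1 e' f1 v (na' _ mα'.2)⟩

end BPartition
end S7

section S8
namespace BPartition

theorem Core.down {h : ℕ} {s : Multiset ℕ} (hc : Core h s) {x y : ℕ} (hx : x ∈ s)
    (hm : y % h = x % h) (hy : y ≤ x) : y ∈ s := by
  obtain ⟨k, hk⟩ : ∃ k, x = y + h * k := by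
    have := (Nat.modEq_iff_dvd' hy).1 hm
    obtain ⟨k, hk⟩ := this
    exact ⟨k, by omega⟩
  induction k generalizing x with
  | zero => rw [Nat.mul_zero] at hk; rwa [hk] at hx
  | succ k ih =>
    rw [Nat.mul_succ] at hk
    have hy0 : y ≠ 0 := by
      rintro rfl
      refine hc.dv x ?_ hx
      rw [Nat.zero_mod] at hm
      exact Nat.dvd_of_mod_eq_zero hm.symm
    have h1 := hc.dn x hx (by
      have : h ≤ h * k + h := by omega
      omega)
    refine ih h1 ?_ (by omega) (by omega)
    rw [hk, show y + (h * k + h) - h = y + h * k by omega, Nat.add_mul_mod_self_left]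

theorem Core.opp {h : ℕ} {s : Multiset ℕ} (hc : Core h s) {x y : ℕ} (hx : x ∈ s) (hy : y ∈ s)
    (hm : x % h + y % h = h) : False := by
  have h0 : 0 < h := by
    rcases Nat.eq_zero_or_pos h with rfl | h0
    · exact absurd (hc.pos x hx) (by simp at hm; omega)
    · exact h0
  have h1 := hc.down hx (Nat.mod_mod x h) (Nat.mod_le x h)
  have h2 := hc.down hy (Nat.mod_mod y h) (Nat.mod_le y h)
  have := hc.op _ h1 (Nat.mod_lt x h0)
  rw [show h - x % h = y % h by omega] at this
  exact this h2

theorem add_mod_h (h x : ℕ) : (x + h) % h = x % h := Nat.add_mod_right x h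

theorem sub_mod_h {h x : ℕ} (hx : h ≤ x) : (x - h) % h = x % h := (Nat.mod_eq_sub_mod hx).symm

theorem compl_mod {h x : ℕ} (h0 : 0 < x) (hx : x < h) : (h - x) % h + x % h = h := by
  rw [Nat.mod_eq_of_lt hx, Nat.mod_eq_of_lt (by omega)]; omega

theorem QQ_add {h i x : ℕ} : QQ h i (x + h) ↔ QQ h i x := by unfold QQ; rw [add_mod_h]

theorem QQ_sub {h i x : ℕ} (hx : h ≤ x) : QQ h i (x - h) ↔ QQ h i x := by
  unfold QQ; rw [sub_mod_h hx]

theorem QQ_compl {h i x : ℕ} (hx : x < h) : QQ h i (h - 1 - x) ↔ QQ h i x := by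
  unfold QQ; rw [Nat.mod_eq_of_lt hx, Nat.mod_eq_of_lt (by omega)]; omega

/-- sw, case description -/
theorem sw_cases {h i : ℕ} (hi : 1 ≤ i) (hi2 : 2 * i + 2 < h) (c : ℕ) :
    (QQ h i c ∧ sw h i c = c + 1) ∨ (∃ e, c = e + 1 ∧ QQ h i e ∧ sw h i c = e) ∨
    (¬ QQ h i c ∧ (∀ e, c = e + 1 → ¬ QQ h i e) ∧ sw h i c = c) := by
  by_cases h1 : QQ h i c
  · exact Or.inl ⟨h1, sw_of_Q h1⟩
  · right
    by_cases h2 : ∃ e, c = e + 1 ∧ QQ h i e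
    · obtain ⟨e, rfl, he⟩ := h2
      exact Or.inl ⟨e, rfl, he, sw_of_Q' hi hi2 he⟩
    · right
      push Not at h2
      refine ⟨h1, h2, ?_⟩
      unfold sw
      rw [if_neg h1]
      rcases c with _ | e
      · simp
      · simp [h2 e rfl]

theorem sw_fix {h i : ℕ} {c : ℕ} (h1 : ¬ QQ h i c) (h2 : ∀ e, c = e + 1 → ¬ QQ h i e) :
    sw h i c = c := by
  unfold sw
  rw [if_neg h1]
  rcases c with _ | e
  · simp
  · simp [h2 e rfl]

theorem sw_add {h i : ℕ} (hi : 1 ≤ i) (hi2 : 2 * i + 2 < h) (c : ℕ) :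
    sw h i (c + h) = sw h i c + h := by
  rcases sw_cases hi hi2 c with ⟨h1, h2⟩ | ⟨e, rfl, h1, h2⟩ | ⟨h1, h2, h3⟩
  · rw [h2, sw_of_Q (QQ_add.2 h1)]; omega
  · rw [h2, show e + 1 + h = (e + h) + 1 by omega, sw_of_Q' hi hi2 (QQ_add.2 h1)]
  · rw [h3]
    refine sw_fix (fun h => h1 (QQ_add.1 h)) ?_
    intro e he hq
    rcases lt_or_ge e h with hlt | hge
    · have : c = 0 := by omega
      subst this
      exact QQ_ndvd' hi hi2 hq ⟨1, by omega⟩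
    · exact h2 (e - h) (by omega) ((QQ_sub hge).2 hq)

theorem sw_compl {h i : ℕ} (hi : 1 ≤ i) (hi2 : 2 * i + 2 < h) {c : ℕ} (h0 : 0 < c) (hc : c < h) :
    sw h i (h - c) + sw h i c = h := by
  rcases sw_cases hi hi2 c with ⟨h1, h2⟩ | ⟨e, rfl, h1, h2⟩ | ⟨h1, h2, h3⟩
  · have h4 := (QQ_compl hc).2 h1
    have h5 : c + 1 ≠ h := fun h5 => QQ_ndvd' hi hi2 h1 (by rw [h5])
    rw [h2, show h - c = (h - 1 - c) + 1 by omega, sw_of_Q' hi hi2 h4]; omega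
  · have h4 := (QQ_compl (show e < h by omega)).2 h1
    rw [h2, show h - (e + 1) = h - 1 - e by omega, sw_of_Q h4]; omega
  · rw [h3, sw_fix]
    · omega
    · intro hq
      exact h2 (c - 1) (by omega) ((QQ_compl (by omega)).1 (by
        rwa [show h - 1 - (c - 1) = h - c by omega]))
    · intro e he hq
      refine h1 ((QQ_compl (by omega)).1 (by rwa [show h - 1 - c = e by omega]))

theorem sw_h {h i : ℕ} (hi : 1 ≤ i) (hi2 : 2 * i + 2 < h) : sw h i h = h := by
  refine sw_fix (fun hq => QQ_ndvd hi hi2 hq dvd_rfl) ?_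
  intro e he hq
  exact QQ_ndvd' hi hi2 hq ⟨1, by omega⟩

theorem sw_lt {h i : ℕ} (hi : 1 ≤ i) (hi2 : 2 * i + 2 < h) {c : ℕ} (hc : c < h) :
    sw h i c < h := by
  rcases sw_cases hi hi2 c with ⟨h1, h2⟩ | ⟨e, rfl, h1, h2⟩ | ⟨h1, h2, h3⟩
  · have h5 : c + 1 ≠ h := fun h5 => QQ_ndvd' hi hi2 h1 (by rw [h5])
    omega
  · omega
  · omega

theorem sw_pos {h i : ℕ} (hi : 1 ≤ i) (hi2 : 2 * i + 2 < h) {c : ℕ} (hc : 0 < c) :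
    0 < sw h i c := by
  rcases sw_cases hi hi2 c with ⟨h1, h2⟩ | ⟨e, rfl, h1, h2⟩ | ⟨h1, h2, h3⟩
  · omega
  · have := QQ_pos hi hi2 h1; omega
  · omega

theorem QQ_half {h i n x : ℕ} (hh : h = 2 * n + 1) (hi : i < n) (hq : QQ h i x) : x ≠ n := by
  rintro rfl
  unfold QQ at hq
  rw [Nat.mod_eq_of_lt (by omega)] at hq
  omega

theorem sw_half {h i n : ℕ} (hh : h = 2 * n + 1) (hi : 1 ≤ i) (hin : i < n) {c : ℕ}
    (hc : h < 2 * c) : h < 2 * sw h i c := by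
  rcases sw_cases hi (show 2 * i + 2 < h by omega) c with ⟨h1, h2⟩ | ⟨e, rfl, h1, h2⟩ | ⟨h1, h2, h3⟩
  · omega
  · have := QQ_half hh hin h1; omega
  · omega

theorem mem_sw {h i : ℕ} (hi : 1 ≤ i) (hi2 : 2 * i + 2 < h) (m : Multiset ℕ) (y : ℕ) :
    y ∈ m.map (sw h i) ↔ sw h i y ∈ m := by
  rw [← Multiset.count_pos, count_sw hi hi2, Multiset.count_pos]

theorem sw_gt {h i : ℕ} (hi : 1 ≤ i) (hi2 : 2 * i + 2 < h) {c : ℕ} (hc : h < c) :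
    h < sw h i c ∧ sw h i (c - h) = sw h i c - h := by
  have h1 := sw_add hi hi2 (c - h)
  rw [show c - h + h = c by omega] at h1
  have := sw_pos hi hi2 (show 0 < c - h by omega)
  omega

theorem EqB_sw {h i : ℕ} (hi : 1 ≤ i) (hi2 : 2 * i + 2 < h) {s l : Multiset ℕ} {a b : ℕ}
    (ha : 0 < a) (hb : 0 < b)
    (H : EqB h s l a b) : EqB h (s.map (sw h i)) (l.map (sw h i)) (sw h i a) (sw h i b) := by
  have hlo : ∀ c, (lo h c).map (sw h i) = lo h (sw h i c) := by
    intro c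
    unfold lo
    rcases lt_trichotomy c h with h1 | h1 | h1
    · have := sw_lt hi hi2 h1
      rw [if_neg (by omega), if_neg (by omega)]; rfl
    · subst h1; rw [sw_h hi hi2]; simp
    · have := sw_gt hi hi2 h1
      rw [if_pos h1, if_pos this.1, Multiset.map_singleton, this.2]
  have hhi : ∀ c, 0 < c → (hib h c).map (sw h i) = hib h (sw h i c) := by
    intro c h0
    unfold hib
    rcases lt_trichotomy c h with h1 | h1 | h1
    · have := sw_lt hi hi2 h1
      have h2 := sw_compl hi hi2 h0 h1
      rw [if_neg (by omega), if_neg (by omega)]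
      simp only [Multiset.insert_eq_cons, Multiset.map_cons, Multiset.map_singleton]
      rw [show sw h i (h - c) = h - sw h i c by omega]
    · subst h1; rw [sw_h hi hi2]; simp [sw_h hi hi2]
    · have := sw_gt hi hi2 h1
      rw [if_pos (by omega), if_pos (by omega), Multiset.map_singleton]
  have := congrArg (Multiset.map (sw h i)) H
  simp only [Multiset.map_add, hlo, hhi a ha, hhi b hb] at this
  exact this

theorem SS_sw {h i n : ℕ} (hh : h = 2 * n + 1) (hi : 1 ≤ i) (hin : i < n) {s : Multiset ℕ} {c : ℕ}
    (H : SS h (s.map (sw h i)) c) : SS h s (sw h i c) := by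
  have hi2 : 2 * i + 2 < h := by omega
  obtain ⟨h1, h2, h3, h4⟩ := H
  simp only [mem_sw hi hi2] at h2 h3 h4
  refine ⟨sw_half hh hi hin h1, h2, ?_, ?_⟩
  · intro h5
    have : c < h := by
      rcases lt_trichotomy c h with h6 | h6 | h6
      · exact h6
      · subst h6; rw [sw_h hi hi2] at h5; omega
      · have := sw_gt hi hi2 h6; omega
    have h6 := sw_compl hi hi2 (by omega) this
    rw [show h - sw h i c = sw h i (h - c) by omega]
    exact h3 this
  · intro h5
    have : h < c := by
      rcases lt_trichotomy c h with h6 | h6 | h6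
      · have := sw_lt hi hi2 h6; omega
      · subst h6; rw [sw_h hi hi2] at h5; omega
      · exact h6
    rw [← (sw_gt hi hi2 this).2]
    exact h4 this

structure Pk (n h i : ℕ) (s : Multiset ℕ) (p : ℕ) : Prop where
  hh : h = 2 * n + 1
  hi : 1 ≤ i
  hin : i < n
  core : Core h s
  q : QQ h i p
  pin : p ∈ s
  pout : p + 1 ∉ s
  uniq : ∀ x, QQ h i x → x ∈ s → x ≠ p → x + 1 ∈ s
  norem : ∀ x, QQ h i x → x + 1 ∈ s → x ∈ s

theorem QQ_mod {h i x : ℕ} (hi : 1 ≤ i) (hi2 : 2 * i + 2 < h) (hx : QQ h i x) :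
    (x + 1) % h = x % h + 1 := by
  unfold QQ at hx
  rcases succ_mod h x (by omega) with h1 | h1 <;> omega

/-- the unique addable -/
theorem pk_of {h i n : ℕ} (hh : h = 2 * n + 1) (hi : 1 ≤ i) (hin : i < n) {σ : BPartition}
    (hσ : IsBarCore h σ) (hcnt : Set.ncard {x : ℕ × ℕ | Addable h i σ x} = 1) :
    ∃ p, Pk n h i (partsM σ) p := by
  have hi2 : 2 * i + 2 < h := by omega
  have hc := core_of hh hσ
  obtain ⟨z, hz⟩ := Set.ncard_eq_one.1 hcnt
  have hz' : Addable h i σ z := by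
    have : z ∈ ({z} : Set (ℕ × ℕ)) := rfl
    rw [← hz] at this; exact this
  obtain ⟨p, hq, hp, hp'⟩ := add_pat hi hi2 ⟨z, hz'⟩
  have hu : ∀ x, QQ h i x → x ∈ partsM σ → x + 1 ∉ partsM σ → x + 1 = z.2 := by
    intro x h1 h2 h3
    have := add_of_one h i σ x h2 hσ.1 ((colRes_QQ x (by omega)).2 h1) h3
    have h4 : (cnt (partsM σ) (x + 1), x + 1) ∈ ({z} : Set (ℕ × ℕ)) := by rw [← hz]; exact this
    rw [Set.mem_singleton_iff] at h4
    rw [← h4]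
  refine ⟨p, hh, hi, hin, hc, hq, hp, hp', ?_, ?_⟩
  · intro x h1 h2 h3
    by_contra h4
    have := hu x h1 h2 h4
    have := hu p hq hp hp'
    omega
  · intro x h1 h2
    by_contra h3
    have m1 := QQ_mod hi hi2 h1
    have m2 := QQ_mod hi hi2 hq
    have : x % h = p % h ∨ (x + 1) % h + p % h = h := by
      unfold QQ at h1 hq; omega
    rcases this with h4 | h4
    · rcases le_or_gt x p with h5 | h5
      · exact h3 (hc.down hp h4 h5)
      · exact hp' (hc.down h2 (by omega) (by omega))
    · exact hc.opp h2 hp h4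

end BPartition
end S8

section S9
namespace BPartition

variable {h i n p : ℕ} {s : Multiset ℕ}

theorem Pk.hi2 (P : Pk n h i s p) : 2 * i + 2 < h := by
  have := P.hh
  have := P.hin
  omega

theorem Pk.ph (P : Pk n h i s p) : p + h ∉ s := by
  intro h1
  have := P.hi2
  have h2 := P.uniq _ (QQ_add.2 P.q) h1 (by omega)
  have := P.core.dn _ h2 (by omega)
  rw [show p + h + 1 - h = p + 1 by omega] at this
  exact P.pout this

theorem Pk.ph1 (P : Pk n h i s p) : p + h + 1 ∉ s := fun h1 =>
  P.ph (P.norem _ (QQ_add.2 P.q) h1)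

theorem Pk.pnh (P : Pk n h i s p) : p ≠ h ∧ p + 1 ≠ h ∧ 0 < p ∧ p ≠ n := by
  have h1 := QQ_ndvd P.hi P.hi2 P.q
  have h2 := QQ_ndvd' P.hi P.hi2 P.q
  refine ⟨?_, ?_, P.core.pos _ P.pin, QQ_half P.hh P.hin P.q⟩
  · rintro rfl; exact h1 dvd_rfl
  · rintro e; rw [e] at h2; exact h2 dvd_rfl

theorem Pk.hp1 (P : Pk n h i s p) (hp : p < h) : h - 1 - p ∉ s ∧ h - p ∉ s := by
  have h1 := P.core.op p P.pin hp
  have := P.hh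
  have h3 := P.pnh
  refine ⟨fun h2 => ?_, h1⟩
  have := P.uniq _ ((QQ_compl hp).2 P.q) h2 (by omega)
  rw [show h - 1 - p + 1 = h - p by omega] at this
  exact h1 this

theorem Pk.lo (P : Pk n h i s p) (hp : h < p) : p - h ∈ s ∧ p + 1 - h ∈ s := by
  have h1 := P.core.dn p P.pin hp
  have h2 := P.uniq _ ((QQ_sub hp.le).2 P.q) h1 (by have := P.hi2; omega)
  rw [show p - h + 1 = p + 1 - h by omega] at h2
  exact ⟨h1, h2⟩

theorem Pk.SSQ (P : Pk n h i s p) : SS h s (p + h) ∧ ¬ SS h s (p + h + 1) := by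
  have := P.pnh
  refine ⟨⟨by omega, P.ph, by omega, fun _ => ?_⟩, fun ⟨_, _, _, h1⟩ => P.pout ?_⟩
  · rw [Nat.add_sub_cancel]; exact P.pin
  · have := h1 (by omega)
    rwa [show p + h + 1 - h = p + 1 by omega] at this

theorem Pk.SSA (P : Pk n h i s p) (hp : h < 2 * p) : SS h s (p + 1) ∧ ¬ SS h s p := by
  refine ⟨⟨by omega, P.pout, fun h1 => ?_, fun h1 => ?_⟩, fun h1 => h1.2.1 P.pin⟩
  · have := (P.hp1 (by omega)).1
    rwa [show h - 1 - p = h - (p + 1) by omega] at this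
  · have := P.pnh
    exact (P.lo (by omega)).2

theorem Pk.SSB (P : Pk n h i s p) (hp : 2 * p < h) : SS h s (h - 1 - p) ∧ ¬ SS h s (h - p) := by
  have := P.pnh
  have := P.hh
  refine ⟨⟨by omega, (P.hp1 (by omega)).1, fun h1 => ?_, by omega⟩, fun h1 => ?_⟩
  · rw [show h - (h - 1 - p) = p + 1 by omega]; exact P.pout
  · have := h1.2.2.1 (by omega)
    rw [show h - (h - p) = p by omega] at this
    exact this P.pin

theorem QQ_two {x y : ℕ} (hx : QQ h i x) (hy : QQ h i y) : x % h = y % h ∨ x % h + y % h + 1 = h := by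
  unfold QQ at hx hy; omega

theorem Pk.SQ (P : Pk n h i s p) {c : ℕ} (hS : SS h s c) (hq : QQ h i c) :
    c = p + h ∨ (c + p + 1 = h) := by
  have hi2 := P.hi2
  obtain ⟨h1, h2, h3, h4⟩ := hS
  have hcd := QQ_ndvd P.hi hi2 hq
  have mp := QQ_mod P.hi hi2 P.q
  have mc := QQ_mod P.hi hi2 hq
  have hcn : c ≠ h := by rintro rfl; exact hcd dvd_rfl
  rcases lt_or_ge h c with h5 | h5
  · left
    have h6 := h4 h5
    have m1 := sub_mod_h h5.le
    by_contra hne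
    rcases QQ_two hq P.q with h7 | h7
    · rcases lt_trichotomy (c - h) p with h8 | h8 | h8
      · have h9 := P.uniq _ ((QQ_sub h5.le).2 hq) h6 (by omega)
        refine h2 (P.core.down P.pin h7 ?_)
        by_contra h10
        have : (p - (c - h)) % h = 0 := (Nat.sub_mod_eq_zero_of_mod_eq (by omega))
        rw [Nat.mod_eq_of_lt (by omega)] at this
        omega
      · omega
      · refine P.ph (P.core.down h6 (by rw [add_mod_h]; omega) ?_)
        by_contra h10
        have : (c - h - p) % h = 0 := (Nat.sub_mod_eq_zero_of_mod_eq (by omega))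
        rw [Nat.mod_eq_of_lt (by omega)] at this
        omega
    · have h9 := P.uniq _ ((QQ_sub h5.le).2 hq) h6 (by
        intro h8
        rw [h8] at m1; have := P.hh; omega)
      have m2 := QQ_mod P.hi hi2 ((QQ_sub h5.le).2 hq)
      exact P.core.opp h9 P.pin (by omega)
  · right
    have h6 := h3 (by omega)
    have m1 : c % h = c := Nat.mod_eq_of_lt (by omega)
    rcases QQ_two hq P.q with h7 | h7
    · exfalso
      refine h2 (P.core.down P.pin h7 ?_)
      have := Nat.mod_le p h
      omega
    · have h8 := P.core.down P.pin (Nat.mod_mod p h) (Nat.mod_le p h)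
      by_contra h9
      have h10 := P.uniq (p % h) (by have := P.q; unfold QQ at *; rwa [Nat.mod_mod]) h8 (by omega)
      rw [show h - c = p % h + 1 by omega] at h6
      exact h6 h10

theorem Pk.SQ' (P : Pk n h i s p) {e : ℕ} (hS : SS h s (e + 1)) (hq : QQ h i e) : e = p := by
  have hi2 := P.hi2
  obtain ⟨h1, h2, h3, h4⟩ := hS
  have hcd := QQ_ndvd P.hi hi2 hq
  have hcd' := QQ_ndvd' P.hi hi2 hq
  have mp := QQ_mod P.hi hi2 P.q
  have mc := QQ_mod P.hi hi2 hq
  have hcn : e ≠ h := by rintro rfl; exact hcd dvd_rfl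
  have hcn' : e + 1 ≠ h := by intro h; rw [h] at hcd'; exact hcd' dvd_rfl
  have hhalf := QQ_half P.hh P.hin hq
  have hh := P.hh
  by_contra hne
  rcases lt_or_ge h e with h5 | h5
  · have h6 := h4 (by omega)
    rw [show e + 1 - h = e - h + 1 by omega] at h6
    have m1 := sub_mod_h h5.le
    have m2 := QQ_mod P.hi hi2 ((QQ_sub h5.le).2 hq)
    have h7 := P.norem _ ((QQ_sub h5.le).2 hq) h6
    rcases QQ_two hq P.q with h8 | h8
    · rcases lt_or_ge (e - h) p with h9 | h9
      · have he : e ∈ s := by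
          refine P.core.down P.pin h8 ?_
          by_contra h10
          have : (p - (e - h)) % h = 0 := (Nat.sub_mod_eq_zero_of_mod_eq (by omega))
          rw [Nat.mod_eq_of_lt (by omega)] at this
          omega
        exact h2 (P.uniq e hq he hne)
      · exact P.pout (P.core.down h6 (by omega) (by omega))
    · exact P.core.opp h6 P.pin (by omega)
  · have m1 : e % h = e := Nat.mod_eq_of_lt (by omega)
    have h6 := h3 (by omega)
    rcases QQ_two hq P.q with h8 | h8
    · have he : e ∈ s := P.core.down P.pin h8 (by have := Nat.mod_le p h; omega)
      exact h2 (P.uniq e hq he hne)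
    · have h9 := P.core.down P.pin (Nat.mod_mod p h) (Nat.mod_le p h)
      rw [show h - (e + 1) = p % h by omega] at h6
      exact h6 h9

theorem Pk.F3 (P : Pk n h i s p) {c : ℕ} (hS : SS h s c) (h1 : c ≠ p + h) (h2 : c + p + 1 ≠ h)
    (h3 : c ≠ p + 1) : sw h i c = c := by
  rcases sw_cases P.hi P.hi2 c with ⟨g1, g2⟩ | ⟨e, rfl, g1, g2⟩ | ⟨_, _, g3⟩
  · rcases P.SQ hS g1 with h | h <;> omega
  · have := P.SQ' hS g1; omega
  · exact g3

end BPartition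
end S9

section S10
namespace BPartition

variable {h i n p : ℕ} {s : Multiset ℕ}

def EE (h c x : ℕ) : ℤ := (hib h c).count x + (lo h c).count (x + 1) - (hib h c).count (x + 1) -
  (lo h c).count x

theorem EE_fix (hi : 1 ≤ i) (hi2 : 2 * i + 2 < h) {c x : ℕ} (hc : sw h i c = c) (hx : QQ h i x) :
    EE h c x = 0 := by
  have h1 : ¬ QQ h i c := fun h1 => by rw [sw_of_Q h1] at hc; omega
  have h2 : ∀ e, c = e + 1 → ¬ QQ h i e := fun e he h2 => by
    rw [he, sw_of_Q' hi hi2 h2] at hc; omega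
  unfold EE
  rw [count_hib, count_hib, count_lo, count_lo]
  have g1 : x ≠ c := by rintro rfl; exact h1 hx
  have g2 : x + 1 ≠ c := fun g => h2 x g.symm hx
  have g3 : ¬ (h < c ∧ x = c - h) := by
    rintro ⟨g, rfl⟩; exact h1 ((QQ_sub g.le).1 hx)
  have g4 : ¬ (h < c ∧ x + 1 = c - h) := by
    rintro ⟨g, g'⟩; exact h2 (x + h) (by omega) (QQ_add.2 hx)
  have g5 : ¬ (c < h ∧ x = h - c) := by
    rintro ⟨g, g'⟩
    have : c ≠ 0 := by
      rintro rfl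
      exact QQ_ndvd hi hi2 hx (by rw [g', Nat.sub_zero])
    exact h2 (c - 1) (by omega) ((QQ_compl (by omega)).1 (by
      rwa [show h - 1 - (c - 1) = x by omega]))
  have g6 : ¬ (c < h ∧ x + 1 = h - c) := by
    rintro ⟨g, g'⟩
    exact h1 ((QQ_compl g).1 (by rwa [show h - 1 - c = x by omega]))
  rw [if_neg g1, if_neg g2, if_neg g3, if_neg g4, if_neg g5, if_neg g6]; rfl

theorem EE_Q (hi : 1 ≤ i) (hi2 : 2 * i + 2 < h) {c x : ℕ} (hc : QQ h i c) (hx : QQ h i x) :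
    EE h c x = (if x = c then 1 else 0) - (if h + x = c then 1 else 0) -
      (if x + c + 1 = h then 1 else 0) := by
  have n1 := QQ_ndvd hi hi2 hc
  have n1' := QQ_pos hi hi2 hx
  have n2 : c ≠ h := by rintro rfl; exact n1 dvd_rfl
  have g2 : x + 1 ≠ c := by rintro rfl; exact QQ_succ hi hi2 hx hc
  have g4 : ¬ (h < c ∧ x + 1 = c - h) := by
    rintro ⟨g, g'⟩
    exact QQ_succ hi hi2 hx (by rw [g']; exact (QQ_sub g.le).2 hc)
  have g5 : ¬ (c < h ∧ x = h - c) := by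
    rintro ⟨g, g'⟩
    have h4 := (QQ_compl g).2 hc
    exact QQ_succ hi hi2 h4 (by rwa [show h - 1 - c + 1 = x by omega])
  unfold EE
  rw [count_hib, count_hib, count_lo, count_lo, if_neg g2, if_neg g4, if_neg g5]
  split_ifs <;> first | rfl | (exfalso; omega)

theorem EE_Q' (hi : 1 ≤ i) (hi2 : 2 * i + 2 < h) {c x : ℕ} (hc : QQ h i c) (hx : QQ h i x) :
    EE h (c + 1) x = -(if x = c then 1 else 0) + (if h + x = c then 1 else 0) +
      (if x + c + 1 = h then 1 else 0) := by
  have n1 := QQ_ndvd hi hi2 hc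
  have n0 := QQ_ndvd' hi hi2 hc
  have n1' := QQ_pos hi hi2 hx
  have n2 : c ≠ h := by rintro rfl; exact n1 dvd_rfl
  have n3 : c + 1 ≠ h := by intro e; rw [e] at n0; exact n0 dvd_rfl
  have g2 : x ≠ c + 1 := by rintro rfl; exact QQ_succ hi hi2 hc hx
  have g4 : ¬ (h < c + 1 ∧ x = c + 1 - h) := by
    rintro ⟨g, g'⟩
    exact QQ_succ hi hi2 ((QQ_sub (by omega : h ≤ c)).2 hc) (by rwa [show c - h + 1 = x by omega])
  have g5 : ¬ (c + 1 < h ∧ x + 1 = h - (c + 1)) := by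
    rintro ⟨g, g'⟩
    have h4 := (QQ_compl (show c < h by omega)).2 hc
    exact QQ_succ hi hi2 hx (by rwa [show x + 1 = h - 1 - c by omega])
  unfold EE
  rw [count_hib, count_hib, count_lo, count_lo, if_neg g2, if_neg g4, if_neg g5]
  split_ifs <;> first | rfl | (exfalso; omega)

theorem EE_sum {l : Multiset ℕ} {a b : ℕ} (H : EqB h s l a b) (x : ℕ) :
    (l.count x : ℤ) - l.count (x + 1) = s.count x - s.count (x + 1) + EE h a x + EE h b x := by
  have h1 := congrArg (Multiset.count x) H
  have h2 := congrArg (Multiset.count (x + 1)) H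
  simp only [Multiset.count_add] at h1 h2
  unfold EE; omega

theorem Pk.EE_neg (P : Pk n h i s p) {l : Multiset ℕ} {a b x : ℕ} (H : EqB h s l a b)
    (hx : QQ h i x) (h1 : x + 1 ∈ l) (h2 : x ∉ l) :
    (if x = p then 1 else 0) + EE h a x + EE h b x < 0 := by
  have h3 := EE_sum H x
  have h4 := Multiset.count_pos.2 h1
  have h5 := Multiset.count_eq_zero.2 h2
  have h6 : (s.count x : ℤ) - s.count (x + 1) = if x = p then 1 else 0 := by
    have n1 := P.core.nd x
    have n2 := P.core.nd (x + 1)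
    split_ifs with e
    · subst e
      have := Multiset.count_pos.2 P.pin
      have := Multiset.count_eq_zero.2 P.pout
      omega
    · by_cases hs : x ∈ s
      · have := Multiset.count_pos.2 hs
        have := Multiset.count_pos.2 (P.uniq x hx hs e)
        omega
      · have := Multiset.count_eq_zero.2 hs
        have := Multiset.count_eq_zero.2 (fun h => hs (P.norem x hx h))
        omega
  omega

theorem sw_fix_add (hi : 1 ≤ i) (hi2 : 2 * i + 2 < h) {c : ℕ} : sw h i (c + h) = c + h ↔ sw h i c = c := by
  rw [sw_add hi hi2]; omega

theorem sw_fix_compl (hi : 1 ≤ i) (hi2 : 2 * i + 2 < h) {a b : ℕ} (hab : a + b = 2 * h) (ha : a < h)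
    (ha0 : 0 < a) : sw h i b + sw h i a = 2 * h := by
  have h1 := sw_compl hi hi2 ha0 ha
  have h2 := sw_add hi hi2 (h - a)
  rw [show h - a + h = b by omega] at h2
  omega

theorem Pk.identA (P : Pk n h i s p) (hp : h < 2 * p) {l : Multiset ℕ} {a b x : ℕ} (hT : Ty h s a b)
    (H : EqB h s l a b) (hx : QQ h i x) (h1 : x + 1 ∈ l) (h2 : x ∉ l) :
    (a = p ∧ b = p + h) ∨ (a = p + 1 ∧ b = p + h) ∨ (a = p + 1 ∧ b = p + 1 + h) := by
  have hi := P.hi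
  have hi2 := P.hi2
  have hneg := P.EE_neg H hx h1 h2
  have f0 : ∀ c, sw h i c = c → EE h c x = 0 := fun c hc => EE_fix hi hi2 hc hx
  have f1 := EE_Q' hi hi2 P.q hx
  have f2 := EE_Q hi hi2 (QQ_add.2 P.q) hx
  have F : ∀ c, SS h s c → sw h i c = c ∨ c = p + 1 ∨ c = p + h := by
    intro c hc
    by_contra hn
    push Not at hn
    exact hn.1 (P.F3 hc hn.2.2 (by have := hc.1; omega) hn.2.1)
  have hpp := P.pnh
  rcases hT with ⟨hab, sa, sb⟩ | ⟨sa, hb⟩ | ⟨sb, hb, ha⟩ | ⟨hab, ha, ha2, sab⟩ | ⟨ha, hb⟩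
  · rcases F a sa with fa | fa | fa
    · rw [f0 a fa] at hneg
      rcases F b sb with fb | fb | fb
      · rw [f0 b fb] at hneg; split_ifs at hneg <;> omega
      · rw [fb, f1] at hneg; split_ifs at hneg <;> omega
      · rw [fb, f2] at hneg; split_ifs at hneg <;> omega
    · rcases F b sb with fb | fb | fb
      · rw [f0 b fb, fa, f1] at hneg; split_ifs at hneg <;> omega
      · omega
      · omega
    · rcases F b sb with fb | fb | fb
      · rw [f0 b fb, fa, f2] at hneg; split_ifs at hneg <;> omega
      · omega
      · omega
  · rcases F a sa with fa | fa | fa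
    · rw [f0 a fa, f0 b (by rw [hb]; exact (sw_fix_add hi hi2).2 fa)] at hneg
      split_ifs at hneg <;> omega
    · omega
    · rw [hb, fa, f2, EE_Q hi hi2 (QQ_add.2 (QQ_add.2 P.q)) hx] at hneg
      split_ifs at hneg <;> omega
  · rcases F b sb with fb | fb | fb
    · rw [f0 b fb, f0 a (by rw [hb] at fb; exact (sw_fix_add hi hi2).1 fb)] at hneg
      split_ifs at hneg <;> omega
    · have q1 := (QQ_sub (show h ≤ p by omega)).2 P.q
      rw [fb, f1, show a = (p - h) + 1 by omega, EE_Q' hi hi2 q1 hx] at hneg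
      split_ifs at hneg <;> omega
    · omega
  · have g0 := sw_fix_compl hi hi2 hab ha (by omega)
    rcases sab with sa | sb
    · rcases F a sa with fa | fa | fa
      · rw [f0 a fa, f0 b (by omega)] at hneg
        split_ifs at hneg <;> omega
      · have q1 := QQ_add.2 ((QQ_compl (show p < h by omega)).2 P.q)
        rw [show b = h - 1 - p + h by omega, EE_Q hi hi2 q1 hx, fa, f1] at hneg
        split_ifs at hneg <;> omega
      · omega
    · rcases F b sb with fb | fb | fb
      · rw [f0 b fb, f0 a (by omega)] at hneg
        split_ifs at hneg <;> omega
      · have q0 := (QQ_sub (show h ≤ p by omega)).2 P.q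
        have q1 := ((QQ_compl (show p - h < h by omega)).2 q0)
        rw [show a = h - 1 - (p - h) by omega, EE_Q hi hi2 q1 hx, fb, f1] at hneg
        split_ifs at hneg <;> omega
      · omega
  · rw [ha, hb, f0 h (sw_h hi hi2)] at hneg
    split_ifs at hneg <;> omega

set_option maxHeartbeats 400000 in
theorem Pk.identB (P : Pk n h i s p) (hp : 2 * p < h) {r : ℕ} (hr : r + p + 1 = h) {l : Multiset ℕ} {a b x : ℕ} (hT : Ty h s a b)
    (H : EqB h s l a b) (hx : QQ h i x) (h1 : x + 1 ∈ l) (h2 : x ∉ l) :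
    (a = r ∧ b = p + h) ∨ (a = r + 1 ∧ b = p + h) ∨ (a = r ∧ b = p + h + 1) := by
  have hi := P.hi
  have hi2 := P.hi2
  have hneg := P.EE_neg H hx h1 h2
  have f0 : ∀ c, sw h i c = c → EE h c x = 0 := fun c hc => EE_fix hi hi2 hc hx
  have qc := (QQ_compl (show p < h by omega)).2 P.q
  rw [show h - 1 - p = r by omega] at qc
  have f1 := EE_Q hi hi2 qc hx
  have f2 := EE_Q hi hi2 (QQ_add.2 P.q) hx
  have hpp := P.pnh
  have hh := P.hh
  have F : ∀ c, SS h s c → sw h i c = c ∨ c = r ∨ c = p + h := by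
    intro c hc
    by_contra hn
    push Not at hn
    have := hc.1
    exact hn.1 (P.F3 hc hn.2.2 (by omega) (by omega))
  rcases hT with ⟨hab, sa, sb⟩ | ⟨sa, hb⟩ | ⟨sb, hb, ha⟩ | ⟨hab, ha, ha2, sab⟩ | ⟨ha, hb⟩
  · rcases F a sa with fa | fa | fa
    · rw [f0 a fa] at hneg
      rcases F b sb with fb | fb | fb
      · rw [f0 b fb] at hneg; split_ifs at hneg <;> omega
      · rw [fb, f1] at hneg; split_ifs at hneg <;> omega
      · rw [fb, f2] at hneg; split_ifs at hneg <;> omega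
    · rcases F b sb with fb | fb | fb
      · rw [f0 b fb, fa, f1] at hneg; split_ifs at hneg <;> omega
      · omega
      · omega
    · rcases F b sb with fb | fb | fb
      · rw [f0 b fb, fa, f2] at hneg; split_ifs at hneg <;> omega
      · omega
      · omega
  · rcases F a sa with fa | fa | fa
    · rw [f0 a fa, f0 b (by rw [hb]; exact (sw_fix_add hi hi2).2 fa)] at hneg
      split_ifs at hneg <;> omega
    · rw [hb, fa, f1, EE_Q hi hi2 (QQ_add.2 qc) hx] at hneg
      split_ifs at hneg <;> omega
    · rw [hb, fa, f2, EE_Q hi hi2 (QQ_add.2 (QQ_add.2 P.q)) hx] at hneg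
      split_ifs at hneg <;> omega
  · rcases F b sb with fb | fb | fb
    · rw [f0 b fb, f0 a (by rw [hb] at fb; exact (sw_fix_add hi hi2).1 fb)] at hneg
      split_ifs at hneg <;> omega
    · omega
    · omega
  · have g0 := sw_fix_compl hi hi2 hab ha (by omega)
    rcases sab with sa | sb
    · rcases F a sa with fa | fa | fa
      · rw [f0 a fa, f0 b (by omega)] at hneg
        split_ifs at hneg <;> omega
      · omega
      · omega
    · rcases F b sb with fb | fb | fb
      · rw [f0 b fb, f0 a (by omega)] at hneg
        split_ifs at hneg <;> omega
      · omega
      · omega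
  · rw [ha, hb, f0 h (sw_h hi hi2)] at hneg
    split_ifs at hneg <;> omega

/-- transport of Ty -/
theorem Ty_sw (hh : h = 2 * n + 1) (hi : 1 ≤ i) (hin : i < n) (P : Pk n h i s p) {a b : ℕ}
    (hT : Ty h (s.map (sw h i)) a b) : Ty h s (sw h i a) (sw h i b) := by
  have hi2 := P.hi2
  rcases hT with ⟨hab, sa, sb⟩ | ⟨sa, hb⟩ | ⟨sb, hb, ha⟩ | ⟨hab, ha, ha2, sab⟩ | ⟨ha, hb⟩
  · left
    have sa' := SS_sw hh hi hin sa
    have sb' := SS_sw hh hi hin sb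
    refine ⟨?_, sa', sb'⟩
    rcases sw_cases hi hi2 a with ⟨g1, g2⟩ | ⟨e, rfl, g1, g2⟩ | ⟨g1, g1', g2⟩ <;>
      rcases sw_cases hi hi2 b with ⟨k1, k2⟩ | ⟨f, rfl, k1, k2⟩ | ⟨k1, k1', k2⟩
    · omega
    · rcases Nat.lt_or_ge a f with h1 | h1
      · have : f ≠ a + 1 := by rintro rfl; exact QQ_succ hi hi2 g1 k1
        omega
      · have : f = a := by omega
        subst this
        rw [g2] at sa'
        rw [k2] at sb'
        have := P.SQ' sa' g1
        subst this
        exact absurd P.pin sb'.2.1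
    · have : b ≠ a + 1 := by rintro rfl; exact k1' _ rfl g1
      omega
    · omega
    · omega
    · omega
    · omega
    · have : a ≠ f := by rintro rfl; exact g1 k1
      omega
    · omega
  · right; left
    exact ⟨SS_sw hh hi hin sa, by rw [hb, sw_add hi hi2]⟩
  · right; right; left
    exact ⟨SS_sw hh hi hin sb, by rw [hb, sw_add hi hi2], sw_half hh hi hin ha⟩
  · right; right; right; left
    have g0 := sw_fix_compl hi hi2 hab ha (by omega)
    exact ⟨by omega, sw_lt hi hi2 ha, sw_half hh hi hin ha2,
      sab.imp (SS_sw hh hi hin) (SS_sw hh hi hin)⟩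
  · right; right; right; right
    rw [ha, hb]; exact ⟨sw_h hi hi2, sw_h hi hi2⟩

end BPartition
end S10

section S11
namespace BPartition

variable {h i n p : ℕ} {s : Multiset ℕ}

def opt (x y z : ℕ × ℕ) : ℕ → ℕ × ℕ
  | 0 => x
  | 1 => y
  | _ => z

theorem NN_add (m m' : Multiset ℕ) (x : ℕ) : NN (m + m') x = NN m x + NN m' x := by
  unfold NN; rw [Multiset.filter_add, Multiset.card_add]

theorem NN_single (a x : ℕ) : NN {a} x = if a < x then 1 else 0 := by
  unfold NN; rw [Multiset.filter_singleton]; split_ifs <;> simp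

theorem MM_congr {s t : Multiset ℕ} (hs : Core h s) (ht : Core h t) {u v : ℕ} (hu : h < 2 * u)
    (huv : u ≤ v) (H : ∀ c, u ≤ c → c < v → (SS h s c ↔ SS h t c)) :
    MM h s u - MM h s v = MM h t u - MM h t v := by
  induction v, huv using Nat.le_induction with
  | base => simp
  | succ v hv ih =>
    have h1 := ih (fun c g1 g2 => H c g1 (by omega))
    have h2 := MM_succ hs v (by omega)
    have h3 := MM_succ ht v (by omega)
    have h4 := H v hv (by omega)
    by_cases h5 : SS h s v
    · have := h2.1 h5
      have := h3.1 (h4.1 h5)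
      omega
    · have := h2.2 h5
      have := h3.2 (fun h => h5 (h4.2 h))
      omega

theorem ddA_s {σ : BPartition} (hc : Core h (partsM σ)) (h3 : 3 ≤ h) (hp : h < 2 * p)
    (s1 : SS h (partsM σ) (p + 1)) (s2 : SS h (partsM σ) (p + h)) (l : BPartition) (j : ℕ)
    (hj : j < 3)
    (H : EqB h (partsM σ) (partsM l) (opt (p, p + h) (p + 1, p + h) (p + 1, p + 1 + h) j).1
      (opt (p, p + h) (p + 1, p + h) (p + 1, p + 1 + h) j).2) :
    (ddd h σ l (opt (p, p + h) (p + 1, p + h) (p + 1, p + 1 + h) j).1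
      (opt (p, p + h) (p + 1, p + h) (p + 1, p + 1 + h) j).2 : ℤ) =
      if j = 1 then MM h (partsM σ) (p + 1) - MM h (partsM σ) (p + h) - 1 else
        MM h (partsM σ) (p + 1) - MM h (partsM σ) (p + h) := by
  have : j = 0 ∨ j = 1 ∨ j = 2 := by omega
  rcases this with rfl | rfl | rfl
  · exact ddd_T (by omega) hc H (Or.inr (Or.inl ⟨s2, rfl, hp⟩))
  · have := (ddd_T1 (by omega) hc H (show p + 1 < p + h by omega) s1 s2).2.2
    simp only [opt] at this
    rw [if_pos (show p + h < p + 1 + h ∧ 2 * h < p + 1 + (p + h) by omega)] at this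
    exact this
  · have := ddd_T (by omega) hc H (Or.inl ⟨s1, rfl⟩)
    have h1 := (MM_succ hc (p + 1) (by omega)).1 s1
    have h2 := (MM_succ hc (p + h) (by omega)).1 s2
    rw [show p + h + 1 = p + 1 + h by omega] at h2
    simp only [OfNat.ofNat_ne_one, if_false, opt] at this ⊢
    omega

theorem ddA_t {τ : BPartition} {q : ℕ} {d : ℤ} (hc : Core h (partsM τ)) (h3 : 3 ≤ h)
    (hq : h < 2 * q)
    (t1 : SS h (partsM τ) q) (t2 : SS h (partsM τ) (q + 1 + h)) (t3 : ¬ SS h (partsM τ) (q + 1))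
    (t4 : ¬ SS h (partsM τ) (q + h))
    (e : MM h (partsM τ) (q + 2) - MM h (partsM τ) (q + h) = d - 1) (l : BPartition) (j : ℕ)
    (hj : j < 3)
    (H : EqB h (partsM τ) (partsM l) (opt (q, q + h) (q, q + 1 + h) (q + 1, q + 1 + h) j).1
      (opt (q, q + h) (q, q + 1 + h) (q + 1, q + 1 + h) j).2) :
    (ddd h τ l (opt (q, q + h) (q, q + 1 + h) (q + 1, q + 1 + h) j).1
      (opt (q, q + h) (q, q + 1 + h) (q + 1, q + 1 + h) j).2 : ℤ) =
      if j = 1 then d else d - 1 := by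
  have h1 := (MM_succ hc q (by omega)).1 t1
  have h2 := (MM_succ hc (q + 1) (by omega)).2 t3
  have h4 := (MM_succ hc (q + h) (by omega)).2 t4
  rw [show q + 1 + 1 = q + 2 by omega] at h2
  rw [show q + h + 1 = q + 1 + h by omega] at h4
  have : j = 0 ∨ j = 1 ∨ j = 2 := by omega
  rcases this with rfl | rfl | rfl
  · have := ddd_T (by omega) hc H (Or.inl ⟨t1, rfl⟩)
    simp only [zero_ne_one, if_false, opt] at this ⊢
    omega
  · have := (ddd_T1 (by omega) hc H (show q < q + 1 + h by omega) t1 t2).2.2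
    simp only [opt] at this
    rw [if_neg (show ¬ (q + 1 + h < q + h ∧ 2 * h < q + (q + 1 + h)) by omega)] at this
    simp only [if_true, opt] at this ⊢
    omega
  · have := ddd_T (by omega) hc H (Or.inr (Or.inl ⟨t2, rfl, show h < 2 * (q + 1) by omega⟩))
    simp only [OfNat.ofNat_ne_one, if_false, opt] at this ⊢
    rw [show q + 1 + 1 = q + 2 by omega] at this
    omega

theorem colA {σ τ : BPartition} {q : ℕ} {v : ℤ} (hc : Core h (partsM σ)) (hc' : Core h (partsM τ))
    (h3 : 3 ≤ h) (hp : h < 2 * p) (hq : h ≤ q)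
    (s1 : SS h (partsM σ) (p + 1)) (s2 : SS h (partsM σ) (p + h))
    (t1 : SS h (partsM τ) q) (t2 : SS h (partsM τ) (q + 1 + h)) (t3 : ¬ SS h (partsM τ) (q + 1))
    (t4 : ¬ SS h (partsM τ) (q + h))
    (hu : MM h (partsM σ) (p + 1) = v + 1) (hv : MM h (partsM σ) (p + h) = v)
    (e : MM h (partsM τ) (q + 2) - MM h (partsM τ) (q + h) = 0)
    (n1 : (NN (partsM τ) (q + h) : ℤ) = NN (partsM τ) (q - h + 1) + 2 * v)
    (n2 : (NN (partsM τ) (q + 1 + h) : ℤ) = NN (partsM τ) (q + 1 - h + 1) + 2 * v - 1)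
    (hβ : betaCount h τ = betaCount h σ) : ∃ c₂ : Colour,
    (∀ l, EqB h (partsM σ) (partsM l) (p + 1) (p + h) → colour h σ l (p + 1) (p + h) = c₂) ∧
    (∀ l, EqB h (partsM τ) (partsM l) q (q + h) → colour h τ l q (q + h) = c₂) ∧
    (∀ l, EqB h (partsM τ) (partsM l) (q + 1) (q + 1 + h) →
      colour h τ l (q + 1) (q + 1 + h) = c₂) := by
  have D0 := ddA_t (d := 1) hc' h3 (by omega) t1 t2 t3 t4 (by omega)
  refine ⟨if (v - 1 + betaCount h σ) % 2 = 1 then Colour.black else Colour.white, ?_, ?_, ?_⟩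
  · intro l H
    obtain ⟨-, g2, g3⟩ := (ddd_T1 (by omega) hc H (show p + 1 < p + h by omega) s1 s2)
    rw [if_pos (show p + h < p + 1 + h ∧ 2 * h < p + 1 + (p + h) by omega)] at g2 g3
    unfold colour
    rw [if_neg (by omega), if_neg (by omega), if_neg (by omega)]
    congr 1
    apply propext
    omega
  · intro l H
    have g3 := D0 l 0 (by omega) H
    simp only [zero_ne_one, if_false, opt] at g3
    have L : (legLen2 h τ l (q + h) : ℤ) = 2 * v := by
      unfold legLen2
      rw [if_pos (by omega)]
      have := leg0 (l := partsM l) hc' (q + h - 2 * h) (q + h) (by omega) (by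
        intro x x1 x2 x3
        refine (memT hc' H (Or.inl ⟨t1, rfl⟩) x3).2 ?_
        rintro ⟨y1, y2⟩; omega)
      rw [show q + h - 2 * h + 1 = q - h + 1 by omega] at this
      omega
    unfold colour
    rw [if_neg (by omega), if_neg (by omega), if_pos (by omega)]
    congr 1
    apply propext
    rw [hβ]
    omega
  · intro l H
    have g3 := D0 l 2 (by omega) H
    simp only [OfNat.ofNat_ne_one, if_false, opt] at g3
    have L : (legLen2 h τ l (q + 1 + h) : ℤ) = 2 * v - 1 := by
      unfold legLen2
      rw [if_pos (by omega)]
      have := leg0 (l := partsM l) hc' (q + 1 + h - 2 * h) (q + 1 + h) (by omega) (by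
        intro x x1 x2 x3
        refine (memT hc' H (Or.inr (Or.inl ⟨t2, rfl, by omega⟩)) x3).2 ?_
        rintro ⟨y1, y2⟩; omega)
      rw [show q + 1 + h - 2 * h + 1 = q + 1 - h + 1 by omega] at this
      omega
    unfold colour
    rw [if_neg (by omega), if_neg (by omega), if_pos (by omega)]
    congr 1
    apply propext
    rw [hβ]
    omega

theorem ddB_s {σ : BPartition} {P Q : ℕ} (hc : Core h (partsM σ)) (hPQ : P + Q + 1 = 2 * h)
    (hP : h < 2 * P) (hP2 : P + 1 < h)
    (s1 : SS h (partsM σ) P) (s2 : SS h (partsM σ) Q) (s3 : ¬ SS h (partsM σ) (P + 1))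
    (l : BPartition) (j : ℕ) (hj : j < 3)
    (H : EqB h (partsM σ) (partsM l) (opt (P, Q) (P + 1, Q) (P, Q + 1) j).1
      (opt (P, Q) (P + 1, Q) (P, Q + 1) j).2) :
    (ddd h σ l (opt (P, Q) (P + 1, Q) (P, Q + 1) j).1
      (opt (P, Q) (P + 1, Q) (P, Q + 1) j).2 : ℤ) =
      if j = 1 then MM h (partsM σ) P - MM h (partsM σ) Q - 1 else
        MM h (partsM σ) P - MM h (partsM σ) Q := by
  have h1 := (MM_succ hc P (by omega)).1 s1
  have h2 := (MM_succ hc Q (by omega)).1 s2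
  have h4 := (MM_succ hc (P + 1) (by omega)).2 s3
  have : j = 0 ∨ j = 1 ∨ j = 2 := by omega
  rcases this with rfl | rfl | rfl
  · have := (ddd_T1 (by omega) hc H (show P < Q by omega) s1 s2).2.2
    simp only [opt] at this
    rw [if_neg (show ¬ (Q < P + h ∧ 2 * h < P + Q) by omega), sub_zero] at this
    exact this
  · have := ddd_T (by omega) hc H (Or.inr (Or.inr (⟨show P + 1 + Q = 2 * h by omega,
      show P + 1 < h by omega, show h < 2 * (P + 1) by omega, Or.inr s2⟩)))
    simp only [if_true, opt] at this ⊢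
    omega
  · have := ddd_T (by omega) hc H (Or.inr (Or.inr (⟨show P + (Q + 1) = 2 * h by omega,
      show P < h by omega, show h < 2 * P by omega, Or.inl s1⟩)))
    simp only [OfNat.ofNat_ne_one, if_false, opt] at this ⊢
    omega

theorem ddB_t {τ : BPartition} {P Q : ℕ} {d : ℤ} (hc : Core h (partsM τ)) (hPQ : P + Q + 1 = 2 * h)
    (hP : h < 2 * P) (hP2 : P + 1 < h)
    (s1 : SS h (partsM τ) (P + 1)) (s2 : SS h (partsM τ) (Q + 1)) (s4 : ¬ SS h (partsM τ) Q)
    (e : MM h (partsM τ) (P + 2) - MM h (partsM τ) Q = d - 1)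
    (l : BPartition) (j : ℕ) (hj : j < 3)
    (H : EqB h (partsM τ) (partsM l) (opt (P + 1, Q) (P, Q + 1) (P + 1, Q + 1) j).1
      (opt (P + 1, Q) (P, Q + 1) (P + 1, Q + 1) j).2) :
    (ddd h τ l (opt (P + 1, Q) (P, Q + 1) (P + 1, Q + 1) j).1
      (opt (P + 1, Q) (P, Q + 1) (P + 1, Q + 1) j).2 : ℤ) =
      if j = 1 then d else d - 1 := by
  have h1 := (MM_succ hc (P + 1) (by omega)).1 s1
  have h4 := (MM_succ hc Q (by omega)).2 s4
  rw [show P + 1 + 1 = P + 2 by omega] at h1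
  have : j = 0 ∨ j = 1 ∨ j = 2 := by omega
  rcases this with rfl | rfl | rfl
  · have := ddd_T (by omega) hc H (Or.inr (Or.inr (⟨show P + 1 + Q = 2 * h by omega,
      show P + 1 < h by omega, show h < 2 * (P + 1) by omega, Or.inl s1⟩)))
    simp only [zero_ne_one, if_false, opt] at this ⊢
    rw [show P + 1 + 1 = P + 2 by omega] at this
    omega
  · have := ddd_T (by omega) hc H (Or.inr (Or.inr (⟨show P + (Q + 1) = 2 * h by omega,
      show P < h by omega, show h < 2 * P by omega, Or.inr s2⟩)))
    simp only [if_true, opt] at this ⊢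
    omega
  · have := (ddd_T1 (by omega) hc H (show P + 1 < Q + 1 by omega) s1 s2).2.2
    simp only [opt] at this
    rw [if_pos (show (Q + 1 < P + 1 + h ∧ 2 * h < P + 1 + (Q + 1)) by omega)] at this
    simp only [OfNat.ofNat_ne_one, if_false, opt] at this ⊢
    omega

/-- DTy from Ty -/
theorem dty_of {σ l : BPartition} {F : ℕ → ℕ} {a b : ℕ} (h0 : 0 < h) (hc : Core h (partsM σ))
    (hT : Ty h (partsM σ) a b) (H : EqB h (partsM σ) (partsM l) a b)
    (Fa : ∀ c, F (c + h) = F c + h) (Fc : a + b = 2 * h → a < h → 0 < a → F b + F a = 2 * h)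
    (Fh : F h = h) : DTy h (partsM σ) F a b (F a) (F b) (ddd h σ l a b) := by
  rcases hT with ⟨hab, sa, sb⟩ | ⟨sa, hb⟩ | ⟨sb, hb, ha⟩ | ⟨hab, ha, ha2, sab⟩ | ⟨ha, hb⟩
  · exact Or.inl ⟨hab, sa, sb, rfl, rfl, (ddd_T1 h0 hc H hab sa sb).2.2⟩
  · exact Or.inr (Or.inl ⟨sa, hb, rfl, by rw [hb, Fa], ddd_T h0 hc H (Or.inl ⟨sa, hb⟩)⟩)
  · exact Or.inr (Or.inr (Or.inl ⟨sb, hb, ha, rfl, by rw [hb, Fa],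
      ddd_T h0 hc H (Or.inr (Or.inl ⟨sb, hb, ha⟩))⟩))
  · have e := ddd_T h0 hc H (Or.inr (Or.inr ⟨hab, ha, ha2, sab⟩))
    have f := Fc hab ha (by omega)
    rcases sab with sa | sb
    · exact Or.inr (Or.inr (Or.inr (Or.inl ⟨hab, ha, ha2, sa, rfl, by omega, e⟩)))
    · exact Or.inr (Or.inr (Or.inr (Or.inr (Or.inl ⟨hab, ha, ha2, sb, rfl, by omega, e⟩))))
  · subst ha hb
    exact Or.inr (Or.inr (Or.inr (Or.inr (Or.inr ⟨rfl, rfl, Fh, Fh, by rw [ddd_T5]; rfl⟩))))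

theorem Ty_half {a b : ℕ} (h0 : 0 < h) (hT : Ty h s a b) : h < 2 * a ∧ h < 2 * b := by
  rcases hT with ⟨hab, sa, sb⟩ | ⟨sa, hb⟩ | ⟨sb, hb, ha⟩ | ⟨hab, ha, ha2, sab⟩ | ⟨ha, hb⟩
  · exact ⟨sa.1, sb.1⟩
  · have := sa.1; omega
  all_goals omega

end BPartition
end S11

section S12
namespace BPartition

variable {h i n p : ℕ} {s : Multiset ℕ}

theorem Pk.cnt (P : Pk n h i s p) {x : ℕ} (hx : QQ h i x) :
    s.count x = s.count (x + 1) + if x = p then 1 else 0 := by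
  have n1 := P.core.nd x
  have n2 := P.core.nd (x + 1)
  split_ifs with e
  · subst e
    have := Multiset.count_pos.2 P.pin
    have := Multiset.count_eq_zero.2 P.pout
    omega
  · by_cases hs : x ∈ s
    · have := Multiset.count_pos.2 hs
      have := Multiset.count_pos.2 (P.uniq x hx hs e)
      omega
    · have := Multiset.count_eq_zero.2 hs
      have := Multiset.count_eq_zero.2 (fun h => hs (P.norem x hx h))
      omega

theorem Pk.teq (P : Pk n h i s p) : s.map (sw h i) + {p} = s + {p + 1} := by
  have hi := P.hi
  have hi2 := P.hi2
  ext y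
  rw [Multiset.count_add, Multiset.count_add, count_sw hi hi2, Multiset.count_singleton,
    Multiset.count_singleton]
  by_cases h1 : QQ h i y
  · rw [sw_of_Q h1]
    have := P.cnt h1
    have : y ≠ p + 1 := by
      rintro rfl; exact QQ_succ hi hi2 P.q h1
    split_ifs at * <;> omega
  · by_cases h2 : ∃ e, y = e + 1 ∧ QQ h i e
    · obtain ⟨e, rfl, h2⟩ := h2
      rw [sw_of_Q' hi hi2 h2]
      have := P.cnt h2
      have : e + 1 ≠ p := by
        rintro rfl; exact h1 P.q
      simp only [Nat.add_right_cancel_iff]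
      split_ifs at * <;> omega
    · have h3 : y ≠ p := by rintro rfl; exact h1 P.q
      have h4 : y ≠ p + 1 := by rintro rfl; exact h2 ⟨p, rfl, P.q⟩
      have h5 : sw h i y = y := sw_fix h1 (fun e he hq => h2 ⟨e, he, hq⟩)
      rw [h5, if_neg h3, if_neg h4]

theorem Pk.mem_t (P : Pk n h i s p) (x : ℕ) :
    x ∈ s.map (sw h i) ↔ (x ∈ s ∧ x ≠ p) ∨ x = p + 1 := by
  have h1 := congrArg (Multiset.count x) P.teq
  rw [Multiset.count_add, Multiset.count_add, Multiset.count_singleton,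
    Multiset.count_singleton] at h1
  have h2 := P.core.nd x
  have h3 := Multiset.count_pos.2 P.pin
  have h4 := Multiset.count_eq_zero.2 P.pout
  rw [← Multiset.count_pos, ← Multiset.count_pos]
  by_cases e1 : x = p
  · subst e1
    rw [if_pos rfl, if_neg (by omega)] at h1
    constructor
    · intro; omega
    · rintro (⟨-, h⟩ | h) <;> omega
  · by_cases e2 : x = p + 1
    · subst e2; simp at h1 ⊢; omega
    · simp [e1, e2] at h1 ⊢; omega

theorem Pk.NN_t (P : Pk n h i s p) (x : ℕ) :
    NN (s.map (sw h i)) x + (if p < x then 1 else 0) = NN s x + if p + 1 < x then 1 else 0 := by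
  have := congrArg (fun m => NN m x) P.teq
  simp only [NN_add, NN_single] at this
  exact this

theorem Pk.tQ1 (P : Pk n h i s p) : SS h (s.map (sw h i)) (p + 1 + h) := by
  have := P.ph1
  rw [show p + h + 1 = p + 1 + h by omega] at this
  have h0 := P.hh
  refine ⟨by omega, ?_, by omega, fun _ => ?_⟩
  · rw [P.mem_t]; rintro (⟨h1, -⟩ | h1)
    · exact this h1
    · omega
  · rw [P.mem_t]; right; omega

theorem Pk.tQ (P : Pk n h i s p) : ¬ SS h (s.map (sw h i)) (p + h) := by
  rintro ⟨-, -, -, h4⟩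
  have := P.pnh
  have := h4 (by omega)
  rw [P.mem_t] at this
  omega

theorem Pk.tA (P : Pk n h i s p) (hp : h < 2 * p) : SS h (s.map (sw h i)) p ∧
    ¬ SS h (s.map (sw h i)) (p + 1) := by
  have h0 := P.hh
  have h1 := P.pnh
  refine ⟨⟨hp, ?_, fun h2 => ?_, fun h2 => ?_⟩, ?_⟩
  · rw [P.mem_t]; omega
  · have := (P.hp1 h2).2
    rw [P.mem_t]; rintro (⟨h1, -⟩ | h1)
    · exact this h1
    · omega
  · rw [P.mem_t]; exact Or.inl ⟨(P.lo h2).1, by omega⟩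
  · rintro ⟨-, h4, -⟩
    apply h4; rw [P.mem_t]; exact Or.inr rfl

theorem Pk.tB (P : Pk n h i s p) (hp : 2 * p < h) : SS h (s.map (sw h i)) (h - p) := by
  have h0 := P.hh
  have h1 := P.pnh
  refine ⟨by omega, ?_, fun h2 => ?_, fun h2 => by omega⟩
  · have := (P.hp1 (by omega)).2
    rw [P.mem_t]; rintro (⟨h1, -⟩ | h1)
    · exact this h1
    · omega
  · rw [show h - (h - p) = p by omega, P.mem_t]; omega

theorem SS_iff_of {s t : Multiset ℕ} {c : ℕ} (h1 : c ∈ s ↔ c ∈ t) (h2 : c < h → (h - c ∈ s ↔ h - c ∈ t))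
    (h3 : h < c → (c - h ∈ s ↔ c - h ∈ t)) : SS h s c ↔ SS h t c := by
  unfold SS
  rw [h1]
  constructor
  · rintro ⟨g1, g2, g3, g4⟩
    exact ⟨g1, g2, fun h => by rw [← h2 h]; exact g3 h, fun h => by rw [← h3 h]; exact g4 h⟩
  · rintro ⟨g1, g2, g3, g4⟩
    exact ⟨g1, g2, fun h => by rw [h2 h]; exact g3 h, fun h => by rw [h3 h]; exact g4 h⟩

theorem Pk.mem_eq (P : Pk n h i s p) {x : ℕ} (h1 : x ≠ p) (h2 : x ≠ p + 1) :
    x ∈ s ↔ x ∈ s.map (sw h i) := by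
  rw [P.mem_t]; tauto

theorem Pk.eA (P : Pk n h i s p) (hp : h < 2 * p) (ht : Core h (s.map (sw h i))) :
    MM h (s.map (sw h i)) (p + 2) - MM h (s.map (sw h i)) (p + h) =
      MM h s (p + 1) - MM h s (p + h) - 1 := by
  have h0 := P.hh
  have h0' := P.hin
  have h1 := MM_congr P.core ht (u := p + 2) (v := p + h) (by omega) (by omega) (by
    intro c c1 c2
    exact SS_iff_of (P.mem_eq (by omega) (by omega)) (fun _ => P.mem_eq (by omega) (by omega))
      (fun _ => P.mem_eq (by omega) (by omega)))
  have h2 := (MM_succ P.core (p + 1) (by omega)).1 (P.SSA hp).1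
  rw [show p + 1 + 1 = p + 2 by omega] at h2
  omega

theorem Pk.eB (P : Pk n h i s p) (hp : 2 * p < h) {r : ℕ} (hr : r + p + 1 = h)
    (ht : Core h (s.map (sw h i))) :
    MM h (s.map (sw h i)) (r + 2) - MM h (s.map (sw h i)) (p + h) =
      MM h s r - MM h s (p + h) - 1 := by
  have h0 := P.hh
  have h0' := P.hin
  have h0'' := P.pnh
  have h1 := MM_congr P.core ht (u := r + 2) (v := p + h) (by omega) (by omega) (by
    intro c c1 c2
    exact SS_iff_of (P.mem_eq (by omega) (by omega)) (fun _ => P.mem_eq (by omega) (by omega))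
      (fun _ => P.mem_eq (by omega) (by omega)))
  have h2 := P.SSB hp
  rw [show h - 1 - p = r by omega, show h - p = r + 1 by omega] at h2
  have h3 := (MM_succ P.core r (by omega)).1 h2.1
  have h4 := (MM_succ P.core (r + 1) (by omega)).2 h2.2
  rw [show r + 1 + 1 = r + 2 by omega] at h4
  omega

theorem map_sw_sw (hi : 1 ≤ i) (hi2 : 2 * i + 2 < h) (m : Multiset ℕ) :
    (m.map (sw h i)).map (sw h i) = m := by
  rw [Multiset.map_map]
  conv_rhs => rw [← Multiset.map_id m]
  refine Multiset.map_congr rfl (fun x _ => ?_)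
  exact sw_sw hi hi2 x

theorem psi_noadd (hi : 1 ≤ i) (hi2 : 2 * i + 2 < h) {l : BPartition} (hl : IsHStrict h l)
    (H : ∀ x, ¬ Removable h i l x) : ∀ x, ¬ Addable h i (psi h i l) x := by
  intro x hx
  obtain ⟨y, hq, h1, h2⟩ := add_pat hi hi2 ⟨x, hx⟩
  rw [psi_sw hi hi2 hl H, mem_sw hi hi2] at h1 h2
  rw [sw_of_Q hq] at h1
  rw [sw_of_Q' hi hi2 hq] at h2
  exact h2 (unexc hi2 hl H y hq h1)

theorem Pk.tau {σ : BPartition} (P : Pk n h i (partsM σ) p) (hσ : IsBarCore h σ) :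
    partsM (psi h i σ) = (partsM σ).map (sw h i) := by
  refine psi_sw P.hi P.hi2 hσ.1 (fun x hx => ?_)
  obtain ⟨y, hq, h1, h2⟩ := rem_pat P.hi P.hi2 ⟨x, hx⟩
  exact h2 (P.norem y hq h1)

def Concl (h i : ℕ) (σ τ α β γ α' β' γ' : BPartition) : Prop :=
    ∃ d : ℕ, 1 ≤ d ∧ ∃ c₁ c₂ : Colour,
      (∀ a b, BarPositions h σ α a b → ddd h σ α a b = d ∧ colour h σ α a b = c₁) ∧
      (∀ a b, BarPositions h σ γ a b → ddd h σ γ a b = d ∧ colour h σ γ a b = c₁) ∧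
      (∀ a b, BarPositions h τ β' a b → ddd h τ β' a b = d ∧ colour h τ β' a b = c₁) ∧
      (∀ a b, BarPositions h τ α' a b →
        ddd h τ α' a b = d - 1 ∧ colour h τ α' a b = c₂) ∧
      (∀ a b, BarPositions h σ β a b →
        ddd h σ β a b = d - 1 ∧ colour h σ β a b = c₂) ∧
      (∀ a b, BarPositions h τ γ' a b →
        ddd h τ γ' a b = d - 1 ∧ colour h τ γ' a b = c₂) ∧
      (∀ lam, InBlock h σ 2 lam → (∀ x, ¬ Removable h i lam x) →
        (∀ a b, BarPositions h σ lam a b → ((ddd h σ lam a b : ℤ) - (d : ℤ)).natAbs ≤ 1) →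
        ((domLT γ lam ∧ domLT β' (psi h i lam)) ∨
          (domLT lam α ∧ domLT (psi h i lam) β'))) ∧
      (∀ lam, InBlock h σ 2 lam → (∀ x, ¬ Removable h i lam x) →
        (∀ a b, BarPositions h σ lam a b →
          ((ddd h σ lam a b : ℤ) - ((d : ℤ) - 1)).natAbs ≤ 1) →
        ((domLT β lam ∧ domLT γ' (psi h i lam)) ∨
          (domLT lam β ∧ domLT (psi h i lam) α')))

theorem caseA {σ : BPartition} (P : Pk n h i (partsM σ) p) (hp : h < 2 * p) (hσ : IsBarCore h σ)
    (α β γ α' β' γ' : BPartition)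
    (hexc : {lam | InBlock h σ 2 lam ∧ ∃ x, Removable h i lam x} = {α, β, γ})
    (ho1 : domLT α β) (ho2 : domLT β γ)
    (hexc' : {mu | InBlock h (psi h i σ) 2 mu ∧ ∃ x, Addable h i mu x} = {α', β', γ'})
    (ho1' : domLT α' β') (ho2' : domLT β' γ') : Concl h i σ (psi h i σ) α β γ α' β' γ' := by
  have hi := P.hi
  have hi2 := P.hi2
  have hh := P.hh
  have hin := P.hin
  have pnh := P.pnh
  have hc := P.core
  have ht := P.tau hσ
  have hct : IsBarCore h (psi h i σ) → Core h ((partsM σ).map (sw h i)) := fun hb => by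
    rw [← ht]; exact core_of hh hb
  have s1 := (P.SSA hp).1
  have s2 := P.SSQ.1
  refine glue hh hσ (opt (p, p + h) (p + 1, p + h) (p + 1, p + 1 + h))
    (opt (p, p + h) (p, p + 1 + h) (p + 1, p + 1 + h)) ?_ ?_ ?_ ?_ ?_ ?_ ?_ ?_ ?_
    (MM h (partsM σ) (p + 1) - MM h (partsM σ) (p + h)) ?_ ?_ ?_ ?_ ?_ α β γ α' β' γ' hexc ho1 ho2
    hexc' ho1' ho2'
  · intro j hj
    have : j = 0 ∨ j = 1 ∨ j = 2 := by omega
    rcases this with rfl | rfl | rfl <;> simp only [opt] <;> omega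
  · intro j hj
    have : j = 0 ∨ j = 1 ∨ j = 2 := by omega
    rcases this with rfl | rfl | rfl <;> simp only [opt] <;> omega
  · simp only [opt, LE2]; omega
  · simp only [opt, LE2]; omega
  · simp only [opt, LE2]; omega
  · simp only [opt, LE2]; omega
  · intro l a b hb hr hbp
    obtain ⟨hT, hE⟩ := bp_ty hh hc hb.1 hbp
    obtain ⟨x, hx, h1, h2⟩ := rem_pat hi hi2 hr
    rcases P.identA hp hT hE hx h1 h2 with h | h | h
    · exact ⟨0, by omega, h⟩
    · exact ⟨1, by omega, h⟩
    · exact ⟨2, by omega, h⟩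
  · intro hbt l a b hb hr hbp
    obtain ⟨hT, hE⟩ := bp_ty hh (core_of hh hbt) hb.1 hbp
    obtain ⟨x, hx, h1, h2⟩ := add_pat hi hi2 hr
    rw [ht] at hT hE
    have hab := Ty_half (by omega) hT
    have hE' := EqB_sw hi hi2 (by omega) (by omega) hE
    rw [map_sw_sw hi hi2] at hE'
    have hT' := Ty_sw hh hi hin P hT
    have ea := sw_sw hi hi2 a
    have eb := sw_sw hi hi2 b
    have e1 := sw_of_Q P.q
    have e2 := sw_of_Q' hi hi2 P.q
    have e3 := sw_add hi hi2 p
    have e4 := sw_add hi hi2 (p + 1)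
    rcases P.identA hp hT' hE' hx (by rw [mem_sw hi hi2, sw_of_Q' hi hi2 hx]; exact h1)
      (by rw [mem_sw hi hi2, sw_of_Q hx]; exact h2) with ⟨h, h'⟩ | ⟨h, h'⟩ | ⟨h, h'⟩
    · rw [h] at ea; rw [h'] at eb
      exact ⟨2, by omega, by simp only [opt]; omega, by simp only [opt]; omega⟩
    · rw [h] at ea; rw [h'] at eb
      exact ⟨1, by omega, by simp only [opt]; omega, by simp only [opt]; omega⟩
    · rw [h] at ea; rw [h'] at eb
      exact ⟨0, by omega, by simp only [opt]; omega, by simp only [opt]; omega⟩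
  · intro l hb H
    exact psi_noadd hi hi2 hb.1 H
  · have := MM_lt hc s1 (show p + 1 < p + h by omega)
    omega
  · exact ddA_s hc (by omega) hp s1 s2
  · intro hbt
    have := P.eA hp (hct hbt)
    have t := P.tA hp
    have t1 := P.tQ
    have t2 := P.tQ1
    rw [← ht] at this t t1 t2
    exact ddA_t (core_of hh hbt) (by omega) hp t.1 t2 t.2 t1 this
  · intro hd hbt
    have e := P.eA hp (hct hbt)
    have t := P.tA hp
    have t1 := P.tQ
    have t2 := P.tQ1
    have hph : h < p := by
      by_contra hlt
      have a1 := MM_lt hc s1 (show p + 1 < h by omega)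
      have a2 := MM_lt hc (SS_h hc (by omega)) (show h < p + h by omega)
      omega
    have N1 := P.NN_t (p + h)
    have N2 := P.NN_t (p - h + 1)
    have N3 := P.NN_t (p + 1 + h)
    have N4 := P.NN_t (p + 1 - h + 1)
    have N5 := P.NN_t h
    rw [if_pos (by omega), if_pos (by omega)] at N1 N3
    rw [if_neg (by omega), if_neg (by omega)] at N2 N4 N5
    have m1 : MM h (partsM σ) (p + 1) = NN (partsM σ) (p + 1) - NN (partsM σ) (p + 1 - h) := by
      unfold MM; rw [if_neg (by omega)]
    have m2 : MM h (partsM σ) (p + h) = NN (partsM σ) (p + h) - NN (partsM σ) p := by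
      unfold MM; rw [if_neg (by omega), Nat.add_sub_cancel]
    have c1 := NN_succ (partsM σ) p
    have c2 := NN_succ (partsM σ) (p - h)
    have c3 := NN_succ (partsM σ) (p + 1 - h)
    have c4 := NN_succ (partsM σ) (p + h)
    have c1' := Multiset.count_pos.2 P.pin
    have c1'' := hc.nd p
    have c3' := Multiset.count_pos.2 (P.lo hph).2
    have c3'' := hc.nd (p + 1 - h)
    have c4' := Multiset.count_eq_zero.2 P.ph
    rw [show p - h + 1 = p + 1 - h by omega] at *
    rw [show p + h + 1 = p + 1 + h by omega] at *
    rw [← ht] at e t t1 t2 N1 N2 N3 N4 N5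
    refine colA (p := p) (q := p) (v := MM h (partsM σ) (p + h)) hc (core_of hh hbt) (by omega) hp hph.le s1 s2 t.1 t2 t.2 t1
      (by omega) rfl (by omega) ?_ ?_ ?_
    · rw [show p - h + 1 = p + 1 - h by omega]; omega
    · omega
    · change NN (partsM (psi h i σ)) h = NN (partsM σ) h
      omega
  · intro l a b hb H hbp hj
    obtain ⟨hT, hE⟩ := bp_ty hh hc hb.1 hbp
    have hab := Ty_half (by omega) hT
    have hE' := EqB_sw hi hi2 (by omega) (by omega) hE
    rw [← ht, ← psi_sw hi hi2 hb.1 H] at hE'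
    refine ⟨sw h i a, sw h i b, hE', hab.1, hab.2, sw_half hh hi hin hab.1, sw_half hh hi hin hab.2, ?_⟩
    have hD := dty_of (F := sw h i) (by omega) hc hT hE (fun c => sw_add hi hi2 c)
      (sw_fix_compl hi hi2) (sw_h hi hi2)
    have e3 := sw_add hi hi2 p
    rw [sw_of_Q P.q] at e3
    exact arithA hc (by omega) (by omega) hp (Or.inl rfl) s1 s2 (P.SSA hp).2 P.SSQ.2 rfl rfl
      (sw_of_Q' hi hi2 P.q) (by omega) (fun c hs h1 h2 => P.F3 hs h2 (by have := hs.1; omega) h1) hD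
      (hj 0 (by omega)) (hj 1 (by omega)) (hj 2 (by omega))

theorem caseB {σ : BPartition} (P : Pk n h i (partsM σ) p) (hp : 2 * p < h) (hσ : IsBarCore h σ)
    (α β γ α' β' γ' : BPartition)
    (hexc : {lam | InBlock h σ 2 lam ∧ ∃ x, Removable h i lam x} = {α, β, γ})
    (ho1 : domLT α β) (ho2 : domLT β γ)
    (hexc' : {mu | InBlock h (psi h i σ) 2 mu ∧ ∃ x, Addable h i mu x} = {α', β', γ'})
    (ho1' : domLT α' β') (ho2' : domLT β' γ') : Concl h i σ (psi h i σ) α β γ α' β' γ' := by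
  have hi := P.hi
  have hi2 := P.hi2
  have hh := P.hh
  have hin := P.hin
  have pnh := P.pnh
  have hc := P.core
  have ht := P.tau hσ
  have hct : IsBarCore h (psi h i σ) → Core h ((partsM σ).map (sw h i)) := fun hb => by
    rw [← ht]; exact core_of hh hb
  obtain ⟨r, hr⟩ : ∃ r, r + p + 1 = h := ⟨h - 1 - p, by omega⟩
  have hrs := P.SSB hp
  rw [show h - 1 - p = r by omega, show h - p = r + 1 by omega] at hrs
  obtain ⟨s1, s3⟩ := hrs
  have s2 := P.SSQ.1
  have qr : QQ h i r := by
    have := (QQ_compl (i := i) (show p < h by omega)).2 P.q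
    rwa [show h - 1 - p = r by omega] at this
  have d1 : MM h (partsM σ) (p + h) + 2 ≤ MM h (partsM σ) r := by
    have a1 := MM_lt hc s1 (show r < h by omega)
    have a2 := MM_lt hc (SS_h hc (by omega)) (show h < p + h by omega)
    omega
  refine glue hh hσ (opt (r, p + h) (r + 1, p + h) (r, p + h + 1))
    (opt (r + 1, p + h) (r, p + h + 1) (r + 1, p + h + 1)) ?_ ?_ ?_ ?_ ?_ ?_ ?_ ?_ ?_
    (MM h (partsM σ) r - MM h (partsM σ) (p + h)) ?_ ?_ ?_ ?_ ?_ α β γ α' β' γ' hexc ho1 ho2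
    hexc' ho1' ho2'
  · intro j hj
    have : j = 0 ∨ j = 1 ∨ j = 2 := by omega
    rcases this with rfl | rfl | rfl <;> simp only [opt] <;> omega
  · intro j hj
    have : j = 0 ∨ j = 1 ∨ j = 2 := by omega
    rcases this with rfl | rfl | rfl <;> simp only [opt] <;> omega
  · simp only [opt, LE2]; omega
  · simp only [opt, LE2]; omega
  · simp only [opt, LE2]; omega
  · simp only [opt, LE2]; omega
  · intro l a b hb hrr hbp
    obtain ⟨hT, hE⟩ := bp_ty hh hc hb.1 hbp
    obtain ⟨x, hx, h1, h2⟩ := rem_pat hi hi2 hrr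
    rcases P.identB hp hr hT hE hx h1 h2 with h | h | h
    · exact ⟨0, by omega, h⟩
    · exact ⟨1, by omega, h⟩
    · exact ⟨2, by omega, h⟩
  · intro hbt l a b hb hrr hbp
    obtain ⟨hT, hE⟩ := bp_ty hh (core_of hh hbt) hb.1 hbp
    obtain ⟨x, hx, h1, h2⟩ := add_pat hi hi2 hrr
    rw [ht] at hT hE
    have hab := Ty_half (by omega) hT
    have hE' := EqB_sw hi hi2 (by omega) (by omega) hE
    rw [map_sw_sw hi hi2] at hE'
    have hT' := Ty_sw hh hi hin P hT
    have ea := sw_sw hi hi2 a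
    have eb := sw_sw hi hi2 b
    have e1 := sw_of_Q P.q
    have e2 := sw_of_Q' hi hi2 P.q
    have e3 := sw_add hi hi2 p
    have e4 := sw_add hi hi2 (p + 1)
    rw [show p + 1 + h = p + h + 1 by omega] at e4
    have e5 := sw_of_Q qr
    have e6 := sw_of_Q' hi hi2 qr
    rcases P.identB hp hr hT' hE' hx (by rw [mem_sw hi hi2, sw_of_Q' hi hi2 hx]; exact h1)
      (by rw [mem_sw hi hi2, sw_of_Q hx]; exact h2) with ⟨h, h'⟩ | ⟨h, h'⟩ | ⟨h, h'⟩
    · rw [h] at ea; rw [h'] at eb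
      exact ⟨2, by omega, by simp only [opt]; omega, by simp only [opt]; omega⟩
    · rw [h] at ea; rw [h'] at eb
      exact ⟨1, by omega, by simp only [opt]; omega, by simp only [opt]; omega⟩
    · rw [h] at ea; rw [h'] at eb
      exact ⟨0, by omega, by simp only [opt]; omega, by simp only [opt]; omega⟩
  · intro l hb H
    exact psi_noadd hi hi2 hb.1 H
  · omega
  · exact ddB_s hc (by omega) (by omega) (by omega) s1 s2 s3
  · intro hbt
    have := P.eB hp hr (hct hbt)
    have t := P.tB hp
    have t1 := P.tQ
    have t2 := P.tQ1
    rw [show h - p = r + 1 by omega] at t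
    rw [show p + 1 + h = p + h + 1 by omega] at t2
    rw [← ht] at this t t1 t2
    exact ddB_t (core_of hh hbt) (by omega) (by omega) (by omega) t t2 t1 this
  · intro hd; omega
  · intro l a b hb H hbp hj
    obtain ⟨hT, hE⟩ := bp_ty hh hc hb.1 hbp
    have hab := Ty_half (by omega) hT
    have hE' := EqB_sw hi hi2 (by omega) (by omega) hE
    rw [← ht, ← psi_sw hi hi2 hb.1 H] at hE'
    refine ⟨sw h i a, sw h i b, hE', hab.1, hab.2, sw_half hh hi hin hab.1, sw_half hh hi hin hab.2, ?_⟩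
    have hD := dty_of (F := sw h i) (by omega) hc hT hE (fun c => sw_add hi hi2 c)
      (sw_fix_compl hi hi2) (sw_h hi hi2)
    have e3 := sw_add hi hi2 p
    rw [sw_of_Q P.q] at e3
    exact arithB hc (by omega) (by omega) (by omega) s1 s2 s3 P.SSQ.2 rfl rfl
      (sw_of_Q qr) (by omega) (fun c hs h1 h2 => P.F3 hs h2 (by omega) (by have := hs.1; omega)) hD
      (hj 0 (by omega)) (hj 1 (by omega)) (hj 2 (by omega))

end BPartition
end S12

section S13
namespace BPartition

variable {h n p : ℕ} {s : Multiset ℕ}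

structure Pz (h : ℕ) (s : Multiset ℕ) (p : ℕ) : Prop where
  h3 : 3 ≤ h
  hp : p + 1 = h
  core : Core h s
  one : ∀ x, x % h = 1 → x ∉ s
  pin : p ∈ s
  ph : p + h ∉ s

theorem pz_of (h3 : 3 ≤ h) (hp : p + 1 = h) {σ : BPartition} (hσ : IsBarCore h σ)
    (hc : Core h (partsM σ))
    (hcnt : Set.ncard {x : ℕ × ℕ | Addable h 0 σ x} = 3) :
    Pz h (partsM σ) p ∧ ∀ x, ¬ Removable h 0 σ x := by
  have pm : p % h = p := Nat.mod_eq_of_lt (by omega)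
  have m1 : 1 % h = 1 := Nat.mod_eq_of_lt (by omega)
  have pm2 : (p + h) % h = p := by rw [Nat.add_mod_right]; exact pm
  have fin : {x : ℕ × ℕ | Addable h 0 σ x}.Finite := Set.finite_of_ncard_pos (by omega)
  have one : ∀ x, x % h = 1 → x ∉ partsM σ := by
    intro x hx hxs
    have x1 : 1 ≤ x := hc.pos x hxs
    have o1 : 1 ∈ partsM σ := hc.down hxs (by omega) x1
    obtain ⟨z, hz⟩ : ({x : ℕ × ℕ | Addable h 0 σ x}).Nonempty := by
      rw [← Set.ncard_pos fin]; omega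
    rcases add_pat0 h3 ⟨z, hz⟩ with g | ⟨y, hy, g⟩ | ⟨y, hy, g, -⟩
    · exact g o1
    · exact hc.opp o1 g (by omega)
    · exact hc.dv y hy g
  have norem : ∀ x, ¬ Removable h 0 σ x := by
    intro x hx
    rcases rem_pat0 h3 ⟨x, hx⟩ with ⟨y, hy, g⟩ | ⟨y, hy, g, -⟩
    · exact one y hy g
    · refine hc.dv _ ?_ g
      have := Nat.div_add_mod y h
      refine ⟨y / h + 1, ?_⟩
      rw [mul_add]; omega
  have add := (psi_s0 h3 hσ.1 norem).2
  have pin : p ∈ partsM σ := by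
    by_contra hps
    have hm : (partsM σ).map (s0 h) = partsM σ := by
      conv_rhs => rw [← Multiset.map_id (partsM σ)]
      refine Multiset.map_congr rfl (fun x hx => ?_)
      unfold s0
      rw [if_neg]
      · rfl
      · intro g
        apply hps
        refine hc.down hx (by omega) ?_
        have := Nat.mod_le x h
        omega
    rw [hm] at add
    have : {x : ℕ × ℕ | Addable h 0 σ x} ⊆ {(cnt (partsM σ) 1, 1)} := by
      rintro ⟨r, c⟩ hx
      obtain ⟨c1, g1, g2⟩ := (add r c).1 hx
      rw [cnt_cons] at g2
      rw [Set.mem_singleton_iff]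
      split_ifs at g2 with g3
      · have : c = 1 := by omega
        subst this
        have : r = cnt (partsM σ) 1 := by omega
        rw [this]
      · omega
    have := Set.ncard_le_ncard this
    rw [Set.ncard_singleton] at this
    omega
  have ph : p + h ∉ partsM σ := by
    intro hps
    have a1 : Addable h 0 σ (cnt (partsM σ) 1, 1) := by
      rw [add, cnt_cons, cnt_s0' h _ 0 (Or.inr rfl) h3]
      simp
    have c1 := cnt_s0 h h3 (partsM σ) p (by omega)
    have c2 := cnt_s0 h h3 (partsM σ) (p + h) (by omega)
    have n1 := Multiset.count_pos.2 pin
    have n2 := Multiset.count_pos.2 hps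
    have a2 : Addable h 0 σ (cnt (partsM σ) (p + 1), p + 1) := by
      rw [add, cnt_cons, c1.1]; omega
    have a3 : Addable h 0 σ (cnt (partsM σ) (p + 2), p + 2) := by
      rw [add, cnt_cons, c1.2]; omega
    have a4 : Addable h 0 σ (cnt (partsM σ) (p + h + 1), p + h + 1) := by
      rw [add, cnt_cons, c2.1]; omega
    have hsub : (↑({(cnt (partsM σ) 1, 1), (cnt (partsM σ) (p + 1), p + 1),
      (cnt (partsM σ) (p + 2), p + 2), (cnt (partsM σ) (p + h + 1), p + h + 1)} : Finset (ℕ × ℕ)) :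
        Set (ℕ × ℕ)) ⊆ {x : ℕ × ℕ | Addable h 0 σ x} := by
      intro x hx
      simp only [Finset.coe_insert, Finset.coe_singleton, Set.mem_insert_iff,
        Set.mem_singleton_iff] at hx
      rcases hx with rfl | rfl | rfl | rfl <;> assumption
    have := Set.ncard_le_ncard hsub fin
    rw [Set.ncard_coe_finset, hcnt, Finset.card_insert_of_notMem, Finset.card_insert_of_notMem,
      Finset.card_insert_of_notMem, Finset.card_singleton] at this
    · omega
    all_goals
      simp only [Finset.mem_insert, Finset.mem_singleton, Prod.mk.injEq, not_or]
      omega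
  exact ⟨⟨h3, hp, hc, one, pin, ph⟩, norem⟩

theorem Pz.cls (P : Pz h s p) {x : ℕ} (hx : x ∈ s) (hm : x % h + 1 = h) : x = p := by
  by_contra hne
  have hp := P.hp
  have pm : p % h = p := Nat.mod_eq_of_lt (by omega)
  apply P.ph
  refine P.core.down hx (by rw [Nat.add_mod_right]; omega) ?_
  have e := Nat.div_add_mod x h
  rcases Nat.eq_zero_or_pos (x / h) with h0 | h0
  · rw [h0] at e; omega
  · have := Nat.mul_le_mul_left h h0
    simp only [Nat.succ_eq_add_one, zero_add, mul_one] at this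
    omega

theorem Pz.teq (P : Pz h s p) : ∃ s', s = p ::ₘ s' ∧
    1 ::ₘ s.map (s0 h) = 1 ::ₘ (p + 2) ::ₘ s' := by
  obtain ⟨s', hs⟩ := Multiset.exists_cons_of_mem P.pin
  refine ⟨s', hs, ?_⟩
  have hp := P.hp
  have pm : p % h = p := Nat.mod_eq_of_lt (by omega)
  congr 1
  conv_lhs => rw [hs]
  rw [Multiset.map_cons]
  congr 1
  · unfold s0; rw [if_pos (by omega)]
  · conv_rhs => rw [← Multiset.map_id s']
    refine Multiset.map_congr rfl (fun x hx => ?_)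
    unfold s0
    rw [if_neg]
    · rfl
    · intro g
      have := P.cls (hs ▸ Multiset.mem_cons_of_mem hx) g
      subst this
      have := P.core.nd x
      rw [hs, Multiset.count_cons_self] at this
      have := Multiset.count_pos.2 hx
      omega

theorem Pz.mem_t (P : Pz h s p) (x : ℕ) :
    x ∈ 1 ::ₘ s.map (s0 h) ↔ (x ∈ s ∧ x ≠ p) ∨ x = 1 ∨ x = p + 2 := by
  obtain ⟨s', hs, ht⟩ := P.teq
  have hn : p ∉ s' := fun g => by
    have := P.core.nd p
    rw [hs, Multiset.count_cons_self] at this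
    have := Multiset.count_pos.2 g
    omega
  rw [ht, hs]
  simp only [Multiset.mem_cons]
  constructor
  · rintro (h | h | h)
    · exact Or.inr (Or.inl h)
    · exact Or.inr (Or.inr h)
    · exact Or.inl ⟨Or.inr h, fun e => hn (e ▸ h)⟩
  · rintro (⟨h | h, g⟩ | h | h)
    · exact absurd h g
    · exact Or.inr (Or.inr h)
    · exact Or.inl h
    · exact Or.inr (Or.inl h)

theorem Pz.NN_t (P : Pz h s p) (x : ℕ) :
    NN (1 ::ₘ s.map (s0 h)) x + (if p < x then 1 else 0) =
      NN s x + (if 1 < x then 1 else 0) + if p + 2 < x then 1 else 0 := by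
  obtain ⟨s', hs, ht⟩ := P.teq
  rw [ht, hs, ← Multiset.singleton_add, ← Multiset.singleton_add, ← Multiset.singleton_add]
  simp only [NN_add, NN_single]
  omega

theorem Pz.S2 (P : Pz h s p) : SS h s (p + h) := by
  have := P.hp
  have := P.h3
  refine ⟨by omega, P.ph, by omega, fun _ => ?_⟩
  rw [Nat.add_sub_cancel]; exact P.pin

theorem Pz.S3 (P : Pz h s p) : ¬ SS h s p := fun g => g.2.1 P.pin

theorem Pz.S4 (P : Pz h s p) : ¬ SS h s (p + h + 1) := by
  have := P.hp
  rintro ⟨-, -, -, g⟩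
  refine P.core.dv _ (dvd_refl h) ?_
  have := g (by omega)
  rwa [show p + h + 1 - h = h by omega] at this

theorem Pz.S1 (P : Pz h s p) {c : ℕ} (hS : SS h s c) (hm : c % h = 1) : False := by
  have h3 := P.h3
  rcases lt_trichotomy c h with g | g | g
  · have := hS.1
    rw [Nat.mod_eq_of_lt g] at hm; omega
  · rw [g, Nat.mod_self] at hm; omega
  · refine P.one _ ?_ (hS.2.2.2 g)
    rw [← hm]
    conv_rhs => rw [show c = c - h + h by omega, Nat.add_mod_right]

theorem Core.S0 {c : ℕ} (hc : Core h s) (hS : SS h s c) (hm : h ∣ c) : c = h := by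
  rcases lt_trichotomy c h with g | g | g
  · have := Nat.eq_zero_of_dvd_of_lt hm g
    have := hS.1
    omega
  · exact g
  · exact absurd (hS.2.2.2 g) (hc.dv _ (Nat.dvd_sub hm dvd_rfl))

theorem Pz.Sm (P : Pz h s p) {c : ℕ} (hS : SS h s c) (hm : c % h + 1 = h) : c = p + h := by
  have h3 := P.h3
  have hp := P.hp
  rcases lt_trichotomy c h with g | g | g
  · rw [Nat.mod_eq_of_lt g] at hm
    have e : c = p := by omega
    exact absurd (e ▸ hS) P.S3
  · rw [g, Nat.mod_self] at hm; omega
  · have := P.cls (hS.2.2.2 g) (by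
      conv_lhs => rw [← Nat.add_mod_right, show c - h + h = c by omega]
      exact hm)
    omega

theorem s0_add (c : ℕ) : s0 h (c + h) = s0 h c + h := by
  unfold s0; rw [Nat.add_mod_right]; split_ifs <;> omega

theorem Pz.identS (P : Pz h s p) {l : Multiset ℕ} {a b : ℕ} (hT : Ty h s a b)
    (H : EqB h s l a b)
    (hx : (∃ x, x % h = 1 ∧ x ∈ l) ∨ ∃ x, x % h + 1 = h ∧ x + 1 ∈ l ∧ x ∉ l) :
    (a = p ∧ b = p + h) ∨ (a = p + 1 ∧ b = p + h) ∨ (a = p + 1 ∧ b = p + 1 + h) := by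
  have h3 := P.h3
  have hp := P.hp
  have hc := P.core
  have pm : p % h = p := Nat.mod_eq_of_lt (by omega)
  have hab := Ty_half (by omega) hT
  have am : a < h → a % h = a := Nat.mod_eq_of_lt
  have bm : b < h → b % h = b := Nat.mod_eq_of_lt
  have am' : (h - a) % h = h - a := Nat.mod_eq_of_lt (by omega)
  have bm' : (h - b) % h = h - b := Nat.mod_eq_of_lt (by omega)
  have A1 : SS h s a → a % h ≠ 1 ∧ a ≠ p := fun g => ⟨fun e => P.S1 g e, fun e => P.S3 (e ▸ g)⟩
  have B1 : SS h s b → b % h ≠ 1 ∧ b ≠ p := fun g => ⟨fun e => P.S1 g e, fun e => P.S3 (e ▸ g)⟩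
  have A0 : SS h s a → h ∣ a → a = h := fun g e => hc.S0 g e
  have B0 : SS h s b → h ∣ b → b = h := fun g e => hc.S0 g e
  have A2 : b = a + h → b % h = a % h := fun e => by rw [e, Nat.add_mod_right]
  have A3 : a + b = 2 * h → a < h → b % h = h - a := fun e g => by
    rw [show b = (h - a) + h by omega, Nat.add_mod_right, am']
  rcases hx with ⟨x, hx, hl⟩ | ⟨x, hx, hl, hl'⟩
  · have E := EqB_count H x
    have n1 := Multiset.count_pos.2 hl
    have n2 := Multiset.count_eq_zero.2 (P.one x hx)
    have key : x = a ∨ (a < h ∧ x = h - a) ∨ x = b ∨ (b < h ∧ x = h - b) := by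
      by_contra hcon
      push Not at hcon
      obtain ⟨c1, c2, c3, c4⟩ := hcon
      rw [if_neg c1, if_neg (show ¬ (a < h ∧ x = h - a) from fun g => c2 g.1 g.2), if_neg c3,
        if_neg (show ¬ (b < h ∧ x = h - b) from fun g => c4 g.1 g.2)] at E
      omega
    rcases hT with ⟨hab', sa, sb⟩ | ⟨sa, hb⟩ | ⟨sb, hb, ha⟩ | ⟨hs, ha, ha2, sab⟩ | ⟨ha, hb⟩
    · exfalso
      have := A1 sa
      have := B1 sb
      rcases key with rfl | ⟨k1, rfl⟩ | rfl | ⟨k1, rfl⟩ <;> omega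
    · exfalso
      have := A1 sa
      have := A2 hb
      rcases key with rfl | ⟨k1, rfl⟩ | rfl | ⟨k1, rfl⟩ <;> omega
    · have := B1 sb
      have := A2 hb
      rcases key with rfl | ⟨k1, rfl⟩ | rfl | ⟨k1, rfl⟩ <;> omega
    · exfalso
      have := A3 hs ha
      have hm : (h + 1) % h = 1 := by
        rw [Nat.add_comm, Nat.add_mod_right]; exact Nat.mod_eq_of_lt (by omega)
      have : a = p ∧ b = h + 1 := by
        rcases key with rfl | ⟨k1, rfl⟩ | rfl | ⟨k1, rfl⟩ <;> omega
      obtain ⟨rfl, rfl⟩ := this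
      rcases sab with g | g
      · exact P.S3 g
      · exact P.S1 g hm
    · exfalso
      have hm : h % h = 0 := Nat.mod_self h
      subst ha hb
      rcases key with rfl | ⟨k1, rfl⟩ | rfl | ⟨k1, rfl⟩ <;> omega
  · have E := EqB_count H (x + 1)
    have E' := EqB_count H x
    have hd : h ∣ x + 1 := ⟨x / h + 1, by
      have := Nat.div_add_mod x h
      rw [mul_add]; omega⟩
    have n1 := Multiset.count_pos.2 hl
    have n1' := Multiset.count_eq_zero.2 hl'
    have n2 := Multiset.count_eq_zero.2 (hc.dv _ hd)
    have hle := Nat.le_of_dvd (by omega) hd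
    have key : x + 1 = a ∨ x + 1 = b := by
      by_contra hcon
      push Not at hcon
      obtain ⟨c1, c3⟩ := hcon
      rw [if_neg c1, if_neg (show ¬ (a < h ∧ x + 1 = h - a) by omega), if_neg c3,
        if_neg (show ¬ (b < h ∧ x + 1 = h - b) by omega)] at E
      omega
    have xe : x + 1 = h → x = p := by omega
    have key2 : x = p → (h < a ∧ x = a - h) ∨ (h < b ∧ x = b - h) := by
      intro e
      subst e
      by_contra hcon
      push Not at hcon
      have := Multiset.count_pos.2 P.pin
      rw [if_neg (fun g => hcon.1 g.1 g.2), if_neg (fun g => hcon.2 g.1 g.2)] at E'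
      omega
    rcases hT with ⟨hab', sa, sb⟩ | ⟨sa, hb⟩ | ⟨sb, hb, ha⟩ | ⟨hs, ha, ha2, sab⟩ | ⟨ha, hb⟩
    · rcases key with e | e
      · have := A0 sa (e ▸ hd)
        have := key2 (by omega)
        omega
      · have := B0 sb (e ▸ hd)
        have := key2 (by omega)
        omega
    · have : h ∣ a := by
        rcases key with e | e
        · exact e ▸ hd
        · rw [e, hb] at hd
          exact (Nat.dvd_add_left dvd_rfl).1 hd
      have := A0 sa this
      omega
    · exfalso
      have : h ∣ b := by
        rcases key with e | e
        · rw [e] at hd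
          rw [hb]; exact dvd_add hd dvd_rfl
        · exact e ▸ hd
      have := B0 sb this
      omega
    · exfalso
      have hb : h ∣ b := by
        rcases key with e | e
        · omega
        · exact e ▸ hd
      have e1 := Nat.mod_eq_zero_of_dvd hb
      have := A3 hs ha
      omega
    · exfalso
      have := key2 (by omega)
      omega

theorem Pz.identT (P : Pz h s p) {t : Multiset ℕ} (ht : t = 1 ::ₘ s.map (s0 h)) (hc : Core h t)
    {l : Multiset ℕ} {a b : ℕ} (hT : Ty h t a b)
    (H : EqB h t l a b)
    (hx : 1 ∉ l ∨ (∃ x, x % h + 1 = h ∧ x ∈ l) ∨ ∃ x, h ∣ x ∧ x ∈ l ∧ x + 1 ∉ l) :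
    (a = h ∧ b = h + h) ∨ (a = h ∧ b = h + 1 + h) ∨ (a = h + 1 ∧ b = h + 1 + h) := by
  have h3 := P.h3
  have hp := P.hp
  have pm : p % h = p := Nat.mod_eq_of_lt (by omega)
  have m1 : 1 % h = 1 := Nat.mod_eq_of_lt (by omega)
  have mt : ∀ x, x ∈ t ↔ (x ∈ s ∧ x ≠ p) ∨ x = 1 ∨ x = p + 2 := by
    rw [ht]; exact P.mem_t
  have hm : (h + 1) % h = 1 := by
    rw [Nat.add_comm, Nat.add_mod_right]; exact m1
  have t1 : 1 ∈ t := (mt 1).2 (by omega)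
  have th1 : h + 1 ∈ t := (mt _).2 (by omega)
  have tm : ∀ x, x % h + 1 = h → x ∉ t := by
    intro x hx g
    rcases (mt x).1 g with ⟨g1, g2⟩ | g1 | g1
    · exact g2 (P.cls g1 hx)
    · rw [g1] at hx; omega
    · rw [g1, show p + 2 = h + 1 by omega] at hx; omega
  have Sm : ∀ c, SS h t c → c % h + 1 ≠ h := by
    intro c g e
    rcases lt_trichotomy c h with g1 | g1 | g1
    · have := g.2.2.1 g1
      rw [Nat.mod_eq_of_lt g1] at e
      rw [show h - c = 1 by omega] at this
      exact this t1
    · rw [g1, Nat.mod_self] at e; omega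
    · refine tm (c - h) ?_ (g.2.2.2 g1)
      conv_lhs => rw [← Nat.add_mod_right, show c - h + h = c by omega]
      exact e
  have Sh1 : ¬ SS h t (h + 1) := fun g => g.2.1 th1
  have hab := Ty_half (by omega) hT
  have am : a < h → a % h = a := Nat.mod_eq_of_lt
  have bm : b < h → b % h = b := Nat.mod_eq_of_lt
  have am' : (h - a) % h = h - a := Nat.mod_eq_of_lt (by omega)
  have bm' : (h - b) % h = h - b := Nat.mod_eq_of_lt (by omega)
  have A1 : SS h t a → a % h + 1 ≠ h ∧ a ≠ h + 1 := fun g => ⟨Sm _ g, fun e => Sh1 (e ▸ g)⟩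
  have B1 : SS h t b → b % h + 1 ≠ h ∧ b ≠ h + 1 := fun g => ⟨Sm _ g, fun e => Sh1 (e ▸ g)⟩
  have A0 : SS h t a → h ∣ a → a = h := fun g e => hc.S0 g e
  have B0 : SS h t b → h ∣ b → b = h := fun g e => hc.S0 g e
  have A2 : b = a + h → b % h = a % h := fun e => by rw [e, Nat.add_mod_right]
  have A3 : a + b = 2 * h → a < h → b % h = h - a := fun e g => by
    rw [show b = (h - a) + h by omega, Nat.add_mod_right, am']
  rcases hx with hl | ⟨x, hx, hl⟩ | ⟨x, hd, hl, hl'⟩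
  · have E := EqB_count H 1
    have n1 := Multiset.count_eq_zero.2 hl
    have n2 := Multiset.count_pos.2 t1
    have key : a = h + 1 ∨ b = h + 1 := by
      by_contra hcon
      rw [if_neg (show ¬ (h < a ∧ 1 = a - h) by omega),
        if_neg (show ¬ (h < b ∧ 1 = b - h) by omega)] at E
      omega
    rcases hT with ⟨hab', sa, sb⟩ | ⟨sa, hb⟩ | ⟨sb, hb, ha⟩ | ⟨hs, ha, ha2, sab⟩ | ⟨ha, hb⟩
    · have := A1 sa
      have := B1 sb
      omega
    · have := A1 sa
      omega
    · have := B1 sb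
      omega
    · exfalso
      rcases sab with g | g
      · have := A1 g; omega
      · have := B1 g; omega
    · omega
  · have E := EqB_count H x
    have n1 := Multiset.count_pos.2 hl
    have n2 := Multiset.count_eq_zero.2 (tm x hx)
    have key : x = a ∨ (a < h ∧ x = h - a) ∨ x = b ∨ (b < h ∧ x = h - b) := by
      by_contra hcon
      push Not at hcon
      obtain ⟨c1, c2, c3, c4⟩ := hcon
      rw [if_neg c1, if_neg (show ¬ (a < h ∧ x = h - a) from fun g => c2 g.1 g.2), if_neg c3,
        if_neg (show ¬ (b < h ∧ x = h - b) from fun g => c4 g.1 g.2)] at E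
      omega
    exfalso
    rcases hT with ⟨hab', sa, sb⟩ | ⟨sa, hb⟩ | ⟨sb, hb, ha⟩ | ⟨hs, ha, ha2, sab⟩ | ⟨ha, hb⟩
    · have := A1 sa
      have := B1 sb
      rcases key with rfl | ⟨k1, rfl⟩ | rfl | ⟨k1, rfl⟩ <;> omega
    · have := A1 sa
      have := A2 hb
      rcases key with rfl | ⟨k1, rfl⟩ | rfl | ⟨k1, rfl⟩ <;> omega
    · have := B1 sb
      have := A2 hb
      rcases key with rfl | ⟨k1, rfl⟩ | rfl | ⟨k1, rfl⟩ <;> omega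
    · have := A3 hs ha
      have : a = p ∧ b = h + 1 := by
        rcases key with rfl | ⟨k1, rfl⟩ | rfl | ⟨k1, rfl⟩ <;> omega
      rcases sab with g | g
      · have := A1 g; omega
      · have := B1 g; omega
    · have hm : h % h = 0 := Nat.mod_self h
      subst ha hb
      rcases key with rfl | ⟨k1, rfl⟩ | rfl | ⟨k1, rfl⟩ <;> omega
  · have E := EqB_count H x
    have E' := EqB_count H (h + 1)
    have n1 := Multiset.count_pos.2 hl
    have n2 := Multiset.count_eq_zero.2 (hc.dv _ hd)
    have key0 : x = 0 ∨ h ≤ x := by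
      rcases Nat.eq_zero_or_pos x with g | g
      · exact Or.inl g
      · exact Or.inr (Nat.le_of_dvd g hd)
    have key : x = a ∨ x = b := by
      by_contra hcon
      push Not at hcon
      obtain ⟨c1, c3⟩ := hcon
      rw [if_neg c1, if_neg (show ¬ (a < h ∧ x = h - a) by omega), if_neg c3,
        if_neg (show ¬ (b < h ∧ x = h - b) by omega)] at E
      omega
    have key2 : x = h → a = h + 1 + h ∨ b = h + 1 + h := by
      intro e
      rw [e] at hl'
      have n3 := Multiset.count_eq_zero.2 hl'
      have := Multiset.count_pos.2 th1
      by_contra hcon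
      rw [if_neg (show ¬ (h < a ∧ h + 1 = a - h) by omega),
        if_neg (show ¬ (h < b ∧ h + 1 = b - h) by omega)] at E'
      omega
    rcases hT with ⟨hab', sa, sb⟩ | ⟨sa, hb⟩ | ⟨sb, hb, ha⟩ | ⟨hs, ha, ha2, sab⟩ | ⟨ha, hb⟩
    · rcases key with e | e
      · have := A0 sa (e ▸ hd)
        have := key2 (by omega)
        omega
      · have := B0 sb (e ▸ hd)
        have := key2 (by omega)
        omega
    · have : h ∣ a := by
        rcases key with e | e
        · exact e ▸ hd
        · rw [e, hb] at hd
          exact (Nat.dvd_add_left dvd_rfl).1 hd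
      have := A0 sa this
      omega
    · exfalso
      have : h ∣ b := by
        rcases key with e | e
        · rw [e] at hd
          rw [hb]; exact dvd_add hd dvd_rfl
        · exact e ▸ hd
      have := B0 sb this
      omega
    · exfalso
      have hb : h ∣ b := by
        rcases key with e | e
        · omega
        · exact e ▸ hd
      have e1 := Nat.mod_eq_zero_of_dvd hb
      have := A3 hs ha
      omega
    · exfalso
      have := key2 (by omega)
      omega

end BPartition
end S13

section S14
namespace BPartition

variable {h n p : ℕ} {s : Multiset ℕ}

theorem s0_small {c : ℕ} (h1 : c + 1 < h) : s0 h c = c := by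
  unfold s0; rw [Nat.mod_eq_of_lt (by omega), if_neg (by omega)]

theorem s0_h (h3 : 3 ≤ h) : s0 h h = h := by
  unfold s0; rw [Nat.mod_self, if_neg (by omega)]

theorem le_s0 (c : ℕ) : c ≤ s0 h c := by
  unfold s0; split_ifs <;> omega

theorem map_lo (h3 : 3 ≤ h) {c : ℕ} (hcp : c + 1 ≠ h) :
    (lo h c).map (s0 h) = lo h (s0 h c) := by
  unfold lo
  rcases lt_trichotomy c h with h1 | h1 | h1
  · rw [s0_small (by omega), if_neg (by omega)]; rfl
  · subst h1; rw [s0_h h3]; simp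
  · have := le_s0 (h := h) c
    have e := s0_add (h := h) (c - h)
    rw [show c - h + h = c by omega] at e
    rw [if_pos h1, if_pos (by omega), Multiset.map_singleton, e, Nat.add_sub_cancel]

theorem map_hib (h3 : 3 ≤ h) {c : ℕ} (hc : h < 2 * c) (hcp : c + 1 ≠ h) :
    (hib h c).map (s0 h) = hib h (s0 h c) := by
  unfold hib
  rcases Nat.lt_or_ge c h with h1 | h1
  · rw [s0_small (by omega), if_neg (by omega)]
    simp only [Multiset.insert_eq_cons, Multiset.map_cons, Multiset.map_singleton]
    rw [s0_small (show c + 1 < h by omega), s0_small (show h - c + 1 < h by omega)]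
  · have := le_s0 (h := h) c
    rw [if_pos h1, if_pos (by omega), Multiset.map_singleton]

theorem EqB_s0 (h3 : 3 ≤ h) {s l : Multiset ℕ} {a b : ℕ} (ha : h < 2 * a) (hb : h < 2 * b)
    (ha' : a + 1 ≠ h) (hb' : b + 1 ≠ h) (H : EqB h s l a b) :
    EqB h (1 ::ₘ s.map (s0 h)) (1 ::ₘ l.map (s0 h)) (s0 h a) (s0 h b) := by
  have := congrArg (Multiset.map (s0 h)) H
  simp only [Multiset.map_add, map_lo h3 ha', map_lo h3 hb', map_hib h3 ha ha',
    map_hib h3 hb hb'] at this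
  unfold EqB
  simp only [Multiset.cons_add, this]

theorem psi_noadd0 (h3 : 3 ≤ h) {l : BPartition} (hl : IsHStrict h l)
    (H : ∀ x, ¬ Removable h 0 l x) : ∀ x, ¬ Addable h 0 (psi h 0 l) x := by
  intro x hx
  obtain ⟨u1, u2⟩ := unexc0 h3 hl H
  have e := (psi_s0 h3 hl H).1
  have cls : ∀ y, y % h + 1 = h → (y + 2) % h = 1 := by
    intro y hy
    have e := Nat.div_add_mod y h
    rw [show y + 2 = 1 + h * (y / h + 1) by rw [mul_add]; omega, Nat.add_mul_mod_self_left]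
    exact Nat.mod_eq_of_lt (by omega)
  rcases add_pat0 h3 ⟨x, hx⟩ with g | ⟨y, hy, g⟩ | ⟨y, hy, g, g'⟩
  · apply g; rw [e]; exact Multiset.mem_cons_self _ _
  · rw [e, Multiset.mem_cons, Multiset.mem_map] at g
    rcases g with g | ⟨z, hz, g⟩
    · rw [g, Nat.mod_eq_of_lt (by omega)] at hy; omega
    · unfold s0 at g
      split_ifs at g with g2
      · have := cls z g2
        rw [g] at this; omega
      · rw [g] at g2; exact g2 hy
  · rw [e, Multiset.mem_cons, Multiset.mem_map] at g
    have y0 : y % h = 0 := Nat.mod_eq_zero_of_dvd hy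
    rcases g with g | ⟨z, hz, g⟩
    · rw [g, Nat.mod_eq_of_lt (by omega)] at y0; omega
    · unfold s0 at g
      split_ifs at g with g2
      · have := cls z g2
        rw [g] at this; omega
      · subst g
        have zp : 0 < z := by
          rcases Nat.eq_zero_or_pos z with g | g
          · exfalso
            rw [g] at hz
            exact absurd (pos_of_mem hz) (by omega)
          · exact g
        obtain ⟨k, rfl⟩ := hy
        obtain ⟨k, rfl⟩ : ∃ j, k = j + 1 := ⟨k - 1, by
          rcases Nat.eq_zero_or_pos k with g | g
          · subst g; omega
          · omega⟩
        have m : (h * (k + 1) - 1) % h + 1 = h := by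
          rw [show h * (k + 1) - 1 = (h - 1) + h * k by rw [mul_add]; omega,
            Nat.add_mul_mod_self_left, Nat.mod_eq_of_lt (by omega)]
          omega
        have := u2 _ m (by rw [Nat.sub_add_cancel (by omega)]; exact hz)
        apply g'
        rw [e, Multiset.mem_cons, Multiset.mem_map]
        right
        refine ⟨_, this, ?_⟩
        unfold s0
        rw [if_pos m]; omega

theorem Pz.mem_eq (P : Pz h s p) {x : ℕ} (h1 : x ≠ p) (h2 : x ≠ 1) (h3 : x ≠ p + 2) :
    x ∈ s ↔ x ∈ 1 ::ₘ s.map (s0 h) := by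
  rw [P.mem_t]; tauto

theorem Pz.e (P : Pz h s p) (ht : Core h (1 ::ₘ s.map (s0 h))) :
    MM h (1 ::ₘ s.map (s0 h)) (h + 2) - MM h (1 ::ₘ s.map (s0 h)) (h + h) =
      MM h s (p + 1) - MM h s (p + h) - 1 := by
  have h3 := P.h3
  have hp := P.hp
  have h1 := MM_congr P.core ht (u := h + 2) (v := p + h) (by omega) (by omega) (by
    intro c c1 c2
    exact SS_iff_of (P.mem_eq (by omega) (by omega) (by omega)) (fun _ => by omega)
      (fun _ => P.mem_eq (by omega) (by omega) (by omega)))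
  have t : ¬ SS h (1 ::ₘ s.map (s0 h)) (p + h) := by
    rintro ⟨-, -, -, g⟩
    have := g (by omega)
    rw [Nat.add_sub_cancel, P.mem_t] at this
    omega
  have h4 := (MM_succ ht (p + h) (by omega)).2 t
  have h5 := (MM_succ P.core h (by omega)).1 (SS_h P.core (by omega))
  have h6 := (MM_succ P.core (h + 1) (by omega)).2 (fun g => P.S1 g (by
    rw [Nat.add_mod_left]; exact Nat.mod_eq_of_lt (by omega)))
  rw [show h + 1 + 1 = h + 2 by omega] at h6
  rw [show p + h + 1 = h + h by omega] at h4
  rw [hp]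
  omega

theorem Pz.tS (P : Pz h s p) (ht : Core h (1 ::ₘ s.map (s0 h))) :
    SS h (1 ::ₘ s.map (s0 h)) h ∧ SS h (1 ::ₘ s.map (s0 h)) (h + 1 + h) ∧
    ¬ SS h (1 ::ₘ s.map (s0 h)) (h + 1) ∧ ¬ SS h (1 ::ₘ s.map (s0 h)) (h + h) := by
  have h3 := P.h3
  have hp := P.hp
  refine ⟨SS_h ht (by omega), ⟨by omega, ?_, by omega, fun _ => ?_⟩, ?_, ?_⟩
  · rw [P.mem_t]
    rintro (⟨g, -⟩ | g | g)
    · exact P.one _ (by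
        rw [Nat.add_mod_right, Nat.add_mod_left]; exact Nat.mod_eq_of_lt (by omega)) g
    · omega
    · omega
  · rw [P.mem_t]; omega
  · rintro ⟨-, g, -⟩
    apply g; rw [P.mem_t]; omega
  · rintro ⟨-, -, -, g⟩
    refine ht.dv _ (dvd_refl h) ?_
    have := g (by omega)
    rwa [Nat.add_sub_cancel] at this

theorem case0 {σ : BPartition} (hh : h = 2 * n + 1) (P : Pz h (partsM σ) p)
    (norem : ∀ x, ¬ Removable h 0 σ x) (hσ : IsBarCore h σ)
    (α β γ α' β' γ' : BPartition)
    (hexc : {lam | InBlock h σ 2 lam ∧ ∃ x, Removable h 0 lam x} = {α, β, γ})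
    (ho1 : domLT α β) (ho2 : domLT β γ)
    (hexc' : {mu | InBlock h (psi h 0 σ) 2 mu ∧ ∃ x, Addable h 0 mu x} = {α', β', γ'})
    (ho1' : domLT α' β') (ho2' : domLT β' γ') : Concl h 0 σ (psi h 0 σ) α β γ α' β' γ' := by
  have h3 := P.h3
  have hp := P.hp
  have hc := P.core
  have ht := (psi_s0 h3 hσ.1 norem).1
  have hct : IsBarCore h (psi h 0 σ) → Core h (1 ::ₘ (partsM σ).map (s0 h)) := fun hb => by
    rw [← ht]; exact core_of hh hb
  have s1 : SS h (partsM σ) (p + 1) := by rw [hp]; exact SS_h hc (by omega)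
  have s2 := P.S2
  refine glue hh hσ (opt (p, p + h) (p + 1, p + h) (p + 1, p + 1 + h))
    (opt (h, h + h) (h, h + 1 + h) (h + 1, h + 1 + h)) ?_ ?_ ?_ ?_ ?_ ?_ ?_ ?_ ?_
    (MM h (partsM σ) (p + 1) - MM h (partsM σ) (p + h)) ?_ ?_ ?_ ?_ ?_ α β γ α' β' γ' hexc ho1 ho2
    hexc' ho1' ho2'
  · intro j hj
    have : j = 0 ∨ j = 1 ∨ j = 2 := by omega
    rcases this with rfl | rfl | rfl <;> simp only [opt] <;> omega
  · intro j hj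
    have : j = 0 ∨ j = 1 ∨ j = 2 := by omega
    rcases this with rfl | rfl | rfl <;> simp only [opt] <;> omega
  · simp only [opt, LE2]; omega
  · simp only [opt, LE2]; omega
  · simp only [opt, LE2]; omega
  · simp only [opt, LE2]; omega
  · intro l a b hb hr hbp
    obtain ⟨hT, hE⟩ := bp_ty hh hc hb.1 hbp
    rcases P.identS hT hE (rem_pat0 h3 hr) with h | h | h
    · exact ⟨0, by omega, h⟩
    · exact ⟨1, by omega, h⟩
    · exact ⟨2, by omega, h⟩
  · intro hbt l a b hb hr hbp
    obtain ⟨hT, hE⟩ := bp_ty hh (core_of hh hbt) hb.1 hbp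
    rcases P.identT ht (core_of hh hbt) hT hE (add_pat0 h3 hr) with h | h | h
    · exact ⟨0, by omega, h⟩
    · exact ⟨1, by omega, h⟩
    · exact ⟨2, by omega, h⟩
  · intro l hb H
    exact psi_noadd0 h3 hb.1 H
  · have := MM_lt hc s1 (show p + 1 < p + h by omega)
    omega
  · exact ddA_s hc (by omega) (by omega) s1 s2
  · intro hbt
    have e := P.e (hct hbt)
    have t := P.tS (hct hbt)
    rw [← ht] at e t
    exact ddA_t (core_of hh hbt) (by omega) (by omega) t.1 t.2.1 t.2.2.1 t.2.2.2 e
  · intro hd hbt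
    have e := P.e (hct hbt)
    have t := P.tS (hct hbt)
    have N1 := P.NN_t (h + h)
    have N2 := P.NN_t 1
    have N3 := P.NN_t (h + 1 + h)
    have N4 := P.NN_t 2
    have N5 := P.NN_t h
    rw [if_pos (by omega), if_pos (by omega), if_pos (by omega)] at N1 N3
    rw [if_neg (by omega), if_neg (by omega), if_neg (by omega)] at N2
    rw [if_neg (by omega), if_pos (by omega), if_neg (by omega)] at N4
    rw [if_pos (by omega), if_pos (by omega), if_neg (by omega)] at N5
    have m1 : MM h (partsM σ) h = h - h + 1 + NN (partsM σ) h - NN (partsM σ) (h - h + 1) := by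
      unfold MM; rw [if_pos (by omega)]
    have m2 : MM h (partsM σ) (p + h) = NN (partsM σ) (p + h) - NN (partsM σ) p := by
      unfold MM; rw [if_neg (by omega), Nat.add_sub_cancel]
    have c0 := NN_succ (partsM σ) 0
    have c1 := NN_succ (partsM σ) 1
    have c2 := NN_succ (partsM σ) p
    have c3 := NN_succ (partsM σ) (p + h)
    have c4 := NN_succ (partsM σ) (h + h)
    have c00 : NN (partsM σ) 0 = 0 := by
      unfold NN; simp
    have c0' := Multiset.count_eq_zero.2 (hc.dv 0 (dvd_zero h))
    have c1' := Multiset.count_eq_zero.2 (P.one 1 (Nat.mod_eq_of_lt (by omega)))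
    have c2' := Multiset.count_pos.2 P.pin
    have c2'' := hc.nd p
    have c3' := Multiset.count_eq_zero.2 P.ph
    have c4' := Multiset.count_eq_zero.2 (hc.dv (h + h) (by simp))
    rw [Nat.sub_self, zero_add] at m1
    rw [zero_add] at c0
    rw [show 1 + 1 = 2 from rfl] at c1
    rw [show p + h + 1 = h + h by omega] at c3
    rw [show h + h + 1 = h + 1 + h by omega] at c4
    rw [hp] at c2 hd
    rw [← ht] at e t N1 N2 N3 N4 N5
    refine colA (p := p) (q := h) (v := MM h (partsM σ) (p + h)) hc (core_of hh hbt) (by omega)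
      (by omega) le_rfl s1 s2 t.1 t.2.1 t.2.2.1 t.2.2.2
      (by rw [hp]; omega) rfl (by rw [hp] at e; omega) ?_ ?_ ?_
    · rw [Nat.sub_self, zero_add]; omega
    · rw [Nat.add_sub_cancel_left, show 1 + 1 = 2 from rfl]; omega
    · change NN (partsM (psi h 0 σ)) h = NN (partsM σ) h
      omega
  · intro l a b hb H hbp hj
    obtain ⟨hT, hE⟩ := bp_ty hh hc hb.1 hbp
    have hab := Ty_half (by omega) hT
    have hj0 := hj 0 (by omega)
    simp only [opt] at hj0
    have hne : a ≠ p ∧ b ≠ p := by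
      have Sp : ∀ c, SS h (partsM σ) c → c ≠ p := fun c g e => P.S3 (e ▸ g)
      have S1 : ∀ c, SS h (partsM σ) c → c ≠ h + 1 := fun c g e => P.S1 g (by
        rw [e, Nat.add_mod_left]; exact Nat.mod_eq_of_lt (by omega))
      rcases hT with ⟨_, sa, sb⟩ | ⟨sa, hb⟩ | ⟨sb, hb, ha⟩ | ⟨hs, ha, ha2, sab⟩ | ⟨ha, hb⟩
      · exact ⟨Sp _ sa, Sp _ sb⟩
      · have := Sp _ sa; omega
      · omega
      · rcases sab with g | g
        · have := Sp _ g; omega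
        · have := S1 _ g; omega
      · omega
    have hE' := EqB_s0 h3 hab.1 hab.2 (by omega) (by omega) hE
    rw [← ht, ← (psi_s0 h3 hb.1 H).1] at hE'
    have la := le_s0 (h := h) a
    have lb := le_s0 (h := h) b
    refine ⟨s0 h a, s0 h b, hE', hab.1, hab.2, by omega, by omega, ?_⟩
    have hD := dty_of (F := s0 h) (by omega) hc hT hE (fun c => s0_add c)
      (by
        intro g1 g2 g3
        have e := s0_add (h := h) (h - a)
        rw [s0_small (show h - a + 1 < h by omega), show h - a + h = b by omega] at e
        rw [e, s0_small (show a + 1 < h by omega)]; omega) (s0_h h3)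
    have F2 : s0 h (p + h) = h + h + 1 := by
      rw [s0_add]; unfold s0
      rw [Nat.mod_eq_of_lt (show p < h by omega), if_pos hp]; omega
    exact arithA hc (by omega) (by omega) (by omega) (Or.inr ⟨hp.symm, hp⟩) s1 s2 P.S3 P.S4 rfl rfl
      (by rw [hp]; exact s0_h h3) F2 (fun c hs h1 h2 => by
        unfold s0; rw [if_neg]
        intro g; exact h2 (P.Sm hs g)) hD
      (hj 0 (by omega)) (hj 1 (by omega)) (hj 2 (by omega))

end BPartition
end S14

open BPartition in
/-- In a [2:k]-pair with (i = 0 and k = 3) or (1 ≤ i < n and k = 1), with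
exceptional partitions α ◁ β ◁ γ in P_{σ,2} and α̂ ◁ β̂ ◁ γ̂ in P_{τ,2}: there is
d ≥ 1 with ∂α = ∂γ = ∂β̂ = d and α, γ, β̂ of a common colour; ∂α̂ = ∂β = ∂γ̂ = d−1
and α̂, β, γ̂ of a common colour; and the stated dominance dichotomies hold for
unexceptional λ ∈ P_{σ,2} with ∂λ close to d resp. d−1. -/
theorem stmt19 (n h : ℕ) (hn : 1 ≤ n) (hh : h = 2 * n + 1) (i k : ℕ)
    (hik : (i = 0 ∧ k = 3) ∨ (1 ≤ i ∧ i < n ∧ k = 1))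
    (σ : BPartition) (hσ : IsBarCore h σ)
    (hcnt : Set.ncard {x : ℕ × ℕ | Addable h i σ x} = k)
    (τ : BPartition) (hτ : τ = psi h i σ)
    (α β γ α' β' γ' : BPartition)
    (hexc : {lam | InBlock h σ 2 lam ∧ ∃ x, Removable h i lam x} = {α, β, γ})
    (ho1 : domLT α β) (ho2 : domLT β γ)
    (hexc' : {mu | InBlock h τ 2 mu ∧ ∃ x, Addable h i mu x} = {α', β', γ'})
    (ho1' : domLT α' β') (ho2' : domLT β' γ') :
    ∃ d : ℕ, 1 ≤ d ∧ ∃ c₁ c₂ : Colour,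
      (∀ a b, BarPositions h σ α a b → ddd h σ α a b = d ∧ colour h σ α a b = c₁) ∧
      (∀ a b, BarPositions h σ γ a b → ddd h σ γ a b = d ∧ colour h σ γ a b = c₁) ∧
      (∀ a b, BarPositions h τ β' a b → ddd h τ β' a b = d ∧ colour h τ β' a b = c₁) ∧
      (∀ a b, BarPositions h τ α' a b →
        ddd h τ α' a b = d - 1 ∧ colour h τ α' a b = c₂) ∧
      (∀ a b, BarPositions h σ β a b →
        ddd h σ β a b = d - 1 ∧ colour h σ β a b = c₂) ∧
      (∀ a b, BarPositions h τ γ' a b →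
        ddd h τ γ' a b = d - 1 ∧ colour h τ γ' a b = c₂) ∧
      (∀ lam, InBlock h σ 2 lam → (∀ x, ¬ Removable h i lam x) →
        (∀ a b, BarPositions h σ lam a b → ((ddd h σ lam a b : ℤ) - (d : ℤ)).natAbs ≤ 1) →
        ((domLT γ lam ∧ domLT β' (psi h i lam)) ∨
          (domLT lam α ∧ domLT (psi h i lam) β'))) ∧
      (∀ lam, InBlock h σ 2 lam → (∀ x, ¬ Removable h i lam x) →
        (∀ a b, BarPositions h σ lam a b →
          ((ddd h σ lam a b : ℤ) - ((d : ℤ) - 1)).natAbs ≤ 1) →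
        ((domLT β lam ∧ domLT γ' (psi h i lam)) ∨
          (domLT lam β ∧ domLT (psi h i lam) α'))) := by
  subst hτ
  rcases hik with ⟨rfl, rfl⟩ | ⟨hi, hin, rfl⟩
  · obtain ⟨P, nr⟩ := pz_of (p := 2 * n) (by omega) hh.symm hσ (core_of hh hσ) hcnt
    exact case0 hh P nr hσ α β γ α' β' γ' hexc ho1 ho2 hexc' ho1' ho2'
  · obtain ⟨p, P⟩ := pk_of hh hi hin hσ hcnt
    have := P.pnh
    rcases Nat.lt_or_ge h (2 * p) with g | g
    · exact caseA P g hσ α β γ α' β' γ' hexc ho1 ho2 hexc' ho1' ho2'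
    · exact caseB P (by omega) hσ α β γ α' β' γ' hexc ho1 ho2 hexc' ho1' ho2'
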